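/- Let k be a field of characteristic 0 and let ∂ be a triangular k-derivation of B = k[x,y,z,u], i.e. ∂x = 0, ∂y ∈ k[x], ∂z ∈ k[x,y] and ∂u ∈ k[x,y,z]. Assume that the G_a-action on A^4_k = Spec(B) generated by ∂ is proper, i.e. the k-algebra homomorphism Φ*: B ⊗_k B → B[t] defined by f ⊗ g ↦ f · Σ_{j≥0} (t^j/j!)·∂^j(g) is surjective. Then the action is a translation: there exists s ∈ B with ∂s = 1, the kernel ker ∂ is k-isomorphic to a polynomial ring in three variables over k, and the k-algebra homomorphism (ker ∂)[S] → B sending S to s and restricting to the inclusion on ker ∂ is an isomorphism. -/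

import Mathlib

/- STATEMENT 0: A proper triangular G_a-action on A^4 over a field k of
characteristic 0 is a translation. -/

open MvPolynomial

/-- The kernel of a derivation, as a subalgebra. -/
def kerDer {R B : Type*} [CommRing R] [CommRing B] [Algebra R B]
    (D : Derivation R B B) : Subalgebra R B where
  carrier := {b | D b = 0}
  add_mem' := by
    intro a b ha hb
    simp only [Set.mem_setOf_eq] at ha hb ⊢
    rw [map_add, ha, hb, add_zero]
  mul_mem' := by
    intro a b ha hb
    simp only [Set.mem_setOf_eq] at ha hb ⊢
    rw [D.leibniz, ha, hb, smul_zero, smul_zero, add_zero]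
  algebraMap_mem' := by
    intro r
    show D (algebraMap R B r) = 0
    simp

/-- The truncated exponential `∑_{j<N} (t^j/j!)·D^j(g)` of a derivation, an element of `B[t]`.
If `D^[N] g = 0` this is the full exponential `Σ_{j≥0} (t^j/j!)·D^j(g)`. -/
noncomputable def expPoly {B : Type*} [CommRing B] [Algebra ℚ B]
    (D : B → B) (N : ℕ) (g : B) : Polynomial B :=
  ∑ j ∈ Finset.range N, Polynomial.C ((j.factorial : ℚ)⁻¹ • D^[j] g) * Polynomial.X ^ j

/-- Properness of the `G_a`-action generated by a locally nilpotent derivation `D` of `B`,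
expressed as surjectivity of the homomorphism `Φ* : B ⊗ B → B[t]`,
`f ⊗ g ↦ f · Σ_{j≥0} (t^j/j!)·D^j(g)`: every `h ∈ B[t]` is a finite sum
`Σ_i C (f i) · exp(D)(g i)`. -/
def IsProperGaAction {R B : Type*} [CommRing R] [CommRing B] [Algebra R B] [Algebra ℚ B]
    (D : Derivation R B B) : Prop :=
  ∀ h : Polynomial B, ∃ (m : ℕ) (f g : Fin m → B) (N : ℕ),
    (∀ i, (⇑D)^[N] (g i) = 0) ∧
    h = ∑ i, Polynomial.C (f i) * expPoly (⇑D) N (g i)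

set_option linter.unusedSectionVars false

namespace Polynomial.GaProper
open Polynomial

section Lead
variable {Γ κ : Type*} [AddCommGroup Γ] [LinearOrder Γ] [IsOrderedAddMonoid Γ] [Field κ]

/-- `f = c·π^γ + (higher terms)`; the coefficient `c` may vanish. -/
def Lead (γ : Γ) (c : κ) (f : HahnSeries Γ κ) : Prop :=
  f.coeff γ = c ∧ ∀ g < γ, f.coeff g = 0

theorem Lead.add {γ : Γ} {c c' : κ} {f f' : HahnSeries Γ κ} (h : Lead γ c f) (h' : Lead γ c' f') :
    Lead γ (c + c') (f + f') :=
  ⟨by rw [HahnSeries.coeff_add, h.1, h'.1], fun g hg => by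
    rw [HahnSeries.coeff_add, h.2 g hg, h'.2 g hg, add_zero]⟩

theorem Lead.neg {γ : Γ} {c : κ} {f : HahnSeries Γ κ} (h : Lead γ c f) : Lead γ (-c) (-f) :=
  ⟨by rw [HahnSeries.coeff_neg, h.1], fun g hg => by rw [HahnSeries.coeff_neg, h.2 g hg, neg_zero]⟩

theorem Lead.sub {γ : Γ} {c c' : κ} {f f' : HahnSeries Γ κ} (h : Lead γ c f) (h' : Lead γ c' f') :
    Lead γ (c - c') (f - f') := by
  rw [sub_eq_add_neg, sub_eq_add_neg]; exact h.add h'.neg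

theorem Lead.zero (γ : Γ) : Lead γ (0 : κ) 0 := ⟨rfl, fun _ _ => rfl⟩

theorem Lead.of_lt {γ γ' : Γ} {c : κ} {f : HahnSeries Γ κ} (h : Lead γ c f) (hg : γ' < γ) :
    Lead γ' 0 f := ⟨h.2 _ hg, fun g hg' => h.2 g (hg'.trans hg)⟩

theorem Lead.sum {ι : Type*} {γ : Γ} (s : Finset ι) {c : ι → κ} {f : ι → HahnSeries Γ κ}
    (h : ∀ i ∈ s, Lead γ (c i) (f i)) : Lead γ (∑ i ∈ s, c i) (∑ i ∈ s, f i) := by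
  classical
  induction s using Finset.induction_on with
  | empty => simpa using Lead.zero γ
  | insert a s ha ih =>
    rw [Finset.sum_insert ha, Finset.sum_insert ha]
    exact (h a (by simp)).add (ih fun i hi => h i (by simp [hi]))

theorem Lead.ne_zero {γ : Γ} {c : κ} {f : HahnSeries Γ κ} (h : Lead γ c f) (hc : c ≠ 0) : f ≠ 0 := by
  rintro rfl; exact hc h.1.symm

theorem Lead.order_eq {γ : Γ} {c : κ} {f : HahnSeries Γ κ} (h : Lead γ c f) (hc : c ≠ 0) :
    f.order = γ := by
  apply le_antisymm
  · exact HahnSeries.order_le_of_coeff_ne_zero (by rw [h.1]; exact hc)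
  · by_contra! hlt
    exact h.ne_zero hc (HahnSeries.coeff_order_eq_zero.1 (h.2 _ hlt))

theorem lead_order (f : HahnSeries Γ κ) : Lead f.order f.leadingCoeff f :=
  ⟨HahnSeries.leadingCoeff_eq.symm, fun _ hg => HahnSeries.coeff_eq_zero_of_lt_order hg⟩

theorem Lead.le_order {γ : Γ} {c : κ} {f : HahnSeries Γ κ} (h : Lead γ c f) (hf : f ≠ 0) :
    γ ≤ f.order := by
  by_contra! hlt
  exact hf (HahnSeries.coeff_order_eq_zero.1 (h.2 _ hlt))

theorem Lead.mul {γ γ' : Γ} {c c' : κ} {f f' : HahnSeries Γ κ} (h : Lead γ c f)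
    (h' : Lead γ' c' f') : Lead (γ + γ') (c * c') (f * f') := by
  by_cases hf : f = 0
  · subst hf
    have : c = 0 := h.1.symm
    rw [this, zero_mul, zero_mul]; exact Lead.zero _
  by_cases hf' : f' = 0
  · subst hf'
    have : c' = 0 := h'.1.symm
    rw [this, mul_zero, mul_zero]; exact Lead.zero _
  have h1 := h.le_order hf
  have h2 := h'.le_order hf'
  have ho : (f * f').order = f.order + f'.order := HahnSeries.order_mul hf hf'
  by_cases hc : c = 0
  · have h1' : γ < f.order := lt_of_le_of_ne h1 fun e => by
      subst e
      exact hf (HahnSeries.coeff_order_eq_zero.1 (h.1.trans hc))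
    rw [hc, zero_mul]
    exact (lead_order (f * f')).of_lt (by rw [ho]; exact add_lt_add_of_lt_of_le h1' h2)
  by_cases hc' : c' = 0
  · have h2' : γ' < f'.order := lt_of_le_of_ne h2 fun e => by
      subst e
      exact hf' (HahnSeries.coeff_order_eq_zero.1 (h'.1.trans hc'))
    rw [hc', mul_zero]
    exact (lead_order (f * f')).of_lt (by rw [ho]; exact add_lt_add_of_le_of_lt h1 h2')
  have e1 := h.order_eq hc
  have e2 := h'.order_eq hc'
  have := lead_order (f * f')
  rw [ho, HahnSeries.leadingCoeff_mul, e1, e2, HahnSeries.leadingCoeff_eq,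
    HahnSeries.leadingCoeff_eq, e1, e2, h.1, h'.1] at this
  exact this

theorem Lead.one : Lead (0 : Γ) (1 : κ) 1 := by
  have := lead_order (1 : HahnSeries Γ κ)
  rwa [HahnSeries.order_one, HahnSeries.leadingCoeff_one] at this

theorem Lead.single (γ : Γ) (c : κ) : Lead γ c (HahnSeries.single γ c) :=
  ⟨HahnSeries.coeff_single_same _ _, fun _ hg => HahnSeries.coeff_single_of_ne hg.ne⟩

theorem Lead.congr {γ γ' : Γ} {c c' : κ} {f : HahnSeries Γ κ} (h : Lead γ c f) (hγ : γ = γ')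
    (hc : c = c') : Lead γ' c' f := hγ ▸ hc ▸ h

/-- Coefficientwise version of `Lead` for polynomials. -/
def GLead (γ : Γ) (α : κ[X]) (b : (HahnSeries Γ κ)[X]) : Prop :=
  ∀ k, Lead γ (α.coeff k) (b.coeff k)

theorem GLead.congr {γ γ' : Γ} {c c' : κ[X]} {f : (HahnSeries Γ κ)[X]} (h : GLead γ c f)
    (hγ : γ = γ') (hc : c = c') : GLead γ' c' f := hγ ▸ hc ▸ h

theorem GLead.add {γ : Γ} {α α' : κ[X]} {b b' : (HahnSeries Γ κ)[X]} (h : GLead γ α b)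
    (h' : GLead γ α' b') : GLead γ (α + α') (b + b') := fun k => by
  rw [coeff_add, coeff_add]; exact (h k).add (h' k)

theorem GLead.sub {γ : Γ} {α α' : κ[X]} {b b' : (HahnSeries Γ κ)[X]} (h : GLead γ α b)
    (h' : GLead γ α' b') : GLead γ (α - α') (b - b') := fun k => by
  rw [coeff_sub, coeff_sub]; exact (h k).sub (h' k)

theorem GLead.zero (γ : Γ) : GLead γ (0 : κ[X]) 0 := fun k => by
  simpa using Lead.zero γ

theorem GLead.of_lt {γ γ' : Γ} {α : κ[X]} {b : (HahnSeries Γ κ)[X]} (h : GLead γ α b)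
    (hg : γ' < γ) : GLead γ' 0 b := fun k => by
  simpa using (h k).of_lt hg

theorem GLead.sum {ι : Type*} {γ : Γ} (s : Finset ι) {α : ι → κ[X]} {b : ι → (HahnSeries Γ κ)[X]}
    (h : ∀ i ∈ s, GLead γ (α i) (b i)) : GLead γ (∑ i ∈ s, α i) (∑ i ∈ s, b i) := fun k => by
  rw [finsetSum_coeff, finsetSum_coeff]
  exact Lead.sum s fun i hi => h i hi k

theorem GLead.mul {γ γ' : Γ} {α α' : κ[X]} {b b' : (HahnSeries Γ κ)[X]} (h : GLead γ α b)
    (h' : GLead γ' α' b') : GLead (γ + γ') (α * α') (b * b') := fun k => by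
  rw [coeff_mul, coeff_mul]
  exact Lead.sum _ fun i _ => (h i.1).mul (h' i.2)

theorem GLead.C {γ : Γ} {c : κ} {f : HahnSeries Γ κ} (h : Lead γ c f) :
    GLead γ (C c) (C f) := fun k => by
  rw [coeff_C, coeff_C]; split_ifs
  exacts [h, Lead.zero _]

theorem GLead.one : GLead (0 : Γ) (1 : κ[X]) 1 := by
  simpa using GLead.C (Lead.one (Γ := Γ) (κ := κ))

theorem GLead.X : GLead (0 : Γ) (X : κ[X]) X := fun k => by
  rw [coeff_X, coeff_X]; split_ifs
  exacts [Lead.one, Lead.zero _]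

theorem GLead.pow {γ : Γ} {α : κ[X]} {b : (HahnSeries Γ κ)[X]} (h : GLead γ α b) (n : ℕ) :
    GLead (n • γ) (α ^ n) (b ^ n) := by
  induction n with
  | zero => simpa using GLead.one
  | succ n ih => rw [succ_nsmul, pow_succ, pow_succ]; exact ih.mul h

theorem GLead.prod {ι : Type*} (s : Finset ι) {γ : ι → Γ} {α : ι → κ[X]}
    {b : ι → (HahnSeries Γ κ)[X]} (h : ∀ i ∈ s, GLead (γ i) (α i) (b i)) :
    GLead (∑ i ∈ s, γ i) (∏ i ∈ s, α i) (∏ i ∈ s, b i) := by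
  classical
  induction s using Finset.induction_on with
  | empty => simpa using GLead.one
  | insert a s ha ih =>
    rw [Finset.sum_insert ha, Finset.prod_insert ha, Finset.prod_insert ha]
    exact (h a (by simp)).mul (ih fun i hi => h i (by simp [hi]))

theorem GLead.unique {γ γ' : Γ} {α α' : κ[X]} {b : (HahnSeries Γ κ)[X]} (h : GLead γ α b)
    (h' : GLead γ' α' b) (hα : α ≠ 0) (hα' : α' ≠ 0) : γ = γ' ∧ α = α' := by
  have key : ∀ {γ γ' : Γ} {α α' : κ[X]}, GLead γ α b → GLead γ' α' b → α ≠ 0 → γ' ≤ γ := by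
    intro γ γ' α α' h h' hα
    by_contra! hlt
    apply hα
    ext k
    rw [← (h k).1, (h' k).2 _ hlt, coeff_zero]
  have e : γ = γ' := le_antisymm (key h' h hα') (key h h' hα)
  subst e
  refine ⟨rfl, ?_⟩
  ext k
  rw [← (h k).1, ← (h' k).1]

theorem GLead.lt_of_zero {γ γ' : Γ} {α : κ[X]} {b : (HahnSeries Γ κ)[X]} (h : GLead γ α b)
    (hα : α ≠ 0) (h' : GLead γ' 0 b) : γ' < γ := by
  by_contra! hle
  apply hα
  ext k
  rcases hle.lt_or_eq with hlt | rfl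
  · rw [← (h k).1, (h' k).2 _ hlt, coeff_zero]
  · rw [← (h k).1, (h' k).1]

theorem GLead.comp {γ : Γ} {α r₀ : κ[X]} {b r : (HahnSeries Γ κ)[X]} (h : GLead γ α b)
    (hr : GLead 0 r₀ r) : GLead γ (α.comp r₀) (b.comp r) := by
  rw [comp_eq_sum_left, comp_eq_sum_left, sum_over_range' _ _ (max (α.natDegree+1) (b.natDegree+1)) (by omega),
    sum_over_range' _ _ (max (α.natDegree+1) (b.natDegree+1)) (by omega)]
  · refine GLead.sum _ fun k _ => ?_
    exact ((GLead.C (h k)).mul (hr.pow k)).congr (by simp) rfl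
  · intro; simp
  · intro; simp

theorem GLead.eval {γ : Γ} {α : κ[X]} {c : κ} {b : (HahnSeries Γ κ)[X]} {r : HahnSeries Γ κ}
    (h : GLead γ α b) (hr : Lead 0 c r) : Lead γ (α.eval c) (b.eval r) := by
  have := (h.comp (GLead.C hr)) 0
  simpa [comp_C] using this

end Lead
end Polynomial.GaProper

namespace Polynomial.GaProper
open Polynomial

section ApproxRoot
variable {R : Type*} [CommRing R] [Nontrivial R] [Algebra ℚ R]

/-- Degree drop in one Tschirnhausen step. -/
theorem degree_tschirnhausen {N e : ℕ} (he : 0 < e) {Φ G a r : R[X]}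
    (hG : G.Monic) (hGN : G.natDegree = N) (ha0 : a ≠ 0) (ha : a.degree < N)
    (hr : r.degree < (N * (e - 1) : ℕ)) (hΦ : Φ = G ^ e + a * G ^ (e - 1) + r) :
    (Φ - (G + (e : ℚ)⁻¹ • a) ^ e).degree < (Φ - G ^ e).degree := by
  set G' := G + (e : ℚ)⁻¹ • a with hG'
  have hGd : G.degree = N := by rw [degree_eq_natDegree hG.ne_zero, hGN]
  have hqa : ((e : ℚ)⁻¹ • a).degree < G.degree := by
    rw [hGd]; exact (degree_smul_le _ _).trans_lt ha
  have hG'm : G'.Monic := hG.add_of_left hqa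
  have hG'd : G'.natDegree = N := by
    rw [hG', natDegree_add_eq_left_of_degree_lt hqa, hGN]
  have hpow : ∀ {H : R[X]}, H.Monic → H.natDegree = N → ∀ i : ℕ, (H ^ i).degree = (N * i : ℕ) := by
    intro H hH hN i
    rw [degree_eq_natDegree (hH.pow i).ne_zero, hH.natDegree_pow, hN, mul_comm]
  have hada : (a * G ^ (e - 1)).degree = a.degree + (N * (e - 1) : ℕ) := by
    rw [(hG.pow _).degree_mul, hpow hG hGN]
  have hlow : r.degree < (a * G ^ (e - 1)).degree := by
    rw [hada]
    refine hr.trans_le ?_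
    have : (0 : WithBot ℕ) ≤ a.degree := zero_le_degree_iff.2 ha0
    calc ((N * (e - 1) : ℕ) : WithBot ℕ) = 0 + (N * (e - 1) : ℕ) := by simp
      _ ≤ _ := by gcongr
  have h1 : (Φ - G ^ e).degree = a.degree + (N * (e - 1) : ℕ) := by
    rw [hΦ, show G ^ e + a * G ^ (e - 1) + r - G ^ e = a * G ^ (e - 1) + r by ring,
      degree_add_eq_left_of_degree_lt hlow, hada]
  have h2 : Φ - G' ^ e = r - (e : ℚ)⁻¹ • a *
      ∑ i ∈ Finset.range e, (G' ^ i - G ^ i) * G ^ (e - 1 - i) := by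
    have hgs := (Commute.all G' G).mul_geom_sum₂ e
    have hs : (∑ i ∈ Finset.range e, (G' ^ i - G ^ i) * G ^ (e - 1 - i)) =
        (∑ i ∈ Finset.range e, G' ^ i * G ^ (e - 1 - i)) - (e : R[X]) * G ^ (e - 1) := by
      simp_rw [sub_mul]
      rw [Finset.sum_sub_distrib]
      congr 1
      rw [Finset.sum_congr rfl (g := fun _ => G ^ (e - 1))]
      · simp
      · intro i hi
        rw [← pow_add]; congr 1
        have := Finset.mem_range.1 hi; omega
    rw [hs]
    have h3 : G' - G = (e : ℚ)⁻¹ • a := by rw [hG']; ring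
    rw [h3] at hgs
    have h4 : (e : ℚ)⁻¹ • a * ((e : R[X]) * G ^ (e - 1)) = a * G ^ (e - 1) := by
      rw [← mul_assoc, smul_mul_assoc, mul_comm a, ← nsmul_eq_mul, ← Nat.cast_smul_eq_nsmul ℚ, smul_smul,
        inv_mul_cancel₀ (by exact_mod_cast he.ne'), one_smul]
    rw [mul_sub, h4, hgs, hΦ]
    ring
  rw [h1, h2]
  refine (degree_sub_le _ _).trans_lt (max_lt ?_ ?_)
  · rw [← hada]; exact hlow
  have h5 : (∑ i ∈ Finset.range e, (G' ^ i - G ^ i) * G ^ (e - 1 - i)).degree <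
      (N * (e - 1) : ℕ) := by
    refine (degree_sum_le _ _).trans_lt ?_
    rw [Finset.sup_lt_iff (WithBot.bot_lt_coe _)]
    intro i hi
    have hi' := Finset.mem_range.1 hi
    rw [(hG.pow _).degree_mul, hpow hG hGN]
    have h6 : (G' ^ i - G ^ i).degree < (N * i : ℕ) := by
      rw [← hpow hG'm hG'd i]
      apply degree_sub_lt_left
      · rw [hpow hG'm hG'd, hpow hG hGN]
      · exact (hG'm.pow i).ne_zero
      · rw [hG'm.pow i, hG.pow i]
    calc (G' ^ i - G ^ i).degree + ((N * (e - 1 - i) : ℕ) : WithBot ℕ)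
        < ((N * i : ℕ) : WithBot ℕ) + ((N * (e - 1 - i) : ℕ) : WithBot ℕ) :=
          WithBot.add_lt_add_right (WithBot.coe_ne_bot) h6
      _ = _ := by
          rw [← Nat.cast_add]; congr 1; rw [← mul_add]; congr 1; omega
  refine (degree_mul_le _ _).trans_lt ?_
  calc ((e : ℚ)⁻¹ • a).degree + _ ≤ a.degree + _ := by gcongr; exact degree_smul_le _ _
    _ < _ := WithBot.add_lt_add_left (by simpa using ha0) h5

/-- Existence of approximate roots inside a class of polynomials stable under Tschirnhausen
steps. -/
theorem exists_approxRoot {N e : ℕ} (he : 0 < e) {Φ : R[X]} (hΦ : Φ.Monic)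
    (hΦN : Φ.natDegree = N * e) (P : R[X] → Prop)
    (hstep : ∀ G a r : R[X], G.Monic → G.natDegree = N → P G → a.degree < N →
      r.degree < (N * (e - 1) : ℕ) → Φ = G ^ e + a * G ^ (e - 1) + r →
      P (G + (e : ℚ)⁻¹ • a))
    {G₀ : R[X]} (hG₀ : G₀.Monic) (hG₀N : G₀.natDegree = N) (hP : P G₀) :
    ∃ G : R[X], G.Monic ∧ G.natDegree = N ∧ P G ∧ (Φ - G ^ e).degree < (N * (e - 1) : ℕ) := by
  induction hd : (Φ - G₀ ^ e).degree using WellFoundedLT.induction generalizing G₀ with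
  | _ d ih =>
  subst hd
  set a := (Φ - G₀ ^ e) /ₘ (G₀ ^ (e - 1)) with ha
  set r := (Φ - G₀ ^ e) %ₘ (G₀ ^ (e - 1)) with hr
  have hm := hG₀.pow (e - 1)
  have hpow : ∀ i : ℕ, (G₀ ^ i).degree = (N * i : ℕ) := by
    intro i
    rw [degree_eq_natDegree (hG₀.pow i).ne_zero, hG₀.natDegree_pow, hG₀N, mul_comm]
  have hdec : Φ = G₀ ^ e + a * G₀ ^ (e - 1) + r := by
    have := modByMonic_add_div (Φ - G₀ ^ e) (G₀ ^ (e - 1))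
    rw [ha, hr]; linear_combination -this
  have hrd : r.degree < (N * (e - 1) : ℕ) := by
    rw [← hpow]; exact degree_modByMonic_lt _ hm
  by_cases ha0 : a = 0
  · refine ⟨G₀, hG₀, hG₀N, hP, ?_⟩
    rw [hdec, ha0]; simpa using hrd
  have hlt : (Φ - G₀ ^ e).degree < (N * e : ℕ) := by
    rw [← hΦN, ← degree_eq_natDegree hΦ.ne_zero]
    apply degree_sub_lt_left
    · rw [hpow, degree_eq_natDegree hΦ.ne_zero, hΦN]
    · exact hΦ.ne_zero
    · rw [hΦ, hG₀.pow e]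
  have had : a.degree < N := by
    by_contra! hge
    have h1 : (a * G₀ ^ (e - 1)).degree = a.degree + (N * (e - 1) : ℕ) := by
      rw [hm.degree_mul, hpow]
    have h2 : a * G₀ ^ (e - 1) = (Φ - G₀ ^ e) - r := by rw [hdec]; ring
    have h3 : (a * G₀ ^ (e - 1)).degree < (N * e : ℕ) := by
      rw [h2]
      refine (degree_sub_le _ _).trans_lt (max_lt hlt (hrd.trans_le ?_))
      exact_mod_cast Nat.mul_le_mul_left _ (by omega)
    rw [h1] at h3
    have h4 : ((N * e : ℕ) : WithBot ℕ) ≤ a.degree + (N * (e - 1) : ℕ) := by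
      calc ((N * e : ℕ) : WithBot ℕ) = (N : WithBot ℕ) + (N * (e - 1) : ℕ) := by
            rw [← Nat.cast_add]; congr 1
            obtain ⟨e, rfl⟩ := Nat.exists_eq_succ_of_ne_zero he.ne'
            simp; ring
        _ ≤ _ := by gcongr
    exact absurd h3 (not_lt.2 h4)
  have hqa : ((e : ℚ)⁻¹ • a).degree < G₀.degree := by
    rw [degree_eq_natDegree hG₀.ne_zero, hG₀N]; exact (degree_smul_le _ _).trans_lt had
  refine ih _ ?_ (hG₀.add_of_left hqa) ?_ (hstep G₀ a r hG₀ hG₀N hP had hrd hdec) rfl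
  · exact degree_tschirnhausen he hG₀ hG₀N ha0 had hrd hdec
  · rw [natDegree_add_eq_left_of_degree_lt hqa, hG₀N]

theorem approxRoot_unique {R : Type*} [CommRing R] [IsDomain R] [Algebra ℚ R] {N e : ℕ} (he : 0 < e) {Φ F G : R[X]} (hF : F.Monic)
    (hG : G.Monic) (hFN : F.natDegree = N) (hGN : G.natDegree = N)
    (h1 : (Φ - F ^ e).degree < (N * (e - 1) : ℕ))
    (h2 : (Φ - G ^ e).degree < (N * (e - 1) : ℕ)) : F = G := by
  have : CharZero R := algebraRat.charZero R
  by_contra hne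
  have hgs := (Commute.all F G).mul_geom_sum₂ e
  have h3 : (F ^ e - G ^ e).degree < (N * (e - 1) : ℕ) := by
    rw [show F ^ e - G ^ e = (Φ - G ^ e) - (Φ - F ^ e) by ring]
    exact (degree_sub_le _ _).trans_lt (max_lt h2 h1)
  have h4 : ((N * (e - 1) : ℕ) : WithBot ℕ) ≤
      (∑ i ∈ Finset.range e, F ^ i * G ^ (e - 1 - i)).degree := by
    apply le_degree_of_ne_zero
    have h5 : ∀ i ∈ Finset.range e, (F ^ i * G ^ (e - 1 - i)).coeff (N * (e - 1)) = 1 := by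
      intro i hi
      have hi' := Finset.mem_range.1 hi
      have hm := (hF.pow i).mul (hG.pow (e - 1 - i))
      have hd : (F ^ i * G ^ (e - 1 - i)).natDegree = N * (e - 1) := by
        rw [(hF.pow i).natDegree_mul (hG.pow _), hF.natDegree_pow, hG.natDegree_pow, hFN, hGN,
          ← add_mul, mul_comm]
        congr 1; omega
      rw [← hd]; exact hm.coeff_natDegree
    rw [finsetSum_coeff, Finset.sum_congr rfl h5]
    simp [he.ne']
  rw [← hgs, degree_mul] at h3
  have h6 : (0 : WithBot ℕ) ≤ (F - G).degree := zero_le_degree_iff.2 (sub_ne_zero.2 hne)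
  have : ((N * (e - 1) : ℕ) : WithBot ℕ) ≤ (F - G).degree +
    (∑ i ∈ Finset.range e, F ^ i * G ^ (e - 1 - i)).degree := by
    calc ((N * (e - 1) : ℕ) : WithBot ℕ) = 0 + (N * (e - 1) : ℕ) := by simp
      _ ≤ _ := by gcongr
  exact absurd h3 (not_lt.2 this)

/-- Expansion of a polynomial in powers of a monic polynomial, compatible with a given
endomorphism of the coefficient ring. -/
theorem exists_adic_expansion {N : ℕ} {G : R[X]} (hG : G.Monic) (hGN : G.natDegree = N)
    (τ : R →+* R) (hGτ : G.map τ = G) (n : ℕ)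
    {b : R[X]} (hbτ : b.map τ = b) (hb : b.degree < (N * n : ℕ)) :
    ∃ a : ℕ → R[X], (∀ k, (a k).map τ = a k) ∧ (∀ k, (a k).degree < N) ∧
      b = ∑ k ∈ Finset.range n, a k * G ^ k := by
  induction n generalizing b with
  | zero =>
    refine ⟨fun _ => 0, fun k => by simp, fun k => by simp, ?_⟩
    have h0 : b = 0 := by
      by_contra h
      have h1 := zero_le_degree_iff.2 h
      exact absurd hb (by simpa using h)
    simp [h0]
  | succ n ih =>
    have hm := hG.pow n
    have hpow : (G ^ n).degree = (N * n : ℕ) := by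
      rw [degree_eq_natDegree hm.ne_zero, hG.natDegree_pow, hGN, mul_comm]
    have hGnτ : (G ^ n).map τ = G ^ n := by rw [Polynomial.map_pow, hGτ]
    obtain ⟨a, haτ, ha, hab⟩ := ih (b := b %ₘ G ^ n) (by rw [map_modByMonic τ hm, hbτ, hGnτ]) (by rw [← hpow]; exact degree_modByMonic_lt _ hm)
    have hq : (b /ₘ G ^ n).degree < N := by
      by_contra! hge
      have h1 : (b /ₘ G ^ n * G ^ n).degree = (b /ₘ G ^ n).degree + (N * n : ℕ) := by
        rw [hm.degree_mul, hpow]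
      have h2 : b /ₘ G ^ n * G ^ n = b - b %ₘ G ^ n := by
        have := modByMonic_add_div b (G ^ n); linear_combination this
      have h3 : (b /ₘ G ^ n * G ^ n).degree < (N * (n + 1) : ℕ) := by
        rw [h2]
        refine (degree_sub_le _ _).trans_lt (max_lt hb ((degree_modByMonic_lt _ hm).trans_le ?_))
        rw [hpow]; exact_mod_cast Nat.mul_le_mul_left _ (by omega)
      rw [h1] at h3
      have h4 : ((N * (n + 1) : ℕ) : WithBot ℕ) ≤ (b /ₘ G ^ n).degree + (N * n : ℕ) := by
        calc ((N * (n + 1) : ℕ) : WithBot ℕ) = (N : WithBot ℕ) + (N * n : ℕ) := by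
              rw [← Nat.cast_add]; congr 1; ring
          _ ≤ _ := by gcongr
      exact absurd h3 (not_lt.2 h4)
    refine ⟨fun k => if k = n then b /ₘ G ^ n else a k, fun k => ?_, fun k => ?_, ?_⟩
    · dsimp only; split_ifs; exacts [by rw [map_divByMonic τ hm, hbτ, hGnτ], haτ k]
    · dsimp only; split_ifs; exacts [hq, ha k]
    · dsimp only
      rw [Finset.sum_range_succ, if_pos rfl, Finset.sum_congr rfl
        (g := fun k => a k * G ^ k), ← hab]
      · have := modByMonic_add_div b (G ^ n); linear_combination -this
      · intro k hk
        rw [if_neg (Finset.mem_range.1 hk).ne]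

end ApproxRoot
end Polynomial.GaProper

namespace Polynomial.GaProper
open Polynomial

/-- A Hahn field together with an automorphism of order `m` multiplying the leading coefficient of
a series by a power of a primitive `m`-th root of unity determined by its order. -/
structure Twist (Γ κ : Type*) [AddCommGroup Γ] [LinearOrder Γ] [IsOrderedAddMonoid Γ] [Field κ]
    (m : ℕ) where
  d : Γ →+ ℤ
  σ : HahnSeries Γ κ →+* HahnSeries Γ κ
  ω : κ
  prim : IsPrimitiveRoot ω m
  lead : ∀ {γ c f}, Lead γ c f → Lead γ (ω ^ d γ * c) (σ f)
  pow_m : σ ^ m = 1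

namespace Twist
variable {Γ κ : Type*} [AddCommGroup Γ] [LinearOrder Γ] [IsOrderedAddMonoid Γ] [Field κ] [CharZero κ]
  {m : ℕ} (T : Twist Γ κ m)

theorem lead_pow {γ : Γ} {c : κ} {f : HahnSeries Γ κ} (h : Lead γ c f) (k : ℕ) :
    Lead γ ((T.ω ^ T.d γ) ^ k * c) ((T.σ ^ k) f) := by
  induction k with
  | zero => simpa using h
  | succ k ih =>
    rw [pow_succ', pow_succ', mul_assoc]
    exact T.lead ih

/-- The average of `f` under the subgroup generated by `σ ^ N`. -/
noncomputable def avg (N e : ℕ) (f : HahnSeries Γ κ) : HahnSeries Γ κ :=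
  (e : HahnSeries Γ κ)⁻¹ * ∑ j ∈ Finset.range e, (T.σ ^ (N * j)) f

theorem natCast_ne_zero {e : ℕ} (he : e ≠ 0) : (e : HahnSeries Γ κ) ≠ 0 := by
  have : (e : HahnSeries Γ κ) = HahnSeries.C (e : κ) := by simp
  rw [this]
  exact HahnSeries.C_ne_zero (by exact_mod_cast he)

theorem pow_eq_self {N e : ℕ} (hm : m = N * e) (f : HahnSeries Γ κ) : (T.σ ^ (N * e)) f = f := by
  rw [← hm, T.pow_m]; rfl

theorem σ_avg {N e : ℕ} (hm : m = N * e) (f : HahnSeries Γ κ) :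
    (T.σ ^ N) (T.avg N e f) = T.avg N e f := by
  unfold avg
  rw [map_mul, map_inv₀, map_natCast, map_sum]
  congr 1
  have h : ∀ j, (T.σ ^ N) ((T.σ ^ (N * j)) f) = (T.σ ^ (N * (j + 1))) f := by
    intro j
    rw [mul_add, mul_one, add_comm, pow_add]; rfl
  simp_rw [h]
  have h1 := Finset.sum_range_succ (fun j => (T.σ ^ (N * j)) f) e
  have h2 := Finset.sum_range_succ' (fun j => (T.σ ^ (N * j)) f) e
  rw [h2] at h1
  have h3 : (T.σ ^ (N * e)) f = (T.σ ^ (N * 0)) f := by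
    rw [T.pow_eq_self hm]; simp
  rw [h3] at h1
  exact add_right_cancel h1

theorem avg_of_fixed {N e : ℕ} (he : e ≠ 0) {f : HahnSeries Γ κ} (hf : (T.σ ^ N) f = f) :
    T.avg N e f = f := by
  have h : ∀ j, (T.σ ^ (N * j)) f = f := by
    intro j
    induction j with
    | zero => simp
    | succ j ih =>
      rw [mul_add, mul_one, pow_add, RingHom.mul_def, RingHom.comp_apply, hf, ih]
  unfold avg
  simp_rw [h]
  simp [natCast_ne_zero he]

theorem avg_sub (N e : ℕ) (f g : HahnSeries Γ κ) :
    T.avg N e (f - g) = T.avg N e f - T.avg N e g := by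
  unfold avg
  simp_rw [map_sub]
  rw [Finset.sum_sub_distrib, mul_sub]

theorem lead_natCast_inv {e : ℕ} (he : e ≠ 0) :
    Lead (0 : Γ) ((e : κ)⁻¹) ((e : HahnSeries Γ κ)⁻¹) := by
  have : (e : HahnSeries Γ κ)⁻¹ = HahnSeries.single 0 ((e : κ)⁻¹) := by
    apply inv_eq_of_mul_eq_one_right
    have h2 : (e : HahnSeries Γ κ) = HahnSeries.single 0 (e : κ) := by
      rw [← HahnSeries.C_apply]; simp
    rw [h2, HahnSeries.single_mul_single]
    simp [he]
  rw [this]; exact Lead.single _ _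

theorem lead_avg {N e : ℕ} (he : e ≠ 0) {γ : Γ} {c : κ} {f : HahnSeries Γ κ} (h : Lead γ c f) :
    Lead γ ((e : κ)⁻¹ * ∑ j ∈ Finset.range e, (T.ω ^ T.d γ) ^ (N * j) * c) (T.avg N e f) := by
  exact ((lead_natCast_inv he).mul (Lead.sum _ fun j _ => T.lead_pow h (N * j))).congr (zero_add _) rfl

/-- The deviation from the average has an order on which the subgroup acts nontrivially. -/
theorem ne_one_of_lead_sub_avg {N e : ℕ} (he : e ≠ 0) (hm : m = N * e) {γ : Γ} {c : κ}
    {f : HahnSeries Γ κ} (hc : c ≠ 0) (h : Lead γ c (f - T.avg N e f)) :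
    (T.ω ^ T.d γ) ^ N ≠ 1 := by
  intro h1
  have h2 := T.lead_avg (N := N) he h
  rw [avg_sub, T.avg_of_fixed he (T.σ_avg hm f), sub_self] at h2
  simp_rw [pow_mul, h1, one_pow, one_mul] at h2
  have : ((e : κ)⁻¹ * ∑ j ∈ Finset.range e, c) = c := by
    simp [he]
  rw [this] at h2
  exact h2.ne_zero hc rfl

/-- Substitution of the generic point of the ball of radius `γ` around `a`. -/
noncomputable def ball (a : HahnSeries Γ κ) (γ : Γ) : (HahnSeries Γ κ)[X] :=
  C a + C (HahnSeries.single γ 1) * X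

/-- Polynomials of degree `< N` fixed by `σ` are constant to first order on the given ball. -/
def Steady (N e : ℕ) (a : HahnSeries Γ κ) (γ : Γ) : Prop :=
  ∀ b : (HahnSeries Γ κ)[X], b.map T.σ = b → b ≠ 0 → b.degree < N →
    ∃ ν c, c ≠ 0 ∧ (e : ℤ) ∣ T.d ν ∧ GLead ν (C c) (b.comp (ball a γ))

theorem gLead_ball_sub {a f : HahnSeries Γ κ} {γ : Γ} {c : κ} (h : Lead γ c (f - a)) :
    GLead γ (X - C c) ((X - C f).comp (ball a γ)) := by
  have h1 : (X - C f).comp (ball a γ) =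
      C (HahnSeries.single γ 1) * X - C (f - a) := by
    simp [ball]; ring
  rw [h1]
  exact (((GLead.C (Lead.single γ 1)).mul GLead.X).congr (add_zero _) (by simp)).sub (GLead.C h)

theorem gLead_ball_far {a f : HahnSeries Γ κ} {γ ν : Γ} {c : κ} (hν : ν < γ)
    (h : Lead ν c (a - f)) :
    GLead ν (C c) ((X - C f).comp (ball a γ)) := by
  have h1 : (X - C f).comp (ball a γ) =
      C (a - f) + C (HahnSeries.single γ 1) * X := by
    simp [ball]; ring
  rw [h1]
  exact ((GLead.C h).add (((GLead.C (Lead.single γ 1)).mul GLead.X).of_lt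
    (by rwa [add_zero]))).congr rfl (add_zero _)

theorem sum_pow_eq_zero {ξ : κ} {e : ℕ} (h1 : ξ ≠ 1) (h2 : ξ ^ e = 1) :
    ∑ j ∈ Finset.range e, ξ ^ j = 0 := by
  have := mul_geom_sum ξ e
  rw [h2, sub_self] at this
  exact (mul_eq_zero.1 this).resolve_left (sub_ne_zero.2 h1)

theorem coeff_prod_X_sub {ξ c : κ} {e : ℕ} (he : 0 < e) (h1 : ξ ≠ 1) (h2 : ξ ^ e = 1) :
    (∏ j ∈ Finset.range e, (X - C (ξ ^ j * c))).coeff (e - 1) = 0 ∧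
    (∏ j ∈ Finset.range e, (X - C (ξ ^ j * c))).coeff e = 1 := by
  have hmon : (∏ j ∈ Finset.range e, (X - C (ξ ^ j * c))).Monic :=
    monic_prod_of_monic _ _ fun _ _ => monic_X_sub_C _
  have hd : (∏ j ∈ Finset.range e, (X - C (ξ ^ j * c))).natDegree = e := by
    rw [natDegree_prod_of_monic _ _ fun _ _ => monic_X_sub_C _,
      Finset.sum_congr rfl fun j _ => natDegree_X_sub_C _]
    simp
  constructor
  · have := prod_X_sub_C_coeff_card_pred (Finset.range e) (fun j => ξ ^ j * c) (by simpa using he)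
    rw [Finset.card_range] at this
    rw [this, ← Finset.sum_mul, sum_pow_eq_zero h1 h2]; simp
  · have := hmon.coeff_natDegree; rwa [hd] at this

end Twist
end Polynomial.GaProper

namespace Polynomial.GaProper
open Polynomial

section
variable {Γ κ : Type*} [AddCommGroup Γ] [LinearOrder Γ] [IsOrderedAddMonoid Γ] [Field κ]

theorem exists_common_gLead (n : ℕ) (b : ℕ → (HahnSeries Γ κ)[X]) (Q : ℕ → Γ → Prop)
    (h : ∀ k < n, b k = 0 ∨ ∃ ν c, c ≠ 0 ∧ Q k ν ∧ GLead ν (C c * X ^ k) (b k))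
    (hne : ∃ k < n, b k ≠ 0) :
    ∃ (ν : Γ) (β : ℕ → κ), (∀ k < n, GLead ν (C (β k) * X ^ k) (b k)) ∧
      (∃ k < n, β k ≠ 0) ∧ (∀ k < n, β k ≠ 0 → Q k ν) := by
  classical
  have h' : ∀ k, ∃ (ν : Γ) (c : κ), k < n → b k ≠ 0 →
      (c ≠ 0 ∧ Q k ν ∧ GLead ν (C c * X ^ k) (b k)) := by
    intro k
    by_cases hk : k < n ∧ b k ≠ 0
    · obtain ⟨ν, c, hc⟩ := (h k hk.1).resolve_left hk.2
      exact ⟨ν, c, fun _ _ => hc⟩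
    · exact ⟨0, 0, fun h1 h2 => absurd ⟨h1, h2⟩ hk⟩
  choose ν c hc using h'
  obtain ⟨k₁, hk₁⟩ := hne
  obtain ⟨k₀, hk₀, hmin⟩ := Finset.exists_min_image ((Finset.range n).filter fun k => b k ≠ 0) ν
    ⟨k₁, by simpa using hk₁⟩
  simp only [Finset.mem_filter, Finset.mem_range] at hk₀ hmin
  refine ⟨ν k₀, fun k => if b k ≠ 0 ∧ ν k = ν k₀ then c k else 0, fun k hk => ?_,
    ⟨k₀, hk₀.1, ?_⟩, fun k hk hβ => ?_⟩
  · dsimp only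
    split_ifs with h1
    · rw [← h1.2]; exact (hc k hk h1.1).2.2
    · by_cases h2 : b k = 0
      · rw [h2]; simpa using GLead.zero (ν k₀)
      · have h3 : ν k₀ < ν k := lt_of_le_of_ne (hmin k ⟨hk, h2⟩) fun h => h1 ⟨h2, h.symm⟩
        simpa using (hc k hk h2).2.2.of_lt h3
  · dsimp only
    rw [if_pos ⟨hk₀.2, rfl⟩]; exact (hc k₀ hk₀.1 hk₀.2).1
  · dsimp only at hβ
    split_ifs at hβ with h1
    · rw [← h1.2]; exact (hc k hk h1.1).2.1
    · exact absurd rfl hβ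

theorem coeff_sum_C_mul_X_pow (n : ℕ) (β : ℕ → κ) {k : ℕ} (hk : k < n) :
    (∑ i ∈ Finset.range n, C (β i) * X ^ i : κ[X]).coeff k = β k := by
  rw [finsetSum_coeff]
  simp_rw [coeff_C_mul_X_pow]
  rw [Finset.sum_ite_eq]; simp [hk]

/-- If a sum of monomial-like terms has leading form `α`, each term has as leading form the
corresponding monomial of `α`. -/
theorem gLead_terms (n : ℕ) (b : ℕ → (HahnSeries Γ κ)[X])
    (h : ∀ k < n, b k = 0 ∨ ∃ ν c, c ≠ 0 ∧ GLead ν (C c * X ^ k) (b k))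
    {ω : Γ} {α : κ[X]} (hα : α ≠ 0) (hs : GLead ω α (∑ k ∈ Finset.range n, b k)) {k : ℕ}
    (hk : k < n) : GLead ω (C (α.coeff k) * X ^ k) (b k) := by
  have hne : ∃ k < n, b k ≠ 0 := by
    by_contra! h0
    rw [Finset.sum_eq_zero fun k hk => h0 k (Finset.mem_range.1 hk)] at hs
    exact hα (Polynomial.ext fun i => (hs i).1.symm)
  obtain ⟨ν, β, h1, ⟨k₀, hk₀, hβ⟩, -⟩ := exists_common_gLead n b (fun _ _ => True)
    (fun k hk => (h k hk).imp_right fun ⟨ν, c, hc, h⟩ => ⟨ν, c, hc, trivial, h⟩) hne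
  have h2 : GLead ν _ (∑ k ∈ Finset.range n, b k) := GLead.sum _ fun k hk =>
    h1 k (Finset.mem_range.1 hk)
  have h3 : (∑ i ∈ Finset.range n, C (β i) * X ^ i : κ[X]) ≠ 0 := by
    intro h0
    apply hβ
    rw [← coeff_sum_C_mul_X_pow n β hk₀, h0, coeff_zero]
  obtain ⟨rfl, rfl⟩ := h2.unique hs h3 hα
  rw [coeff_sum_C_mul_X_pow n β hk]
  exact h1 k hk

theorem natDegree_prod_X_sub_C_range {R : Type*} [CommRing R] [Nontrivial R] (n : ℕ) (f : ℕ → R) :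
    (∏ k ∈ Finset.range n, (X - C (f k))).natDegree = n := by
  rw [natDegree_prod_of_monic _ _ fun _ _ => monic_X_sub_C _,
      Finset.sum_congr rfl fun j _ => natDegree_X_sub_C _]
  simp

end

namespace Twist
variable {Γ κ : Type*} [AddCommGroup Γ] [LinearOrder Γ] [IsOrderedAddMonoid Γ] [Field κ] [CharZero κ]
  {m : ℕ} (T : Twist Γ κ m)

theorem map_prod_orbit {N : ℕ} {f : HahnSeries Γ κ} (hf : (T.σ ^ N) f = f) :
    (∏ k ∈ Finset.range N, (X - C ((T.σ ^ k) f))).map T.σ =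
      ∏ k ∈ Finset.range N, (X - C ((T.σ ^ k) f)) := by
  rw [Polynomial.map_prod]
  have h : ∀ k, (X - C ((T.σ ^ k) f)).map T.σ = X - C ((T.σ ^ (k + 1)) f) := by
    intro k
    rw [Polynomial.map_sub, map_X, map_C, pow_succ']; rfl
  simp_rw [h]
  rcases N with _ | N
  · simp
  · rw [Finset.prod_range_succ, Finset.prod_range_succ', hf]; simp

theorem tschirnhausen_step {N e : ℕ} (he : 0 < e) {a : HahnSeries Γ κ} {γ : Γ}
    (hst : T.Steady N e a γ)
    {G b r Φ : (HahnSeries Γ κ)[X]} (hGm : G.Monic) (hGN : G.natDegree = N) (hGσ : G.map T.σ = G)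
    {ωG : Γ} {cG : κ} (hcG : cG ≠ 0) (hG : GLead ωG (C cG * X) (G.comp (ball a γ)))
    (hb : b.degree < N) (hr : r.degree < (N * (e - 1) : ℕ))
    (hΦ : Φ = G ^ e + b * G ^ (e - 1) + r) (hΦσ : Φ.map T.σ = Φ)
    {ωΦ : Γ} {α : κ[X]} (hα : GLead ωΦ α (Φ.comp (ball a γ))) (hα1 : α.coeff (e - 1) = 0)
    (hα2 : α.coeff e ≠ 0) :
    e • ωG = ωΦ ∧ (G + C ((e : HahnSeries Γ κ)⁻¹) * b).map T.σ = G + C ((e : HahnSeries Γ κ)⁻¹) * b ∧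
      GLead ωG (C cG * X) ((G + C ((e : HahnSeries Γ κ)⁻¹) * b).comp (ball a γ)) := by
  have hbσ : b.map T.σ = b := by
    have h1 := hΦσ
    rw [hΦ] at h1
    simp only [Polynomial.map_add, Polynomial.map_mul, Polynomial.map_pow, hGσ] at h1
    by_contra hne
    have h2 : (b.map T.σ - b) * G ^ (e - 1) = r - r.map T.σ := by linear_combination h1
    have h3 : (r - r.map T.σ).degree < (N * (e - 1) : ℕ) :=
      (degree_sub_le _ _).trans_lt (max_lt hr ((degree_map_le).trans_lt hr))
    rw [← h2, degree_mul, degree_pow, degree_eq_natDegree hGm.ne_zero, hGN,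
      degree_eq_natDegree (sub_ne_zero.2 hne)] at h3
    have h4 : (b.map T.σ - b).natDegree + (e - 1) * N < N * (e - 1) := by
      rw [nsmul_eq_mul] at h3
      exact_mod_cast h3
    rw [mul_comm N] at h4
    omega
  have hrσ : r.map T.σ = r := by
    have h1 := hΦσ
    rw [hΦ] at h1
    simp only [Polynomial.map_add, Polynomial.map_mul, Polynomial.map_pow, hGσ, hbσ] at h1
    linear_combination h1
  obtain ⟨A, hAσ, hAd, hA⟩ := exists_adic_expansion hGm hGN T.σ hGσ (e - 1) hrσ hr
  -- uniform expansion
  let B : ℕ → (HahnSeries Γ κ)[X] := fun k => if k = e then 1 else if k = e - 1 then b else A k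
  have hBe : B e = 1 := by simp [B]
  have hBe1 : B (e - 1) = b := by simp [B]; omega
  have hB : ∀ k < e - 1, B k = A k := by
    intro k hk
    simp only [B]; rw [if_neg (by omega), if_neg (by omega)]
  have hsum : Φ.comp (ball a γ) = ∑ k ∈ Finset.range (e + 1), (B k * G ^ k).comp (ball a γ) := by
    rw [← Polynomial.sum_comp]
    congr 1
    obtain ⟨e, rfl⟩ : ∃ e', e = e' + 1 := ⟨e - 1, by omega⟩
    rw [Finset.sum_range_succ, hBe, Finset.sum_range_succ]
    rw [Nat.add_sub_cancel] at *
    rw [hBe1, Finset.sum_congr rfl (g := fun k => A k * G ^ k), ← hA, hΦ]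
    · ring
    · intro k hk
      rw [hB k (Finset.mem_range.1 hk)]
  have hterm : ∀ k < e + 1, (B k * G ^ k).comp (ball a γ) = 0 ∨ ∃ ν c, c ≠ 0 ∧
      GLead ν (C c * X ^ k) ((B k * G ^ k).comp (ball a γ)) := by
    intro k hk
    by_cases hB0 : B k = 0
    · left; simp [hB0]
    right
    have hBk : ∃ ν c, c ≠ 0 ∧ GLead ν (C c) ((B k).comp (ball a γ)) := by
      by_cases hke : k = e
      · subst hke
        rw [hBe]
        exact ⟨0, 1, one_ne_zero, by simpa using GLead.one⟩
      · obtain ⟨ν, c, hc, -, h⟩ := hst (B k) (by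
          by_cases h : k = e - 1
          · rw [h, hBe1, hbσ]
          · rw [hB k (by omega), hAσ]) hB0 (by
          by_cases h : k = e - 1
          · rw [h, hBe1]; exact hb
          · rw [hB k (by omega)]; exact hAd k)
        exact ⟨ν, c, hc, h⟩
    obtain ⟨ν, c, hc, h⟩ := hBk
    refine ⟨ν + k • ωG, c * cG ^ k, mul_ne_zero hc (pow_ne_zero _ hcG), ?_⟩
    rw [mul_comp, pow_comp]
    refine (h.mul (hG.pow k)).congr rfl ?_
    rw [mul_pow, C_mul, C_pow]; ring
  have hα0 : α ≠ 0 := by rintro rfl; exact hα2 rfl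
  rw [hsum] at hα
  have hte := gLead_terms (e + 1) _ hterm hα0 hα (Nat.lt_succ_self e)
  have hte1 := gLead_terms (e + 1) _ hterm hα0 hα (show e - 1 < e + 1 by omega)
  have hωe : e • ωG = ωΦ := by
    rw [hBe, one_mul, pow_comp] at hte
    exact ((hG.pow e).unique hte (by simp [hcG]) (by simp [hα2])).1
  refine ⟨hωe, ?_, ?_⟩
  · rw [Polynomial.map_add, hGσ]
    rw [Polynomial.map_mul, map_C, map_inv₀, map_natCast, hbσ]
  · rw [add_comp]
    by_cases hb0 : b = 0
    · simpa [hb0] using hG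
    obtain ⟨ν, c, hc, -, h⟩ := hst b hbσ hb0 hb
    rw [hα1, C_0, zero_mul, hBe1, mul_comp, pow_comp] at hte1
    have h5 : ωΦ < ν + (e - 1) • ωG := (h.mul (hG.pow (e - 1))).lt_of_zero
      (by simp [hc, hcG]) hte1
    have h6 : ωG < ν := by
      rw [← hωe] at h5
      obtain ⟨e, rfl⟩ : ∃ e', e = e' + 1 := ⟨e - 1, by omega⟩
      rw [Nat.add_sub_cancel, succ_nsmul'] at h5
      exact lt_of_add_lt_add_right h5
    have h7 : GLead ωG 0 ((C ((e : HahnSeries Γ κ)⁻¹) * b).comp (ball a γ)) := by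
      rw [mul_comp, C_comp]
      refine (((GLead.C (lead_natCast_inv he.ne')).mul h).of_lt ?_)
      rwa [zero_add]
    simpa using hG.add h7

end Twist
end Polynomial.GaProper

namespace Polynomial.GaProper
open Polynomial
namespace Twist
variable {Γ κ : Type*} [AddCommGroup Γ] [LinearOrder Γ] [IsOrderedAddMonoid Γ] [Field κ] [CharZero κ]
  {m : ℕ} (T : Twist Γ κ m)

/-- The situation at one stage of the approximate root construction: `m = N e`, and the order of
`w - σᵏ w` is small for `N ∤ k`. -/
structure Stage (w : HahnSeries Γ κ) (N e : ℕ) : Prop where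
  eq : m = N * e
  pos : 0 < N
  one_lt : 1 < e
  sep : ∀ k < m, ¬ N ∣ k → (w - (T.σ ^ k) w).order < (w - T.avg N e w).order
  steady : T.Steady N e (T.avg N e w) (w - T.avg N e w).order

/-- Sum of the `d`-degrees of the differences `w - σᵏ w`, `N ∤ k`. -/
noncomputable def diffSum (w : HahnSeries Γ κ) (N : ℕ) : ℤ :=
  ∑ k ∈ (Finset.range m).filter (fun k => ¬ N ∣ k), T.d (w - (T.σ ^ k) w).order

variable {T} {w : HahnSeries Γ κ} (hw : ∀ k, 0 < k → k < m → (T.σ ^ k) w ≠ w)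
include hw

theorem not_dvd_pos {N k : ℕ} (h : ¬ N ∣ k) : 0 < k := Nat.pos_of_ne_zero fun h0 => h (h0 ▸ dvd_zero N)

namespace Stage
variable {N e : ℕ} (S : T.Stage w N e)
include S

theorem avg_ne : w - T.avg N e w ≠ 0 := by
  intro h
  have h1 := T.σ_avg S.eq w
  rw [← sub_eq_zero.1 h] at h1
  exact hw N S.pos (by rw [S.eq]; exact lt_mul_of_one_lt_right S.pos S.one_lt) h1

theorem lc_ne : (w - T.avg N e w).leadingCoeff ≠ 0 :=
  HahnSeries.leadingCoeff_ne_zero.2 (S.avg_ne hw)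

omit hw in
theorem σ_pow_mul_avg (j : ℕ) : (T.σ ^ (N * j)) (T.avg N e w) = T.avg N e w := by
  induction j with
  | zero => simp
  | succ j ih =>
    rw [mul_add, mul_one, pow_add, RingHom.mul_def, RingHom.comp_apply, T.σ_avg S.eq, ih]

theorem ξ_ne : (T.ω ^ T.d (w - T.avg N e w).order) ^ N ≠ 1 :=
  T.ne_one_of_lead_sub_avg (by have := S.one_lt; omega) S.eq (S.lc_ne hw) (lead_order _)

omit hw in
theorem ω_ne : T.ω ≠ 0 := T.prim.ne_zero (by rw [S.eq]; exact (mul_pos S.pos (by have := S.one_lt; omega)).ne')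

omit hw in
theorem ω_pow_eq_one_iff (a : ℤ) : (T.ω ^ a) ^ N = 1 ↔ (e : ℤ) ∣ a := by
  rw [← zpow_natCast, ← zpow_mul, T.prim.zpow_eq_one_iff_dvd, S.eq, mul_comm a]
  push_cast
  exact mul_dvd_mul_iff_left (by exact_mod_cast S.pos.ne')

omit hw in
theorem ξ_pow : ((T.ω ^ T.d (w - T.avg N e w).order) ^ N) ^ e = 1 := by
  rw [← pow_mul, ← S.eq, ← zpow_natCast, zpow_comm, zpow_natCast, T.prim.pow_eq_one, one_zpow]

theorem lead_far {k : ℕ} (hk : k < m) (hNk : ¬ N ∣ k) :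
    ∃ c, c ≠ 0 ∧ Lead (w - (T.σ ^ k) w).order c (w - (T.σ ^ k) w) :=
  ⟨_, HahnSeries.leadingCoeff_ne_zero.2 (sub_ne_zero.2 (hw k (not_dvd_pos hw hNk) hk).symm), lead_order _⟩

/-- Leading form of the characteristic polynomial of `w` on the generic ball. -/
theorem gLead_charpoly : ∃ α : κ[X], α.coeff (e - 1) = 0 ∧ α.coeff e ≠ 0 ∧
    ∃ ωΦ, T.d ωΦ = e * T.d (w - T.avg N e w).order + T.diffSum w N ∧
    GLead ωΦ α ((∏ k ∈ Finset.range m, (X - C ((T.σ ^ k) w))).comp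
      (ball (T.avg N e w) (w - T.avg N e w).order)) := by
  set w₀ := T.avg N e w with hw₀
  set γ := (w - w₀).order with hγ
  set c₀ := (w - w₀).leadingCoeff with hc₀
  set ξ := (T.ω ^ T.d γ) ^ N with hξ
  have hfar : ∀ k, ∃ c, k < m → ¬ N ∣ k → c ≠ 0 ∧
      GLead (w - (T.σ ^ k) w).order (C c) ((X - C ((T.σ ^ k) w)).comp (ball w₀ γ)) := by
    intro k
    by_cases h : k < m ∧ ¬ N ∣ k
    · obtain ⟨c, hc, hl⟩ := S.lead_far hw h.1 h.2
      refine ⟨c, fun _ _ => ⟨hc, gLead_ball_far (S.sep k h.1 h.2) ?_⟩⟩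
      have h1 := hl.sub ((lead_order (w - w₀)).of_lt (S.sep k h.1 h.2))
      rw [sub_zero] at h1
      convert h1 using 1
      ring
    · exact ⟨0, fun h1 h2 => absurd ⟨h1, h2⟩ h⟩
  choose A hA using hfar
  have h1 : GLead (∑ k ∈ (Finset.range m).filter (fun k => ¬ N ∣ k), (w - (T.σ ^ k) w).order)
      (∏ k ∈ (Finset.range m).filter (fun k => ¬ N ∣ k), C (A k))
      (∏ k ∈ (Finset.range m).filter (fun k => ¬ N ∣ k),
        (X - C ((T.σ ^ k) w)).comp (ball w₀ γ)) := by
    refine GLead.prod _ fun k hk => ?_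
    rw [Finset.mem_filter, Finset.mem_range] at hk
    exact (hA k hk.1 hk.2).2
  have h2 : GLead (∑ j ∈ Finset.range e, γ) (∏ j ∈ Finset.range e, (X - C (ξ ^ j * c₀)))
      (∏ j ∈ Finset.range e, (X - C ((T.σ ^ (N * j)) w)).comp (ball w₀ γ)) := by
    refine GLead.prod _ fun j _ => gLead_ball_sub ?_
    have h3 := T.lead_pow (lead_order (w - w₀)) (N * j)
    rw [map_sub, S.σ_pow_mul_avg, pow_mul] at h3
    exact h3
  have he : 0 < e := by have := S.one_lt; omega
  have h3 : ∏ j ∈ Finset.range e, (X - C ((T.σ ^ (N * j)) w)).comp (ball w₀ γ) =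
      ∏ k ∈ (Finset.range m).filter (fun k => N ∣ k), (X - C ((T.σ ^ k) w)).comp (ball w₀ γ) := by
    refine Finset.prod_bij (fun j _ => N * j) ?_ ?_ ?_ ?_
    · intro j hj
      rw [Finset.mem_range] at hj
      rw [Finset.mem_filter, Finset.mem_range, S.eq]
      exact ⟨Nat.mul_lt_mul_of_pos_left hj S.pos, dvd_mul_right _ _⟩
    · intro i _ j _ h
      exact Nat.eq_of_mul_eq_mul_left S.pos h
    · intro k hk
      rw [Finset.mem_filter, Finset.mem_range, S.eq] at hk
      obtain ⟨h4, j, rfl⟩ := hk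
      exact ⟨j, Finset.mem_range.2 (Nat.lt_of_mul_lt_mul_left h4), rfl⟩
    · intro j _; rfl
  have h4 := coeff_prod_X_sub (c := c₀) he (S.ξ_ne hw) S.ξ_pow
  rw [h3] at h2
  have h5 := h2.mul h1
  rw [Finset.prod_filter_mul_prod_filter_not, ← prod_comp, ← map_prod, mul_comm _ (C _)] at h5
  refine ⟨_, ?_, ?_, _, ?_, h5⟩
  · rw [coeff_C_mul, h4.1, mul_zero]
  · rw [coeff_C_mul, h4.2, mul_one]
    refine Finset.prod_ne_zero_iff.2 fun k hk => ?_
    rw [Finset.mem_filter, Finset.mem_range] at hk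
    exact (hA k hk.1 hk.2).1
  · rw [map_add, diffSum, map_sum, map_sum]; simp

/-- Leading form of the characteristic polynomial of the average on the generic ball. -/
theorem gLead_charpoly_avg : ∃ (c : κ) (ν : Γ), c ≠ 0 ∧
    GLead ν (C c * X) ((∏ k ∈ Finset.range N, (X - C ((T.σ ^ k) (T.avg N e w)))).comp
      (ball (T.avg N e w) (w - T.avg N e w).order)) := by
  set w₀ := T.avg N e w with hw₀
  set γ := (w - w₀).order with hγ
  have hNm : N < m := by rw [S.eq]; exact lt_mul_of_one_lt_right S.pos S.one_lt
  have hfar : ∀ k, ∃ c, k + 1 < N → c ≠ 0 ∧ GLead (w - (T.σ ^ (k + 1)) w).order (C c)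
      ((X - C ((T.σ ^ (k + 1)) w₀)).comp (ball w₀ γ)) := by
    intro k
    by_cases h : k + 1 < N
    · have hd : ¬ N ∣ k + 1 := Nat.not_dvd_of_pos_of_lt (by omega) h
      obtain ⟨c, hc, hl⟩ := S.lead_far hw (h.trans hNm) hd
      have hs := S.sep _ (h.trans hNm) hd
      refine ⟨c, fun _ => ⟨hc, gLead_ball_far hs ?_⟩⟩
      have h1 := (hl.sub ((lead_order (w - w₀)).of_lt hs)).add
        ((T.lead_pow (lead_order (w - w₀)) (k + 1)).of_lt hs)
      rw [sub_zero, add_zero] at h1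
      convert h1 using 1
      rw [map_sub]; ring
    · exact ⟨0, fun h1 => absurd h1 h⟩
  choose A hA using hfar
  have h0 : GLead γ (X - C 0) ((X - C w₀).comp (ball w₀ γ)) :=
    gLead_ball_sub (by rw [sub_self]; exact Lead.zero _)
  have h1 : GLead (∑ k ∈ Finset.range (N - 1), (w - (T.σ ^ (k + 1)) w).order)
      (∏ k ∈ Finset.range (N - 1), C (A k))
      (∏ k ∈ Finset.range (N - 1), (X - C ((T.σ ^ (k + 1)) w₀)).comp (ball w₀ γ)) := by
    refine GLead.prod _ fun k hk => ?_
    rw [Finset.mem_range] at hk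
    exact (hA k (by omega)).2
  have h2 := h1.mul h0
  have hN' : N = (N - 1) + 1 := by have := S.pos; omega
  have hz : (T.σ ^ 0) w₀ = w₀ := by rw [pow_zero]; rfl
  have h3 : (∏ k ∈ Finset.range N, (X - C ((T.σ ^ k) w₀))).comp (ball w₀ γ) =
      (∏ k ∈ Finset.range (N - 1), (X - C ((T.σ ^ (k + 1)) w₀)).comp (ball w₀ γ)) *
      (X - C w₀).comp (ball w₀ γ) := by
    conv_lhs => rw [hN']
    rw [Finset.prod_range_succ', mul_comp, prod_comp, hz]
  rw [← h3, ← map_prod, C_0, sub_zero] at h2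
  refine ⟨_, _, ?_, h2⟩
  refine Finset.prod_ne_zero_iff.2 fun k hk => ?_
  rw [Finset.mem_range] at hk
  exact (hA k (by omega)).1

/-- The approximate root of the characteristic polynomial. -/
theorem exists_root {P : Type*} [CommRing P] [IsDomain P] [Algebra ℚ P] {j : P →+* HahnSeries Γ κ}
    (hσj : ∀ p, T.σ (j p) = j p) {Φ : P[X]}
    (hΦ : Φ.map j = ∏ k ∈ Finset.range m, (X - C ((T.σ ^ k) w)))
    (hj : Function.Injective j) :
    ∃ (F : P[X]) (c : κ) (ν : Γ), F.Monic ∧ F.natDegree = N ∧ c ≠ 0 ∧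
      GLead ν (C c * X) ((F.map j).comp (ball (T.avg N e w) (w - T.avg N e w).order)) ∧
      e * T.d ν = e * T.d (w - T.avg N e w).order + T.diffSum w N := by
  obtain ⟨α, hα1, hα2, ωΦ, hd, hα⟩ := S.gLead_charpoly hw
  obtain ⟨c₁, ν₁, hc₁, hF₁⟩ := S.gLead_charpoly_avg hw
  have he : 0 < e := by have := S.one_lt; omega
  have hΦm : (Φ.map j).Monic := by
    rw [hΦ]; exact monic_prod_of_monic _ _ fun _ _ => monic_X_sub_C _
  have hΦN : (Φ.map j).natDegree = N * e := by
    rw [hΦ, natDegree_prod_X_sub_C_range, S.eq]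
  have hmapσ : ∀ p : P[X], (p.map j).map T.σ = p.map j := by
    intro p
    rw [Polynomial.map_map]
    congr 1
    ext x; simp [hσj]
  rw [← hΦ] at hα
  obtain ⟨G, hGm, hGN, ⟨ν, c, hGσ, hc, hG, hν⟩, hG2⟩ := exists_approxRoot he hΦm hΦN
    (fun G => ∃ ν c, G.map T.σ = G ∧ c ≠ 0 ∧
      GLead ν (C c * X) (G.comp (ball (T.avg N e w) (w - T.avg N e w).order)) ∧ True)
    (fun G b r hGm hGN hP hb hr hΦ' => by
      obtain ⟨ν, c, hGσ, hc, hG, -⟩ := hP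
      have h := T.tschirnhausen_step he S.steady hGm hGN hGσ hc hG hb hr hΦ' (hmapσ _)
        hα hα1 hα2
      have h2 : (e : ℚ)⁻¹ • b = C ((e : HahnSeries Γ κ)⁻¹) * b := by
        rw [← algebraMap_smul (HahnSeries Γ κ), smul_eq_C_mul, map_inv₀, map_natCast]
      rw [h2]
      exact ⟨ν, c, h.2.1, hc, h.2.2, trivial⟩)
    (monic_prod_of_monic _ _ fun _ _ => monic_X_sub_C _)
    (natDegree_prod_X_sub_C_range N fun k => (T.σ ^ k) (T.avg N e w))
    ⟨ν₁, c₁, T.map_prod_orbit (T.σ_avg S.eq w), hc₁, hF₁, trivial⟩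
  have hΦm' : Φ.Monic := (hj.monic_map_iff).2 hΦm
  obtain ⟨F, hFm, hFN, -, hF2⟩ := exists_approxRoot he hΦm'
    (by rw [← natDegree_map_eq_of_injective hj, hΦN])
    (fun _ => True) (fun _ _ _ _ _ _ _ _ _ => trivial) (monic_X_pow N) (natDegree_X_pow N) trivial
  have hFG : F.map j = G := by
    refine approxRoot_unique he (hFm.map j) hGm (by rw [hFm.natDegree_map, hFN]) hGN ?_ hG2
    rw [← Polynomial.map_pow, ← Polynomial.map_sub]
    exact degree_map_le.trans_lt hF2
  refine ⟨F, c, ν, hFm, hFN, hc, by rw [hFG]; exact hG, ?_⟩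
  have h := T.tschirnhausen_step (b := 0) (r := Φ.map j - G ^ e) he S.steady hGm hGN hGσ hc hG
    (by simp) hG2 (by ring) (hmapσ _) hα hα1 hα2
  rw [← hd, ← h.1]; simp

end Stage
end Twist
end Polynomial.GaProper

namespace Polynomial.GaProper
open Polynomial

theorem card_range_filter_dvd {N : ℕ} (hN : 0 < N) (e : ℕ) :
    ((Finset.range (N * e)).filter (fun k => N ∣ k)).card = e := by
  have : (Finset.range (N * e)).filter (fun k => N ∣ k) = (Finset.range e).image (fun j => N * j) := by
    ext k
    simp only [Finset.mem_filter, Finset.mem_range, Finset.mem_image]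
    constructor
    · rintro ⟨h, j, rfl⟩
      exact ⟨j, Nat.lt_of_mul_lt_mul_left h, rfl⟩
    · rintro ⟨j, hj, rfl⟩
      exact ⟨Nat.mul_lt_mul_of_pos_left hj hN, dvd_mul_right _ _⟩
  rw [this, Finset.card_image_of_injective _ fun i j h => Nat.eq_of_mul_eq_mul_left hN h,
    Finset.card_range]

namespace Twist
variable {Γ κ : Type*} [AddCommGroup Γ] [LinearOrder Γ] [IsOrderedAddMonoid Γ] [Field κ] [CharZero κ]
  {m : ℕ} {T : Twist Γ κ m}

theorem lead_eval_of_ball {a g : HahnSeries Γ κ} {γ ν : Γ} {α : κ[X]} {c : κ}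
    {f : (HahnSeries Γ κ)[X]} (hf : GLead ν α (f.comp (ball a γ))) (hg : Lead γ c (g - a)) :
    Lead ν (α.eval c) (f.eval g) := by
  have h1 : Lead 0 c (HahnSeries.single (-γ) 1 * (g - a)) :=
    ((Lead.single (-γ) 1).mul hg).congr (neg_add_cancel γ) (one_mul c)
  have h2 := hf.eval h1
  have h3 : (HahnSeries.single γ (1 : κ)) * HahnSeries.single (-γ) 1 = 1 := by
    rw [HahnSeries.single_mul_single]; simp
  rw [eval_comp] at h2
  have h4 : (ball a γ).eval (HahnSeries.single (-γ) 1 * (g - a)) = g := by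
    simp only [ball, eval_add, eval_mul, eval_C, eval_X]
    rw [← mul_assoc, h3]; ring
  rwa [h4] at h2

variable {w : HahnSeries Γ κ} (hw : ∀ k, 0 < k → k < m → (T.σ ^ k) w ≠ w)

theorem pow_map_eval {P : Type*} [CommRing P] {j : P →+* HahnSeries Γ κ}
    (hσj : ∀ p, T.σ (j p) = j p) (F : P[X]) (k : ℕ) :
    (T.σ ^ k) ((F.map j).eval w) = (F.map j).eval ((T.σ ^ k) w) := by
  induction k with
  | zero => simp
  | succ k ih =>
    rw [pow_succ', RingHom.mul_def, RingHom.comp_apply, RingHom.comp_apply, ih, eval_map, eval_map,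
      hom_eval₂]
    congr 1
    ext p; simp [hσj]

namespace Stage
variable {N e : ℕ} (S : T.Stage w N e)
include hw S

theorem dvd_root {P : Type*} [CommRing P] {j : P →+* HahnSeries Γ κ}
    (hσj : ∀ p, T.σ (j p) = j p) {F : P[X]} {c : κ} {ν : Γ} (hc : c ≠ 0)
    (hF : GLead ν (C c * X) ((F.map j).comp (ball (T.avg N e w) (w - T.avg N e w).order))) :
    (e : ℤ) ∣ T.d ν - T.d (w - T.avg N e w).order := by
  have h0 := lead_order (w - T.avg N e w)
  have h1 := T.lead_pow (lead_eval_of_ball hF h0) N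
  rw [pow_map_eval hσj] at h1
  have h2 := T.lead_pow h0 N
  rw [map_sub, T.σ_avg S.eq] at h2
  have h3 := lead_eval_of_ball hF h2
  have h4 := h1.1.symm.trans h3.1
  simp only [eval_mul, eval_C, eval_X] at h4
  rw [← S.ω_pow_eq_one_iff, zpow_sub₀ S.ω_ne, div_pow, div_eq_one_iff_eq]
  · have h5 := S.lc_ne hw
    have h6 : c * (w - T.avg N e w).leadingCoeff ≠ 0 := mul_ne_zero hc h5
    apply mul_right_cancel₀ h6
    rw [h4]; ring
  · exact pow_ne_zero _ (zpow_ne_zero _ S.ω_ne)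

theorem nonneg_root {P : Type*} [CommRing P] {j : P →+* HahnSeries Γ κ}
    (hpos : ∀ F : P[X], (F.map j).eval w ≠ 0 → 0 ≤ T.d ((F.map j).eval w).order)
    {F : P[X]} {c : κ} {ν : Γ} (hc : c ≠ 0)
    (hF : GLead ν (C c * X) ((F.map j).comp (ball (T.avg N e w) (w - T.avg N e w).order))) :
    0 ≤ T.d ν := by
  have h1 := lead_eval_of_ball hF (lead_order (w - T.avg N e w))
  have h2 : (C c * X).eval (w - T.avg N e w).leadingCoeff ≠ 0 := by
    simpa [hc] using S.lc_ne hw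
  rw [← h1.order_eq h2]
  exact hpos F (h1.ne_zero h2)

theorem order_mid {k : ℕ} (hk : N ∣ k) (hk' : ¬ (e : ℤ) ∣ (k / N : ℕ) * T.d (w - T.avg N e w).order) :
    (w - (T.σ ^ k) w).order = (w - T.avg N e w).order := by
  obtain ⟨i, rfl⟩ := hk
  rw [Nat.mul_div_cancel_left _ S.pos] at hk'
  have h0 := lead_order (w - T.avg N e w)
  have h1 := h0.sub (T.lead_pow h0 (N * i))
  rw [map_sub, S.σ_pow_mul_avg, sub_sub_sub_cancel_right] at h1
  apply h1.order_eq
  intro h2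
  have h3 : (1 - (T.ω ^ T.d (w - T.avg N e w).order) ^ (N * i)) *
    (w - T.avg N e w).leadingCoeff = 0 := by rw [← h2]; ring
  rcases mul_eq_zero.1 h3 with h4 | h4
  · apply hk'
    rw [← S.ω_pow_eq_one_iff, mul_comm, zpow_mul, zpow_natCast, ← pow_mul, mul_comm i, ← sub_eq_zero.1 h4]
  · exact S.lc_ne hw h4

variable {N' e' : ℕ} (he' : e' = Int.gcd e (T.d (w - T.avg N e w).order)) (hN' : N' * e' = N * e)
include he' hN'

omit hw hN' in
theorem gcd_pos : 0 < e' := by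
  rw [he', Int.gcd_pos_iff]; left
  have := S.one_lt; exact_mod_cast (by omega : e ≠ 0)

omit hw hN' in
theorem gcd_dvd : e' ∣ e := by
  rw [he']; exact_mod_cast Int.gcd_dvd_left (e : ℤ) _

omit hw hN' S in
theorem gcd_dvd_d : (e' : ℤ) ∣ T.d (w - T.avg N e w).order := by
  rw [he']; exact Int.gcd_dvd_right (e : ℤ) _

omit hw in
theorem next_eq : N' = N * (e / e') := by
  have h1 := S.gcd_pos he'
  obtain ⟨q, hq⟩ := S.gcd_dvd he'
  rw [hq, Nat.mul_div_cancel_left _ h1]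
  apply Nat.eq_of_mul_eq_mul_right h1
  rw [hN']; conv_lhs => rw [hq]
  ring

omit hw hN' in
theorem dvd_mul_iff (i : ℤ) : (e : ℤ) ∣ i * T.d (w - T.avg N e w).order ↔ ((e / e' : ℕ) : ℤ) ∣ i := by
  have h1 := S.gcd_pos he'
  have h4 := Int.isCoprime_iff_gcd_eq_one.2 (Int.gcd_ediv_gcd_ediv_gcd
    (i := (e : ℤ)) (j := T.d (w - T.avg N e w).order) (by rw [← he']; exact h1))
  rw [← he'] at h4
  obtain ⟨q, hq⟩ := S.gcd_dvd he'
  obtain ⟨r, hr⟩ := gcd_dvd_d he'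
  have h1' : (e' : ℤ) ≠ 0 := by exact_mod_cast h1.ne'
  rw [hr, Int.mul_ediv_cancel_left _ h1'] at h4
  conv at h4 =>
    rw [hq]
  rw [Nat.cast_mul, Int.mul_ediv_cancel_left _ h1'] at h4
  rw [hr]
  conv_lhs => rw [hq]
  conv_rhs => rw [hq]
  rw [Nat.mul_div_cancel_left _ h1, Nat.cast_mul, mul_left_comm, mul_dvd_mul_iff_left h1']
  exact ⟨IsCoprime.dvd_of_dvd_mul_right h4, fun h => dvd_mul_of_dvd_left h _⟩

theorem next_lt : e' < e := by
  refine lt_of_le_of_ne (Nat.le_of_dvd (by have := S.one_lt; omega) (S.gcd_dvd he')) ?_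
  intro h
  have h1 := S.ξ_ne hw
  rw [Ne, S.ω_pow_eq_one_iff] at h1
  have h2 := gcd_dvd_d he'
  rw [h] at h2
  exact h1 h2

theorem next_order_mid {k : ℕ} (hk : N ∣ k) (hk' : ¬ N' ∣ k) :
    (w - (T.σ ^ k) w).order = (w - T.avg N e w).order := by
  refine S.order_mid hw hk ?_
  rw [S.dvd_mul_iff he']
  obtain ⟨i, rfl⟩ := hk
  rw [Nat.mul_div_cancel_left _ S.pos, Int.natCast_dvd_natCast]
  intro h
  apply hk'
  rw [S.next_eq he' hN']
  exact mul_dvd_mul_left _ h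

theorem next_diffSum : T.diffSum w N' = T.diffSum w N + (e - e' : ℤ) * T.d (w - T.avg N e w).order := by
  have hNN' : N ∣ N' := by rw [S.next_eq he' hN']; exact dvd_mul_right _ _
  have hN'0 : 0 < N' := by
    apply Nat.pos_of_ne_zero; rintro rfl
    rw [zero_mul] at hN'
    have := mul_pos S.pos (by have := S.one_lt; omega : 0 < e)
    omega
  unfold diffSum
  rw [← Finset.sum_filter_add_sum_filter_not ((Finset.range m).filter fun k => ¬ N' ∣ k) (fun k => N ∣ k),
    Finset.filter_filter, Finset.filter_filter, add_comm]
  congr 1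
  · congr 1
    ext k
    simp only [Finset.mem_filter]
    exact ⟨fun h => ⟨h.1, h.2.2⟩, fun h => ⟨h.1, fun h' => h.2 (hNN'.trans h'), h.2⟩⟩
  · rw [Finset.sum_congr rfl (g := fun _ => T.d (w - T.avg N e w).order), Finset.sum_const, nsmul_eq_mul]
    · congr 1
      have h1 : (Finset.range m).filter (fun k => ¬ N' ∣ k ∧ N ∣ k) =
          (Finset.range m).filter (fun k => N ∣ k) \ (Finset.range m).filter (fun k => N' ∣ k) := by
        ext k
        simp only [Finset.mem_filter, Finset.mem_sdiff]
        tauto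
      rw [h1, Finset.card_sdiff_of_subset, S.eq, card_range_filter_dvd S.pos, ← hN', card_range_filter_dvd hN'0,
        Nat.cast_sub (S.next_lt hw he' hN').le]
      intro k
      simp only [Finset.mem_filter]
      exact fun h => ⟨h.1, hNN'.trans h.2⟩
    · intro k hk
      rw [Finset.mem_filter] at hk
      rw [S.next_order_mid hw he' hN' hk.2.2 hk.2.1]

theorem next_order_lt (h1 : 1 < e') : (w - T.avg N e w).order < (w - T.avg N' e' w).order := by
  have h0 := lead_order (w - T.avg N e w)
  have hN'e : m = N' * e' := by rw [hN', S.eq]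
  have h2 : w - T.avg N' e' w = (w - T.avg N e w) - T.avg N' e' (w - T.avg N e w) := by
    rw [avg_sub, T.avg_of_fixed (f := T.avg N e w) (by omega)]
    · ring
    · rw [S.next_eq he' hN', S.σ_pow_mul_avg]
  have hω : (T.ω ^ T.d (w - T.avg N e w).order) ^ N' = 1 := by
    rw [S.next_eq he' hN', pow_mul, ← pow_mul, ← zpow_natCast, ← zpow_mul, T.prim.zpow_eq_one_iff_dvd]
    have := gcd_dvd_d he'
    have h3 : (m : ℤ) = N' * e' := by exact_mod_cast hN'e
    rw [h3, S.next_eq he' hN', mul_comm]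
    exact mul_dvd_mul_right this _
  have h3 := h0.sub (T.lead_avg (N := N') (e := e') (by omega) h0)
  simp_rw [pow_mul, hω, one_pow, one_mul] at h3
  rw [← h2] at h3
  have hN'0 : 0 < N' := by
    apply Nat.pos_of_ne_zero; rintro rfl
    rw [zero_mul] at hN'
    have := mul_pos S.pos (by have := S.one_lt; omega : 0 < e)
    omega
  have hne : w - T.avg N' e' w ≠ 0 := by
    intro h
    have h1' := T.σ_avg hN'e w
    rw [← sub_eq_zero.1 h] at h1'
    exact hw N' hN'0 (by rw [hN'e]; exact lt_mul_of_one_lt_right hN'0 h1) h1'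
  refine lt_of_le_of_ne (h3.le_order hne) fun h => ?_
  have h4 := (lead_order (w - T.avg N' e' w)).1
  rw [← h, h3.1] at h4
  apply HahnSeries.leadingCoeff_ne_zero.2 hne
  rw [← h4]
  have : (e' : κ) ≠ 0 := by exact_mod_cast (by omega : e' ≠ 0)
  simp [this]

end Stage
end Twist
end Polynomial.GaProper

namespace Polynomial.GaProper
open Polynomial

namespace Twist
variable {Γ κ : Type*} [AddCommGroup Γ] [LinearOrder Γ] [IsOrderedAddMonoid Γ] [Field κ] [CharZero κ]
  {m : ℕ} {T : Twist Γ κ m}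

theorem ball_comp {a a' : HahnSeries Γ κ} {γ γ' : Γ} :
    (ball a γ).comp (C (HahnSeries.single (-γ) 1 * (a' - a)) + C (HahnSeries.single (γ' - γ) 1) * X)
      = ball a' γ' := by
  have h3 : (HahnSeries.single γ (1 : κ)) * HahnSeries.single (-γ) 1 = 1 := by
    rw [HahnSeries.single_mul_single]; simp
  have h4 : (HahnSeries.single γ (1 : κ)) * HahnSeries.single (γ' - γ) 1 = HahnSeries.single γ' 1 := by
    rw [HahnSeries.single_mul_single]; simp
  simp only [ball, add_comp, mul_comp, C_comp, X_comp]
  rw [mul_add, ← mul_assoc, ← C_mul, ← C_mul, ← mul_assoc, h3, h4, one_mul, C_sub]; ring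

variable {w : HahnSeries Γ κ} (hw : ∀ k, 0 < k → k < m → (T.σ ^ k) w ≠ w)
namespace Stage
variable {N e : ℕ} (S : T.Stage w N e)
include hw S

variable {N' e' : ℕ} (he' : e' = Int.gcd e (T.d (w - T.avg N e w).order)) (hN' : N' * e' = N * e)
include he' hN'

theorem next_steady (h1 : 1 < e') {F : (HahnSeries Γ κ)[X]} (hFσ : F.map T.σ = F) (hFm : F.Monic)
    (hFN : F.natDegree = N) {c : κ} {ν : Γ} (hc : c ≠ 0)
    (hF : GLead ν (C c * X) (F.comp (ball (T.avg N e w) (w - T.avg N e w).order)))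
    (hν : (e : ℤ) ∣ T.d ν - T.d (w - T.avg N e w).order) :
    T.Steady N' e' (T.avg N' e' w) (w - T.avg N' e' w).order := by
  intro b hbσ hb0 hb
  have hN'e := S.next_eq he' hN'
  set w₀ := T.avg N e w with hw₀
  set γ := (w - w₀).order with hγ
  rw [hN'e] at hb
  obtain ⟨A, hAσ, hAd, hA⟩ := exists_adic_expansion hFm hFN T.σ hFσ _ hbσ hb
  have hterm : ∀ k < e / e', (A k * F ^ k).comp (ball w₀ γ) = 0 ∨ ∃ μ β, β ≠ 0 ∧
      (e : ℤ) ∣ T.d μ - k * T.d γ ∧ GLead μ (C β * X ^ k) ((A k * F ^ k).comp (ball w₀ γ)) := by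
    intro k _
    by_cases hA0 : A k = 0
    · left; simp [hA0]
    right
    obtain ⟨μ, β, hβ, hd, hG⟩ := S.steady (A k) (hAσ k) hA0 (hAd k)
    refine ⟨μ + k • ν, β * c ^ k, mul_ne_zero hβ (pow_ne_zero _ hc), ?_, ?_⟩
    · rw [map_add, map_nsmul, nsmul_eq_mul, add_sub_assoc, ← mul_sub]
      exact dvd_add hd (dvd_mul_of_dvd_right hν _)
    · rw [mul_comp, pow_comp]
      refine (hG.mul (hF.pow k)).congr rfl ?_
      rw [mul_pow, C_mul, C_pow]; ring
  have hne : ∃ k < e / e', (A k * F ^ k).comp (ball w₀ γ) ≠ 0 := by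
    by_contra! h0
    apply hb0
    have h2 : b.comp (ball w₀ γ) = 0 := by
      rw [hA, Polynomial.sum_comp]
      exact Finset.sum_eq_zero fun k hk => h0 k (Finset.mem_range.1 hk)
    have h3 := congrArg (fun p => p.comp (C (HahnSeries.single (-γ) 1 * (0 - w₀)) +
      C (HahnSeries.single (0 - γ) 1) * X)) h2
    rw [comp_assoc, ball_comp] at h3
    have h4 : ball (0 : HahnSeries Γ κ) (0 : Γ) = X := by
      simp only [ball, C_0, zero_add]
      have : HahnSeries.single (0 : Γ) (1 : κ) = 1 := rfl
      rw [this, C_1, one_mul]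
    rwa [h4, comp_X, zero_comp] at h3
  obtain ⟨μ, β, hG, ⟨k₀, hk₀, hβ⟩, hQ⟩ := exists_common_gLead (e / e') _
    (fun k μ => (e : ℤ) ∣ T.d μ - k * T.d γ) hterm hne
  have huniq : ∀ k < e / e', k ≠ k₀ → β k = 0 := by
    intro k hk hkk
    by_contra hβk
    have h2 := dvd_sub (hQ k₀ hk₀ hβ) (hQ k hk hβk)
    have h3 : T.d μ - k₀ * T.d γ - (T.d μ - k * T.d γ) = (k - k₀ : ℤ) * T.d γ := by ring
    rw [h3, S.dvd_mul_iff he'] at h2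
    apply hkk
    have h4 := Int.eq_zero_of_abs_lt_dvd h2 (by rw [abs_lt]; constructor <;> omega)
    omega
  have hsum : GLead μ (C (β k₀) * X ^ k₀) (b.comp (ball w₀ γ)) := by
    have h2 : GLead μ _ (∑ k ∈ Finset.range (e / e'), (A k * F ^ k).comp (ball w₀ γ)) :=
      GLead.sum _ fun k hk => hG k (Finset.mem_range.1 hk)
    rw [← Polynomial.sum_comp, ← hA] at h2
    refine h2.congr rfl (Finset.sum_eq_single_of_mem k₀ (Finset.mem_range.2 hk₀) fun k hk hkk => ?_)
    rw [huniq k (Finset.mem_range.1 hk) hkk, C_0, zero_mul]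
  have hlt := S.next_order_lt hw he' hN' h1
  refine ⟨μ, β k₀ * (w - w₀).leadingCoeff ^ k₀, mul_ne_zero hβ (pow_ne_zero _ (S.lc_ne hw)), ?_, ?_⟩
  · have h2 := (Int.natCast_dvd_natCast.2 (S.gcd_dvd he')).trans (hQ k₀ hk₀ hβ)
    have h3 : (e' : ℤ) ∣ k₀ * T.d γ := dvd_mul_of_dvd_right (gcd_dvd_d he') _
    simpa using dvd_add h2 h3
  · have h2 : Lead γ (w - w₀).leadingCoeff (T.avg N' e' w - w₀) := by
      have h3 := (lead_order (w - w₀)).sub ((lead_order (w - T.avg N' e' w)).of_lt hlt)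
      rw [sub_zero] at h3
      convert h3 using 1; ring
    have h4 : GLead 0 (C (w - w₀).leadingCoeff)
        (C (HahnSeries.single (-γ) 1 * (T.avg N' e' w - w₀)) +
          C (HahnSeries.single ((w - T.avg N' e' w).order - γ) 1) * X) := by
      have h5 := GLead.C (((Lead.single (-γ) (1 : κ)).mul h2).congr (neg_add_cancel γ) (one_mul _))
      have h6 : GLead 0 0 (C (HahnSeries.single ((w - T.avg N' e' w).order - γ) (1 : κ)) * X) := by
        refine ((GLead.C (Lead.single _ _)).mul GLead.X).of_lt ?_
        rw [add_zero, sub_pos]; exact hlt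
      simpa using h5.add h6
    have h5 := hsum.comp h4
    rw [comp_assoc, ball_comp] at h5
    refine h5.congr rfl ?_
    simp

/-- One step of the induction. -/
theorem next {P : Type*} [CommRing P] [IsDomain P] [Algebra ℚ P] {j : P →+* HahnSeries Γ κ}
    (hσj : ∀ p, T.σ (j p) = j p) {Φ : P[X]}
    (hΦ : Φ.map j = ∏ k ∈ Finset.range m, (X - C ((T.σ ^ k) w)))
    (hj : Function.Injective j)
    (hpos : ∀ F : P[X], (F.map j).eval w ≠ 0 → 0 ≤ T.d ((F.map j).eval w).order) :
    0 ≤ e * T.d (w - T.avg N e w).order + T.diffSum w N ∧ (1 < e' → T.Stage w N' e') := by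
  obtain ⟨F, c, ν, hFm, hFN, hc, hF, hν⟩ := S.exists_root hw hσj hΦ hj
  refine ⟨?_, fun h1 => ?_⟩
  · rw [← hν]
    exact mul_nonneg (by positivity) (S.nonneg_root hw hpos hc hF)
  · have hlt := S.next_order_lt hw he' hN' h1
    refine ⟨by rw [hN', S.eq], ?_, h1, ?_, ?_⟩
    · rw [S.next_eq he' hN']
      exact mul_pos S.pos (Nat.div_pos (S.next_lt hw he' hN').le (S.gcd_pos he'))
    · intro k hk hNk
      by_cases hd : N ∣ k
      · rw [S.next_order_mid hw he' hN' hd hNk]; exact hlt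
      · exact (S.sep k hk hd).trans hlt
    · refine S.next_steady hw he' hN' h1 ?_ (hFm.map j) (by rw [hFm.natDegree_map, hFN]) hc hF
        (S.dvd_root hw hσj hc hF)
      rw [Polynomial.map_map]
      congr 1
      ext x; simp [hσj]

end Stage

theorem diffSum_le {P : Type*} [CommRing P] [IsDomain P] [Algebra ℚ P] {j : P →+* HahnSeries Γ κ}
    (hσj : ∀ p, T.σ (j p) = j p) {Φ : P[X]}
    (hΦ : Φ.map j = ∏ k ∈ Finset.range m, (X - C ((T.σ ^ k) w)))
    (hj : Function.Injective j)
    (hpos : ∀ F : P[X], (F.map j).eval w ≠ 0 → 0 ≤ T.d ((F.map j).eval w).order) (hw : ∀ k, 0 < k → k < m → (T.σ ^ k) w ≠ w) (e : ℕ) :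
    ∀ N, T.Stage w N e → T.diffSum w N ≤ e * T.diffSum w m := by
  induction e using Nat.strong_induction_on with
  | _ e ih =>
    intro N S
    set e' := Int.gcd e (T.d (w - T.avg N e w).order) with he'
    have hN' : N * (e / e') * e' = N * e := by
      rw [mul_assoc, Nat.div_mul_cancel (S.gcd_dvd he')]
    have h1 := S.next hw he' hN' hσj hΦ hj hpos
    have h2 := S.next_diffSum hw he' hN'
    have h3 := S.next_lt hw he' hN'
    have h4 := S.gcd_pos he'
    have h5 : T.diffSum w (N * (e / e')) ≤ e' * T.diffSum w m := by
      by_cases h6 : 1 < e'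
      · exact ih e' h3 _ (h1.2 h6)
      · have h7 : e' = 1 := by omega
        rw [h7, mul_one] at hN'
        rw [h7, hN', ← S.eq]; simp
    rw [h2] at h5
    have h8 : (0 : ℤ) < e' := by exact_mod_cast h4
    have h9 : (0 : ℤ) < e - e' := by have : (e' : ℤ) < e := by exact_mod_cast h3
                                     linarith
    have h10 := h1.1
    have h11 : (0:ℤ) < e := by linarith
    set D := T.diffSum w N
    set δ := T.d (w - T.avg N e w).order
    have h12 := mul_nonneg h9.le h10
    have h13 := mul_le_mul_of_nonneg_left h5 h11.le
    have h14 : (e' : ℤ) * D ≤ e' * (e * T.diffSum w m) := by linarith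
    exact le_of_mul_le_mul_left h14 h8

/-- Orders of elements with few collisions along the orbit are divisible by the length of the
orbit. -/
theorem dvd_of_diffSum_le {P : Type*} [CommRing P] [IsDomain P] [Algebra ℚ P] {j : P →+* HahnSeries Γ κ}
    (hσj : ∀ p, T.σ (j p) = j p) {Φ : P[X]}
    (hΦ : Φ.map j = ∏ k ∈ Finset.range m, (X - C ((T.σ ^ k) w)))
    (hj : Function.Injective j)
    (hpos : ∀ F : P[X], (F.map j).eval w ≠ 0 → 0 ≤ T.d ((F.map j).eval w).order)
    (hw : ∀ k, 0 < k → k < m → (T.σ ^ k) w ≠ w) (hm : 0 < m) {n : ℕ} (hn : T.d w.order = n)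
    (hmn : m ≤ n) (hD : T.diffSum w m < m) : m ∣ n := by
  by_contra hdvd
  have hm1 : 1 < m := by
    by_contra h
    exact hdvd (by rw [show m = 1 by omega]; exact one_dvd _)
  have hw0 : w ≠ 0 := by rintro rfl; exact hw 1 one_pos hm1 (map_zero _)
  have hω : T.ω ^ T.d w.order ≠ 1 := by
    rw [Ne, T.prim.zpow_eq_one_iff_dvd, hn, Int.natCast_dvd_natCast]; exact hdvd
  have hord : (w - T.avg 1 m w).order = w.order := by
    have h1 := (lead_order w).sub (T.lead_avg (N := 1) hm.ne' (lead_order w))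
    simp_rw [one_mul] at h1
    rw [← Finset.sum_mul, sum_pow_eq_zero hω, zero_mul, mul_zero, sub_zero] at h1
    · exact h1.order_eq (HahnSeries.leadingCoeff_ne_zero.2 hw0)
    · rw [← zpow_natCast, ← zpow_mul, mul_comm, zpow_mul, zpow_natCast, T.prim.pow_eq_one, one_zpow]
  have S : T.Stage w 1 m := by
    refine ⟨(one_mul m).symm, one_pos, hm1, fun k _ h => absurd (one_dvd k) h, ?_⟩
    intro b hbσ hb0 hb
    have hb' : b = C (b.coeff 0) := eq_C_of_degree_le_zero (Nat.WithBot.lt_one_iff_le_zero.1 (by simpa using hb))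
    have hx : b.coeff 0 ≠ 0 := by
      intro h; rw [h, C_0] at hb'; exact hb0 hb'
    have hxσ : T.σ (b.coeff 0) = b.coeff 0 := by
      rw [← coeff_map, hbσ]
    refine ⟨(b.coeff 0).order, (b.coeff 0).leadingCoeff, HahnSeries.leadingCoeff_ne_zero.2 hx, ?_, ?_⟩
    · have h1 := (T.lead (lead_order (b.coeff 0)))
      rw [hxσ] at h1
      have h2 := h1.1.symm.trans (lead_order (b.coeff 0)).1
      rw [← T.prim.zpow_eq_one_iff_dvd]
      exact mul_right_cancel₀ (HahnSeries.leadingCoeff_ne_zero.2 hx) (by rw [h2, one_mul])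
    · rw [hb', C_comp, coeff_C_zero]
      exact GLead.C (lead_order _)
  set e' := Int.gcd m (T.d (w - T.avg 1 m w).order) with he'
  have hN' : m / e' * e' = 1 * m := by
    rw [one_mul, Nat.div_mul_cancel (S.gcd_dvd he')]
  have h1 := S.next hw he' hN' hσj hΦ hj hpos
  have h2 := S.next_diffSum hw he' hN'
  have h3 := S.next_lt hw he' hN'
  have h4 := S.gcd_pos he'
  have h0 : T.diffSum w 1 = 0 := by
    unfold diffSum
    rw [Finset.filter_false_of_mem, Finset.sum_empty]
    intro k _; simp
  rw [h0, zero_add, hord, hn] at h2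
  have h5 : T.diffSum w (m / e') ≤ e' * T.diffSum w m := by
    by_cases h6 : 1 < e'
    · exact diffSum_le hσj hΦ hj hpos hw e' _ (h1.2 h6)
    · have h7 : e' = 1 := by omega
      rw [h7]; simp
  rw [h2] at h5
  have h6 : (e' : ℤ) ≤ m - e' := by
    obtain ⟨q, hq⟩ := S.gcd_dvd he'
    have : 2 ≤ q := by
      by_contra hlt
      have : q ≤ 1 := by omega
      interval_cases q <;> omega
    have : e' * 2 ≤ m := by
      conv_rhs => rw [hq]
      exact Nat.mul_le_mul_left _ this
    omega
  have h7 : (0 : ℤ) < e' := by exact_mod_cast h4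
  have h8 : (m : ℤ) ≤ n := by exact_mod_cast hmn
  nlinarith

end Twist
end Polynomial.GaProper

namespace Polynomial.GaProper
open Polynomial

section Scale
variable {Γ κ : Type*} [AddCommGroup Γ] [LinearOrder Γ] [IsOrderedAddMonoid Γ] [Field κ]

/-- Coefficientwise scaling. -/
def scaleFun (d : Γ →+ ℤ) (ω : κ) (f : HahnSeries Γ κ) : HahnSeries Γ κ where
  coeff γ := ω ^ d γ * f.coeff γ
  isPWO_support' := f.isPWO_support.mono (by
    intro γ h
    simp only [Function.mem_support, ne_eq, mul_eq_zero, not_or] at h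
    exact h.2)

theorem coeff_scaleFun (d : Γ →+ ℤ) (ω : κ) (f : HahnSeries Γ κ) (γ : Γ) :
    (scaleFun d ω f).coeff γ = ω ^ d γ * f.coeff γ := rfl

/-- The automorphism of a Hahn field multiplying the monomial of exponent `γ` by `ω ^ d γ`. -/
def scale (d : Γ →+ ℤ) (ω : κ) (hω : ω ≠ 0) : HahnSeries Γ κ →+* HahnSeries Γ κ where
  toFun := scaleFun d ω
  map_one' := by
    ext γ
    simp only [HahnSeries.coeff_one, coeff_scaleFun]
    split_ifs with h
    · rw [h, map_zero]; simp
    · simp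
  map_zero' := by ext γ; simp [coeff_scaleFun]
  map_add' f g := by ext γ; simp [mul_add, coeff_scaleFun]
  map_mul' f g := by
    ext γ
    rw [coeff_scaleFun, HahnSeries.coeff_mul, Finset.mul_sum, HahnSeries.coeff_mul]
    refine Finset.sum_congr ?_ ?_
    · ext ⟨a, b⟩
      simp [Finset.mem_antidiagonal, coeff_scaleFun, zpow_ne_zero _ hω]
    · rintro ⟨a, b⟩ h
      rw [Finset.mem_antidiagonal] at h
      rw [← h.2.2, map_add, zpow_add₀ hω, coeff_scaleFun, coeff_scaleFun]
      ring

@[simp] theorem coeff_scale (d : Γ →+ ℤ) (ω : κ) (hω : ω ≠ 0) (f : HahnSeries Γ κ) (γ : Γ) :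
    (scale d ω hω f).coeff γ = ω ^ d γ * f.coeff γ := rfl

theorem coeff_scale_pow (d : Γ →+ ℤ) (ω : κ) (hω : ω ≠ 0) (k : ℕ) (f : HahnSeries Γ κ) (γ : Γ) :
    (((scale d ω hω) ^ k) f).coeff γ = (ω ^ d γ) ^ k * f.coeff γ := by
  induction k generalizing f with
  | zero => simp
  | succ k ih =>
    rw [pow_succ, RingHom.mul_def, RingHom.comp_apply, ih, coeff_scale]
    ring

/-- Scaling by a primitive root of unity. -/
def Twist.ofScale (d : Γ →+ ℤ) (ω : κ) {m : ℕ} (hm : 0 < m) (h : IsPrimitiveRoot ω m) :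
    Twist Γ κ m where
  d := d
  σ := scale d ω (h.ne_zero hm.ne')
  ω := ω
  prim := h
  lead := by
    rintro γ c f ⟨h1, h2⟩
    exact ⟨by rw [coeff_scale, h1], fun g hg => by rw [coeff_scale, h2 g hg, mul_zero]⟩
  pow_m := by
    ext f γ
    rw [coeff_scale_pow, ← zpow_natCast, ← zpow_mul, mul_comm (d γ), zpow_mul, zpow_natCast, h.pow_eq_one]
    simp

end Scale

section Iterate
variable {Γ Γ' κ : Type*} [AddCommGroup Γ] [LinearOrder Γ] [IsOrderedAddMonoid Γ]
  [AddCommGroup Γ'] [LinearOrder Γ'] [IsOrderedAddMonoid Γ'] [Field κ]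

open HahnSeries in
theorem ofIterate_mul (x y : HahnSeries Γ (HahnSeries Γ' κ)) :
    ofIterate (x * y) = ofIterate x * ofIterate y := by
  ext g
  have h1 : (ofIterate (x * y)).coeff g = ((x * y).coeff g.1).coeff g.2 := rfl
  rw [h1, HahnSeries.coeff_mul, HahnSeries.coeff_sum, HahnSeries.coeff_mul]
  simp_rw [HahnSeries.coeff_mul]
  rw [Finset.sum_sigma']
  refine Finset.sum_bij' (fun p _ => (toLex (p.1.1, p.2.1), toLex (p.1.2, p.2.2)))
    (fun q _ => ⟨((ofLex q.1).1, (ofLex q.2).1), ((ofLex q.1).2, (ofLex q.2).2)⟩) ?_ ?_ ?_ ?_ ?_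
  · rintro ⟨⟨a, b⟩, ⟨c, d⟩⟩ h
    simp only [Finset.mem_sigma, Finset.mem_antidiagonal, HahnSeries.mem_support] at h ⊢
    refine ⟨h.2.1, h.2.2.1, ?_⟩
    exact congrArg toLex (Prod.ext h.1.2.2 h.2.2.2)
  · rintro ⟨a, b⟩ h
    simp only [Finset.mem_sigma, Finset.mem_antidiagonal, HahnSeries.mem_support] at h ⊢
    refine ⟨⟨fun h0 => h.1 ?_, fun h0 => h.2.1 ?_, congrArg (fun z => (ofLex z).1) h.2.2⟩,
      h.1, h.2.1, congrArg (fun z => (ofLex z).2) h.2.2⟩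
    · change (x.coeff (ofLex a).1).coeff _ = 0
      rw [h0]; rfl
    · change (y.coeff (ofLex b).1).coeff _ = 0
      rw [h0]; rfl
  · rintro ⟨⟨a, b⟩, ⟨c, d⟩⟩ h; rfl
  · rintro ⟨a, b⟩ h; rfl
  · rintro ⟨⟨a, b⟩, ⟨c, d⟩⟩ h; rfl

/-- Iterated Hahn series as Hahn series over the lexicographic product. -/
def iterateHom : HahnSeries Γ (HahnSeries Γ' κ) →+* HahnSeries (Γ ×ₗ Γ') κ where
  toFun := HahnSeries.ofIterate
  map_one' := by
    ext g
    change ((1 : HahnSeries Γ (HahnSeries Γ' κ)).coeff (ofLex g).1).coeff (ofLex g).2 = _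
    rw [HahnSeries.coeff_one, HahnSeries.coeff_one]
    by_cases h1 : (ofLex g).1 = 0
    · rw [if_pos h1, HahnSeries.coeff_one]
      by_cases h2 : (ofLex g).2 = 0
      · rw [if_pos h2, if_pos]
        exact congrArg toLex (Prod.ext h1 h2 : ofLex g = 0)
      · rw [if_neg h2, if_neg]
        rintro rfl; exact h2 rfl
    · rw [if_neg h1, if_neg]
      · rfl
      · rintro rfl; exact h1 rfl
  map_zero' := by ext g; rfl
  map_add' x y := by ext g; rfl
  map_mul' := ofIterate_mul

theorem coeff_iterateHom (x : HahnSeries Γ (HahnSeries Γ' κ)) (a : Γ) (b : Γ') :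
    (iterateHom x).coeff (toLex (a, b)) = (x.coeff a).coeff b := rfl

variable (κ) in
/-- Power series in one variable over a Hahn field, as Hahn series of rank two. -/
noncomputable def iota : PowerSeries (HahnSeries ℤ κ) →+* HahnSeries (ℤ ×ₗ ℤ) κ :=
  iterateHom.comp (HahnSeries.ofPowerSeries ℤ (HahnSeries ℤ κ))

theorem coeff_iota_nat (f : PowerSeries (HahnSeries ℤ κ)) (i : ℕ) (b : ℤ) :
    (iota κ f).coeff (toLex ((i : ℤ), b)) = (PowerSeries.coeff i f).coeff b := by
  rw [iota, RingHom.comp_apply, coeff_iterateHom, HahnSeries.ofPowerSeries_apply_coeff]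

theorem coeff_iota_neg (f : PowerSeries (HahnSeries ℤ κ)) (i b : ℤ) (hi : i < 0) :
    (iota κ f).coeff (toLex (i, b)) = 0 := by
  rw [iota, RingHom.comp_apply, coeff_iterateHom, HahnSeries.ofPowerSeries_apply,
    HahnSeries.embDomain_of_notMem_range]
  · rfl
  · rintro ⟨n, hn⟩
    have : (n : ℤ) = i := hn
    omega

theorem iota_injective : Function.Injective (iota κ) := by
  intro f g h
  ext i b
  rw [← coeff_iota_nat, h, coeff_iota_nat]

/-- The leading term of `τ ^ k * f` is determined by the constant coefficient of `f`. -/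
theorem lead_iota (k : ℕ) (f : PowerSeries (HahnSeries ℤ κ)) {γ : ℤ} {c : κ}
    (h : Lead γ c (PowerSeries.constantCoeff f)) :
    Lead (toLex ((k : ℤ), γ)) c (iota κ (PowerSeries.X ^ k * f)) := by
  constructor
  · rw [coeff_iota_nat]
    have := PowerSeries.coeff_X_pow_mul f k 0
    rw [zero_add] at this
    rw [this, PowerSeries.coeff_zero_eq_constantCoeff_apply, h.1]
  · intro g hg
    obtain ⟨⟨a, b⟩, rfl⟩ := toLex.surjective g
    by_cases ha : a < 0
    · exact coeff_iota_neg _ _ _ ha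
    obtain ⟨a, rfl⟩ := Int.eq_ofNat_of_zero_le (not_lt.1 ha)
    rw [coeff_iota_nat]
    rw [Prod.Lex.toLex_lt_toLex] at hg
    rcases hg with hg | ⟨hg1, hg2⟩
    · rw [PowerSeries.coeff_X_pow_mul', if_neg]
      · rfl
      · have : (a : ℤ) < k := hg
        omega
    · have hak : a = k := by
        have : (a : ℤ) = k := hg1
        omega
      subst hak
      have := PowerSeries.coeff_X_pow_mul f a 0
      rw [zero_add] at this
      rw [this, PowerSeries.coeff_zero_eq_constantCoeff_apply, h.2 b hg2]

theorem iota_map_scale (d : ℤ →+ ℤ) (ω : κ) (hω : ω ≠ 0) (f : PowerSeries (HahnSeries ℤ κ)) :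
    iota κ (PowerSeries.map (scale d ω hω) f) =
      scale (d.comp ⟨⟨fun g : ℤ ×ₗ ℤ => (ofLex g).2, rfl⟩, fun _ _ => rfl⟩) ω hω (iota κ f) := by
  ext g
  obtain ⟨⟨a, b⟩, rfl⟩ := toLex.surjective g
  rw [coeff_scale]
  by_cases ha : a < 0
  · rw [coeff_iota_neg _ _ _ ha, coeff_iota_neg _ _ _ ha, mul_zero]
  obtain ⟨a, rfl⟩ := Int.eq_ofNat_of_zero_le (not_lt.1 ha)
  rw [coeff_iota_nat, coeff_iota_nat, PowerSeries.coeff_map, coeff_scale]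
  rfl

end Iterate
end Polynomial.GaProper

namespace Polynomial.GaProper
open Polynomial

/-- Hensel's lemma for simple roots of arbitrary polynomials over a ring of power series. -/
theorem exists_powerSeries_root {K : Type*} [Field K] (q : (PowerSeries K)[X]) (r : K)
    (h0 : (q.map PowerSeries.constantCoeff).eval r = 0)
    (h1 : (q.map PowerSeries.constantCoeff).derivative.eval r ≠ 0) :
    ∃ y : PowerSeries K, PowerSeries.constantCoeff y = r ∧ q.eval y = 0 := by
  have hred : ∀ (p : (PowerSeries K)[X]) (a : PowerSeries K),
      PowerSeries.constantCoeff (p.eval a) =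
        (p.map PowerSeries.constantCoeff).eval (PowerSeries.constantCoeff a) := by
    intro p a
    rw [eval_map, eval₂_at_apply]
  set u : PowerSeries K := PowerSeries.C ((q.map PowerSeries.constantCoeff).derivative.eval r)⁻¹
    with hu
  let a : ℕ → PowerSeries K := fun n => Nat.rec (PowerSeries.C r) (fun _ b => b - q.eval b * u) n
  have ha : ∀ n, a (n + 1) = a n - q.eval (a n) * u := fun n => rfl
  have key : ∀ n, PowerSeries.constantCoeff (a n) = r ∧ PowerSeries.X ^ (n + 1) ∣ q.eval (a n) := by
    intro n
    induction n with
    | zero =>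
      have hc : PowerSeries.constantCoeff (a 0) = r := PowerSeries.constantCoeff_C r
      refine ⟨hc, ?_⟩
      rw [zero_add, pow_one, PowerSeries.X_dvd_iff, hred, hc, h0]
    | succ n ih =>
      obtain ⟨ih1, ih2⟩ := ih
      have hq0 : PowerSeries.constantCoeff (q.eval (a n)) = 0 := by rw [hred, ih1, h0]
      refine ⟨by rw [ha, map_sub, map_mul, hq0, zero_mul, sub_zero, ih1], ?_⟩
      obtain ⟨z, hz⟩ := q.binomExpansion (a n) (-(q.eval (a n) * u))
      rw [ha, sub_eq_add_neg, hz]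
      have h2 : PowerSeries.X ∣ 1 - q.derivative.eval (a n) * u := by
        rw [PowerSeries.X_dvd_iff, map_sub, map_mul, hred, ih1, hu, PowerSeries.constantCoeff_C,
          derivative_map]
        rw [derivative_map] at h1
        rw [mul_inv_cancel₀ h1, map_one, sub_self]
      have h3 : q.eval (a n) + q.derivative.eval (a n) * -(q.eval (a n) * u) +
          z * (-(q.eval (a n) * u)) ^ 2 = q.eval (a n) * (1 - q.derivative.eval (a n) * u) +
          q.eval (a n) * q.eval (a n) * (z * u ^ 2) := by ring
      rw [h3]
      refine dvd_add ?_ ?_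
      · rw [pow_succ]; exact mul_dvd_mul ih2 h2
      · refine Dvd.dvd.mul_right ?_ _
        refine dvd_trans ?_ (mul_dvd_mul ih2 ih2)
        rw [← pow_add]; exact pow_dvd_pow _ (by omega)
  have hstab : ∀ n k, PowerSeries.X ^ (n + 1) ∣ a (n + k) - a n := by
    intro n k
    induction k with
    | zero => simp
    | succ k ih =>
      rw [← add_assoc, ha, show a (n + k) - q.eval (a (n + k)) * u - a n =
        (a (n + k) - a n) - q.eval (a (n + k)) * u by ring]
      exact dvd_sub ih (Dvd.dvd.mul_right ((pow_dvd_pow _ (by omega)).trans (key (n + k)).2) _)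
  let y : PowerSeries K := PowerSeries.mk fun i => PowerSeries.coeff i (a i)
  have hy : ∀ n, PowerSeries.X ^ (n + 1) ∣ y - a n := by
    intro n
    rw [PowerSeries.X_pow_dvd_iff]
    intro i hi
    obtain ⟨k, rfl⟩ := Nat.exists_eq_add_of_le (Nat.lt_succ_iff.1 hi)
    have := (PowerSeries.X_pow_dvd_iff.1 (hstab i k)) i (Nat.lt_succ_self i)
    rw [map_sub, sub_eq_zero] at this
    rw [map_sub, PowerSeries.coeff_mk, this, sub_self]
  refine ⟨y, ?_, ?_⟩
  · rw [← PowerSeries.coeff_zero_eq_constantCoeff_apply, PowerSeries.coeff_mk,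
      PowerSeries.coeff_zero_eq_constantCoeff_apply, (key 0).1]
  · ext n
    have h2 : PowerSeries.X ^ (n + 1) ∣ q.eval y := by
      have h3 := dvd_add ((hy n).trans (sub_dvd_eval_sub y (a n) q)) (key n).2
      rwa [sub_add_cancel] at h3
    rw [PowerSeries.X_pow_dvd_iff.1 h2 n (Nat.lt_succ_self n), map_zero]

section
variable {κ : Type*} [Field κ]

theorem Lead.pow {Γ : Type*} [AddCommGroup Γ] [LinearOrder Γ] [IsOrderedAddMonoid Γ] {γ : Γ} {c : κ}
    {f : HahnSeries Γ κ} (h : Lead γ c f) (n : ℕ) : Lead (n • γ) (c ^ n) (f ^ n) := by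
  induction n with
  | zero => simpa using Lead.one
  | succ n ih => rw [pow_succ, pow_succ, succ_nsmul]; exact ih.mul h

/-- The leading term of a polynomial in an element of negative order. -/
theorem lead_eval₂ {γ : ℤ} {c : κ} {f : HahnSeries ℤ κ} (h : Lead γ c f) (hγ : γ < 0) (p : κ[X]) :
    Lead (p.natDegree • γ) (p.leadingCoeff * c ^ p.natDegree) (p.eval₂ HahnSeries.C f) := by
  have hC : ∀ a : κ, Lead (0 : ℤ) a (HahnSeries.C a) := fun a => Lead.single 0 a
  rw [eval₂_eq_sum_range, Finset.sum_range_succ]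
  have h1 : Lead (p.natDegree • γ) 0 (∑ i ∈ Finset.range p.natDegree, HahnSeries.C (p.coeff i) * f ^ i) := by
    have h2 : ∀ i ∈ Finset.range p.natDegree,
        Lead (p.natDegree • γ) (0 : κ) (HahnSeries.C (p.coeff i) * f ^ i) := by
      intro i hi
      have h3 := (hC (p.coeff i)).mul (h.pow i)
      rw [zero_add] at h3
      refine h3.of_lt ?_
      have := Finset.mem_range.1 hi
      simp only [nsmul_eq_mul]
      have : (i : ℤ) < p.natDegree := by exact_mod_cast this
      nlinarith
    have h4 := Lead.sum (Finset.range p.natDegree) (c := fun _ => (0 : κ)) h2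
    rwa [Finset.sum_const_zero] at h4
  have h5 := h1.add ((hC (p.coeff p.natDegree)).mul (h.pow p.natDegree) |>.congr (zero_add _) rfl)
  rwa [zero_add] at h5

theorem eval₂_ne_zero_of_lead {γ : ℤ} {c : κ} {f : HahnSeries ℤ κ} (h : Lead γ c f) (hγ : γ < 0)
    (hc : c ≠ 0) {p : κ[X]} (hp : p ≠ 0) : p.eval₂ HahnSeries.C f ≠ 0 :=
  (lead_eval₂ h hγ p).ne_zero (mul_ne_zero (leadingCoeff_ne_zero.2 hp) (pow_ne_zero _ hc))

variable [CharZero κ]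

/-- Inversion of a polynomial at infinity. -/
theorem exists_laurent_root (V : κ[X]) (hV : 0 < V.natDegree) :
    ∃ y : HahnSeries ℤ κ, Lead (-1) 1 y ∧
      V.eval₂ HahnSeries.C y = HahnSeries.single (-(V.natDegree : ℤ)) V.leadingCoeff := by
  set m := V.natDegree with hm
  have hc : V.leadingCoeff ≠ 0 := leadingCoeff_ne_zero.2 (by rintro rfl; simp [hm] at hV)
  let q : (PowerSeries κ)[X] := ∑ i ∈ Finset.range (m + 1),
    C (PowerSeries.C (V.coeff i) * PowerSeries.X ^ (m - i)) * X ^ i - C (PowerSeries.C V.leadingCoeff)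
  have hq : q.map PowerSeries.constantCoeff = C V.leadingCoeff * X ^ m - C V.leadingCoeff := by
    simp only [q]
    rw [Polynomial.map_sub, Polynomial.map_sum, Finset.sum_range_succ, Finset.sum_eq_zero]
    · rw [tsub_self, pow_zero, mul_one, zero_add]
      simp [leadingCoeff, -coeff_natDegree, hm]
    · intro i hi
      have : m - i ≠ 0 := by have := Finset.mem_range.1 hi; omega
      simp [this]
  obtain ⟨g, hg1, hg2⟩ := exists_powerSeries_root q 1 (by rw [hq]; simp) (by
    rw [hq]
    simp only [derivative_sub, derivative_mul, derivative_C, derivative_X_pow]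
    simp [hc]; omega)
  refine ⟨HahnSeries.single (-1) 1 * HahnSeries.ofPowerSeries ℤ κ g, ?_, ?_⟩
  · have h1 : Lead (0 : ℤ) 1 (HahnSeries.ofPowerSeries ℤ κ g) := by
      constructor
      · have := HahnSeries.ofPowerSeries_apply_coeff (Γ := ℤ) g 0
        rw [← hg1, ← PowerSeries.coeff_zero_eq_constantCoeff_apply, ← this]; rfl
      · intro b hb
        rw [HahnSeries.ofPowerSeries_apply, HahnSeries.embDomain_of_notMem_range]
        rintro ⟨n, hn⟩
        have : (n : ℤ) = b := hn
        omega
    exact ((Lead.single (-1 : ℤ) (1 : κ)).mul h1).congr (by simp) (one_mul _)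
  · have h2 := congrArg (HahnSeries.ofPowerSeries ℤ κ) hg2
    simp only [q, eval_sub, eval_finsetSum, eval_mul, eval_C, eval_pow, eval_X, map_sub, map_sum,
      map_mul, map_pow, map_zero, sub_eq_zero] at h2
    have hC : ∀ a : κ, HahnSeries.ofPowerSeries ℤ κ (PowerSeries.C a) = HahnSeries.single 0 a := by
      intro a; rw [HahnSeries.ofPowerSeries_C]; rfl
    rw [eval₂_eq_sum_range, ← hm]
    have h3 : HahnSeries.single (-(m : ℤ)) V.leadingCoeff =
      HahnSeries.single (-(m : ℤ)) 1 * HahnSeries.ofPowerSeries ℤ κ (PowerSeries.C V.leadingCoeff) := by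
      rw [hC, HahnSeries.single_mul_single]; simp
    rw [h3, ← h2, Finset.mul_sum]
    refine Finset.sum_congr rfl fun i hi => ?_
    have hi' := Nat.lt_succ_iff.1 (Finset.mem_range.1 hi)
    rw [hC, HahnSeries.C_apply, mul_pow, HahnSeries.single_pow, HahnSeries.ofPowerSeries_X,
      HahnSeries.single_pow, ← mul_assoc, ← mul_assoc, ← mul_assoc, HahnSeries.single_mul_single,
      HahnSeries.single_mul_single, HahnSeries.single_mul_single]
    congr 2
    · simp only [nsmul_eq_mul, zero_add]
      push_cast [Nat.cast_sub hi']
      congr 1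
      ring
    · simp

variable (κ) in
/-- The embedding of power series rings induced by the constants of a Laurent series field. -/
noncomputable def mu : PowerSeries κ →+* PowerSeries (HahnSeries ℤ κ) :=
  PowerSeries.map (HahnSeries.C : κ →+* HahnSeries ℤ κ)

theorem constantCoeff_eval₂_mu (p : (PowerSeries κ)[X]) (y : PowerSeries (HahnSeries ℤ κ)) :
    PowerSeries.constantCoeff (p.eval₂ (mu κ) y) =
      (p.map PowerSeries.constantCoeff).eval₂ HahnSeries.C (PowerSeries.constantCoeff y) := by
  rw [hom_eval₂, eval₂_map]
  congr 1

theorem exists_iterated_root (v : (PowerSeries κ)[X])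
    (hV : 0 < (v.map PowerSeries.constantCoeff).natDegree) :
    ∃ y : PowerSeries (HahnSeries ℤ κ), Lead (-1) 1 (PowerSeries.constantCoeff y) ∧
      v.eval₂ (mu κ) y = PowerSeries.C (HahnSeries.single
        (-((v.map PowerSeries.constantCoeff).natDegree : ℤ))
        (v.map PowerSeries.constantCoeff).leadingCoeff) := by
  set V := v.map PowerSeries.constantCoeff with hVdef
  obtain ⟨r, hr1, hr2⟩ := exists_laurent_root V hV
  have hmap : (v.map (mu κ)).map PowerSeries.constantCoeff = V.map HahnSeries.C := by
    rw [hVdef, Polynomial.map_map, Polynomial.map_map]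
    congr 1
  set q := v.map (mu κ) - C (PowerSeries.C (HahnSeries.single
        (-(V.natDegree : ℤ)) V.leadingCoeff)) with hq
  have h0 : (q.map PowerSeries.constantCoeff).eval r = 0 := by
    rw [hq, Polynomial.map_sub, hmap, eval_sub, eval_map, hr2, map_C, eval_C,
      PowerSeries.constantCoeff_C, sub_self]
  have h1 : (q.map PowerSeries.constantCoeff).derivative.eval r ≠ 0 := by
    rw [hq, Polynomial.map_sub, hmap, derivative_sub, map_C, derivative_C, sub_zero, derivative_map,
      eval_map]
    refine eval₂_ne_zero_of_lead hr1 (by norm_num) one_ne_zero ?_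
    intro h
    have := derivative_eq_zero.1 h
    omega
  obtain ⟨y, hy1, hy2⟩ := exists_powerSeries_root q r h0 h1
  refine ⟨y, by rwa [hy1], ?_⟩
  rw [hq, eval_sub, eval_map, eval_C, sub_eq_zero] at hy2
  exact hy2

end
end Polynomial.GaProper

namespace Polynomial.GaProper
open Polynomial

section
variable {κ : Type*} [Field κ] [CharZero κ] {y : PowerSeries (HahnSeries ℤ κ)}

@[simp] theorem mu_X : mu κ PowerSeries.X = PowerSeries.X := by simp [mu]

/-- A polynomial over a power series ring with vanishing reduction is divisible by the variable. -/
theorem exists_eq_C_X_mul {R : Type*} [CommRing R] {p : (PowerSeries R)[X]}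
    (h : p.map PowerSeries.constantCoeff = 0) : ∃ q : (PowerSeries R)[X], p = C PowerSeries.X * q := by
  have : C PowerSeries.X ∣ p := by
    rw [C_dvd_iff_dvd_coeff]
    intro i
    rw [PowerSeries.X_dvd_iff, ← coeff_map, h, coeff_zero]
  exact this

theorem X_pow_dvd_of_eval₂ (hy : Lead (-1) 1 (PowerSeries.constantCoeff y)) (k : ℕ)
    (p : (PowerSeries κ)[X]) (h : PowerSeries.X ^ k ∣ p.eval₂ (mu κ) y) :
    ∃ q : (PowerSeries κ)[X], p = C (PowerSeries.X ^ k) * q := by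
  induction k generalizing p with
  | zero => exact ⟨p, by simp⟩
  | succ k ih =>
    have h0 : p.map PowerSeries.constantCoeff = 0 := by
      by_contra h0
      refine eval₂_ne_zero_of_lead hy (by norm_num) one_ne_zero h0 ?_
      rw [← constantCoeff_eval₂_mu, ← PowerSeries.X_dvd_iff]
      exact (dvd_pow_self _ (Nat.succ_ne_zero k)).trans h
    obtain ⟨p', rfl⟩ := exists_eq_C_X_mul h0
    rw [eval₂_mul, eval₂_C, mu_X, pow_succ', mul_dvd_mul_iff_left PowerSeries.X_ne_zero] at h
    obtain ⟨q, rfl⟩ := ih p' h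
    exact ⟨q, by rw [pow_succ', C_mul, mul_assoc]⟩

/-- The closure of the ring generated by `y` over the power series ring. -/
def orbitRing (y : PowerSeries (HahnSeries ℤ κ)) : Subring (PowerSeries (HahnSeries ℤ κ)) where
  carrier := {f | ∀ n, ∃ p : (PowerSeries κ)[X], PowerSeries.X ^ n ∣ f - p.eval₂ (mu κ) y}
  mul_mem' := by
    intro f g hf hg n
    obtain ⟨p, hp⟩ := hf n
    obtain ⟨q, hq⟩ := hg n
    refine ⟨p * q, ?_⟩
    rw [eval₂_mul, show f * g - p.eval₂ (mu κ) y * q.eval₂ (mu κ) y = (f - p.eval₂ (mu κ) y) * g +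
      p.eval₂ (mu κ) y * (g - q.eval₂ (mu κ) y) by ring]
    exact dvd_add (hp.mul_right _) (hq.mul_left _)
  one_mem' := fun n => ⟨1, by simp⟩
  add_mem' := by
    intro f g hf hg n
    obtain ⟨p, hp⟩ := hf n
    obtain ⟨q, hq⟩ := hg n
    refine ⟨p + q, ?_⟩
    rw [eval₂_add, add_sub_add_comm]
    exact dvd_add hp hq
  zero_mem' := fun n => ⟨0, by simp⟩
  neg_mem' := by
    intro f hf n
    obtain ⟨p, hp⟩ := hf n
    refine ⟨-p, ?_⟩
    rw [eval₂_neg, ← neg_sub']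
    exact (dvd_neg).2 hp

theorem eval₂_mem_orbitRing (p : (PowerSeries κ)[X]) : p.eval₂ (mu κ) y ∈ orbitRing y :=
  fun n => ⟨p, by simp⟩

theorem exists_lead_of_mem_orbitRing (hy : Lead (-1) 1 (PowerSeries.constantCoeff y))
    {f : PowerSeries (HahnSeries ℤ κ)} (hf : f ∈ orbitRing y) (h0 : f ≠ 0) :
    ∃ (k e : ℕ) (c : κ), c ≠ 0 ∧ Lead (toLex ((k : ℤ), -(e : ℤ))) c (iota κ f) := by
  obtain ⟨k, g, hg, rfl⟩ : ∃ k g, PowerSeries.constantCoeff g ≠ 0 ∧ f = PowerSeries.X ^ k * g := by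
    have hfin := PowerSeries.order_finite_iff_ne_zero.2 h0
    obtain ⟨g, hg⟩ := PowerSeries.X_pow_order_dvd (φ := f)
    refine ⟨_, g, ?_, hg⟩
    intro h
    have h1 := PowerSeries.coeff_order h0
    apply h1
    have := PowerSeries.coeff_X_pow_mul g f.order.toNat 0
    rw [zero_add, PowerSeries.coeff_zero_eq_constantCoeff_apply, h] at this
    rwa [← hg] at this
  obtain ⟨p, hp⟩ := hf (k + 1)
  have h1 : PowerSeries.X ^ k ∣ p.eval₂ (mu κ) y := by
    have h2 := (pow_dvd_pow PowerSeries.X (Nat.le_succ k)).trans hp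
    exact (dvd_sub_right (dvd_mul_right _ _)).1 h2
  obtain ⟨q, rfl⟩ := X_pow_dvd_of_eval₂ hy k p h1
  rw [eval₂_mul, eval₂_C, map_pow, mu_X, ← mul_sub, pow_succ,
    mul_dvd_mul_iff_left (pow_ne_zero _ PowerSeries.X_ne_zero), PowerSeries.X_dvd_iff, map_sub,
    sub_eq_zero, constantCoeff_eval₂_mu] at hp
  have hL := lead_eval₂ hy (by norm_num) (q.map PowerSeries.constantCoeff)
  rw [← hp, one_pow, mul_one] at hL
  refine ⟨k, (q.map PowerSeries.constantCoeff).natDegree, _, ?_, lead_iota k g (hL.congr (by simp) rfl)⟩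
  rw [Ne, leadingCoeff_eq_zero]
  intro h
  rw [h] at hp
  exact hg (by simpa using hp)

/-- Power series over `κ[X]`, with `X` evaluated at a monomial. -/
noncomputable def evalMonomial (m : ℕ) (c : κ) : PowerSeries κ[X] →+* PowerSeries (HahnSeries ℤ κ) :=
  PowerSeries.map (eval₂RingHom HahnSeries.C (HahnSeries.single (-(m : ℤ)) c))

theorem evalMonomial_injective {m : ℕ} (hm : 0 < m) {c : κ} (hc : c ≠ 0) :
    Function.Injective (evalMonomial m c) := by
  rw [injective_iff_map_eq_zero]
  intro f hf
  ext1 i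
  rw [map_zero]
  by_contra h
  refine eval₂_ne_zero_of_lead (Lead.single (-(m : ℤ)) c) (by omega) hc h ?_
  have := congrArg (PowerSeries.coeff i) hf
  rw [evalMonomial, PowerSeries.coeff_map, map_zero] at this
  exact this

theorem eval₂_evalMonomial_C (m : ℕ) (c : κ) (q : κ[X]) (v : (PowerSeries κ)[X])
    (hv : v.eval₂ (mu κ) y = PowerSeries.C (HahnSeries.single (-(m : ℤ)) c)) :
    (q.eval₂ (C.comp PowerSeries.C) v).eval₂ (mu κ) y = evalMonomial m c (PowerSeries.C q) := by
  rw [← coe_eval₂RingHom, hom_eval₂, coe_eval₂RingHom, hv, evalMonomial, PowerSeries.map_C]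
  rw [coe_eval₂RingHom, hom_eval₂]
  congr 1
  ext1 a
  simp [mu]

theorem exists_shift {R : Type*} [CommRing R] (f : PowerSeries R) :
    ∃ (a : R) (g : PowerSeries R), f = PowerSeries.C a + PowerSeries.X * g :=
  ⟨PowerSeries.constantCoeff f, PowerSeries.mk fun i => PowerSeries.coeff (i + 1) f, by
    rw [add_comm]; exact PowerSeries.eq_X_mul_shift_add_const f⟩

theorem evalMonomial_mem_orbitRing (m : ℕ) (c : κ) {v : (PowerSeries κ)[X]}
    (hv : v.eval₂ (mu κ) y = PowerSeries.C (HahnSeries.single (-(m : ℤ)) c)) (f : PowerSeries κ[X]) :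
    evalMonomial m c f ∈ orbitRing y := by
  intro n
  induction n generalizing f with
  | zero => exact ⟨0, by simp⟩
  | succ n ih =>
    obtain ⟨a, g, rfl⟩ := exists_shift f
    obtain ⟨p, hp⟩ := ih g
    refine ⟨a.eval₂ (C.comp PowerSeries.C) v + C PowerSeries.X * p, ?_⟩
    rw [eval₂_add, eval₂_mul, eval₂_C, mu_X, eval₂_evalMonomial_C m c a v hv, map_add, map_mul,
      add_sub_add_left_eq_sub, show evalMonomial m c PowerSeries.X = PowerSeries.X by simp [evalMonomial],
      ← mul_sub, pow_succ']
    exact mul_dvd_mul_left _ hp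

/-- One step of the expansion of a polynomial in powers of `v`. -/
theorem exists_expand_step (v : (PowerSeries κ)[X])
    (hm : 0 < (v.map PowerSeries.constantCoeff).natDegree) (h : (PowerSeries κ)[X]) :
    ∃ (q : ℕ → κ[X]) (h' : (PowerSeries κ)[X]),
      h = ∑ b ∈ Finset.range (v.map PowerSeries.constantCoeff).natDegree,
        (q b).eval₂ (C.comp PowerSeries.C) v * X ^ b + C PowerSeries.X * h' := by
  set V := v.map PowerSeries.constantCoeff with hV
  set m := V.natDegree with hmdef
  have hc : V.leadingCoeff ≠ 0 := leadingCoeff_ne_zero.2 (by rintro h; simp [hmdef, h] at hm)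
  have hG : (C V.leadingCoeff⁻¹ * V).Monic := by
    rw [mul_comm]; exact monic_mul_leadingCoeff_inv (leadingCoeff_ne_zero.1 hc)
  have hGN : (C V.leadingCoeff⁻¹ * V).natDegree = m := natDegree_C_mul (inv_ne_zero hc)
  set H := h.map PowerSeries.constantCoeff with hH
  obtain ⟨a, -, ha1, ha2⟩ := exists_adic_expansion hG hGN (RingHom.id κ) (by simp) (H.natDegree + 1)
    (b := H) (by simp) (by
      refine lt_of_le_of_lt degree_le_natDegree ?_
      norm_cast
      nlinarith)
  let q : ℕ → κ[X] := fun b => ∑ k ∈ Finset.range (H.natDegree + 1),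
    C ((a k).coeff b * V.leadingCoeff⁻¹ ^ k) * X ^ k
  have h0 : (h - ∑ b ∈ Finset.range m, (q b).eval₂ (C.comp PowerSeries.C) v * X ^ b).map
      PowerSeries.constantCoeff = 0 := by
    rw [Polynomial.map_sub, Polynomial.map_sum, ← hH, sub_eq_zero]
    have h1 : ∀ b, ((q b).eval₂ (C.comp PowerSeries.C) v * X ^ b).map PowerSeries.constantCoeff =
        ∑ k ∈ Finset.range (H.natDegree + 1), C ((a k).coeff b) * X ^ b * (C V.leadingCoeff⁻¹ * V) ^ k := by
      intro b
      simp only [q, eval₂_finsetSum, Polynomial.map_mul, Polynomial.map_sum, eval₂_mul, eval₂_C, eval₂_pow, eval₂_X,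
        Polynomial.map_pow, map_X, RingHom.comp_apply, map_C, PowerSeries.constantCoeff_C, ← hV, Finset.sum_mul]
      refine Finset.sum_congr rfl fun k _ => ?_
      rw [C_mul, C_pow]; ring
    simp_rw [h1]
    rw [Finset.sum_comm]
    conv_lhs => rw [ha2]
    refine Finset.sum_congr rfl fun k _ => ?_
    rw [← Finset.sum_mul]
    congr 1
    by_cases hk : a k = 0
    · simp [hk]
    · conv_lhs => rw [(a k).as_sum_range_C_mul_X_pow' (natDegree_lt_iff_degree_lt hk |>.2 (ha1 k))]
  obtain ⟨h', hh'⟩ := exists_eq_C_X_mul h0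
  exact ⟨q, h', by rw [← hh']; ring⟩

/-- A monic equation of degree `m` over the power series in `v`, satisfied by all roots. -/
theorem exists_monic_equation (v : (PowerSeries κ)[X])
    (hm : 0 < (v.map PowerSeries.constantCoeff).natDegree) :
    ∃ Ω : (PowerSeries κ[X])[X], Ω.Monic ∧ Ω.natDegree = (v.map PowerSeries.constantCoeff).natDegree ∧
      ∀ (c : κ) (y : PowerSeries (HahnSeries ℤ κ)), v.eval₂ (mu κ) y = PowerSeries.C (HahnSeries.single
        (-((v.map PowerSeries.constantCoeff).natDegree : ℤ)) c) →
        Ω.eval₂ (evalMonomial (v.map PowerSeries.constantCoeff).natDegree c) y = 0 := by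
  set m := (v.map PowerSeries.constantCoeff).natDegree with hmdef
  choose q next hqn using exists_expand_step v hm
  let h : ℕ → (PowerSeries κ)[X] := fun i => next^[i] (X ^ m)
  have hh : ∀ i, h (i + 1) = next (h i) := fun i => Function.iterate_succ_apply' next i _
  let p : ℕ → ℕ → PowerSeries κ[X] := fun i b => PowerSeries.mk fun n => q (h (i + n)) b
  have hp : ∀ i b, p i b = PowerSeries.C (q (h i) b) + PowerSeries.X * p (i + 1) b := by
    intro i b
    have h1 := PowerSeries.eq_X_mul_shift_add_const (p i b)
    rw [add_comm] at h1
    rw [h1]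
    congr 2
    ext1 n
    simp only [p, PowerSeries.coeff_mk]
    congr 2; ring_nf
  let Ω : (PowerSeries κ[X])[X] := X ^ m - ∑ b ∈ Finset.range m, C (p 0 b) * X ^ b
  have hdeg : (∑ b ∈ Finset.range m, C (p 0 b) * X ^ b : (PowerSeries κ[X])[X]).degree < m := by
    refine lt_of_le_of_lt (degree_sum_le _ _) ?_
    refine (Finset.sup_lt_iff (WithBot.bot_lt_coe m)).2 fun b hb => ?_
    exact (degree_C_mul_X_pow_le _ _).trans_lt (WithBot.coe_lt_coe.2 (Finset.mem_range.1 hb))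
  refine ⟨Ω, monic_X_pow_sub hdeg,
    natDegree_eq_of_degree_eq_some ?_, ?_⟩
  · rw [degree_sub_eq_left_of_degree_lt (by rwa [degree_X_pow]), degree_X_pow]
  intro c y hv
  have hX : evalMonomial m c PowerSeries.X = PowerSeries.X := by simp [evalMonomial]
  have key : ∀ n i, PowerSeries.X ^ n ∣ (h i).eval₂ (mu κ) y -
      ∑ b ∈ Finset.range m, evalMonomial m c (p i b) * y ^ b := by
    intro n
    induction n with
    | zero => intro i; simp
    | succ n ih =>
      intro i
      have h2 : (h i).eval₂ (mu κ) y - ∑ b ∈ Finset.range m, evalMonomial m c (p i b) * y ^ b =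
          PowerSeries.X * ((h (i + 1)).eval₂ (mu κ) y -
            ∑ b ∈ Finset.range m, evalMonomial m c (p (i + 1) b) * y ^ b) := by
        rw [hqn (h i), ← hh, eval₂_add, eval₂_mul, eval₂_C, mu_X, eval₂_finsetSum]
        simp_rw [hp i, map_add, map_mul, hX, eval₂_mul, eval₂_pow, eval₂_X,
          eval₂_evalMonomial_C m c _ v hv, add_mul, Finset.sum_add_distrib, mul_sub, Finset.mul_sum, mul_assoc]
        ring
      rw [h2, pow_succ']
      exact mul_dvd_mul_left _ (ih (i + 1))
  have h3 : (X ^ m : (PowerSeries κ)[X]).eval₂ (mu κ) y -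
      ∑ b ∈ Finset.range m, evalMonomial m c (p 0 b) * y ^ b = 0 := by
    ext1 n
    erw [PowerSeries.X_pow_dvd_iff.1 (key (n + 1) 0) n (Nat.lt_succ_self n), map_zero]
  rw [eval₂_sub, eval₂_finsetSum]
  simpa only [eval₂_mul, eval₂_C, eval₂_pow, eval₂_X] using h3

end
end Polynomial.GaProper

namespace Polynomial.GaProper
open Polynomial

/-- The norm of a polynomial over the roots of a monic polynomial is defined over the base. -/
theorem exists_map_eq_prod_eval {A K ι : Type*} [CommRing A] [CommRing K] [IsDomain K] (φ : A →+* K)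
    (P q : A[X]) (hP : P.Monic) (s : Finset ι) (a : ι → K)
    (h : P.map φ = ∏ i ∈ s, (X - C (a i))) :
    ∃ r, φ r = ∏ i ∈ s, (q.map φ).eval (a i) := by
  have hPφ : (P.map φ).Monic := hP.map φ
  have hroots : (P.map φ).roots = s.val.map a := by
    rw [h];
    have h2 := roots_multiset_prod_X_sub_C (s.val.map a)
    rwa [Multiset.map_map] at h2
  have hsplit : (P.map φ).Splits := by
    rw [h]; exact Splits.prod fun i _ => Splits.X_sub_C _
  have h1 := resultant_eq_prod_eval (P.map φ) (q.map φ) (q.map φ).natDegree le_rfl hsplit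
  refine ⟨P.resultant q (P.map φ).natDegree (q.map φ).natDegree, ?_⟩
  rw [← resultant_map_map, h1, hPφ.leadingCoeff, one_pow, one_mul, hroots, Multiset.map_map]
  rfl

theorem eq_prod_X_sub_C {K : Type*} [CommRing K] [IsDomain K] {P : K[X]} (hP : P.Monic) {m : ℕ}
    (hm : P.natDegree = m) {a : ℕ → K} (ha : ∀ k < m, ∀ l < m, a k = a l → k = l)
    (h : ∀ k < m, P.eval (a k) = 0) : P = ∏ k ∈ Finset.range m, (X - C (a k)) := by
  have h1 : (∏ k ∈ Finset.range m, (X - C (a k))).Monic :=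
    monic_prod_of_monic _ _ fun _ _ => monic_X_sub_C _
  have h2 : (∏ k ∈ Finset.range m, (X - C (a k))).natDegree = m := by
    rw [natDegree_prod_of_monic _ _ fun _ _ => monic_X_sub_C _,
      Finset.sum_congr rfl fun j _ => natDegree_X_sub_C _]
    simp
  have hd : P.degree = m := by rw [degree_eq_natDegree hP.ne_zero, hm]
  refine eq_of_degree_sub_lt_of_eval_index_eq (Finset.range m) (v := a) ?_ ?_ ?_
  · intro k hk l hl hkl
    exact ha k (by simpa using hk) l (by simpa using hl) hkl
  · rw [Finset.card_range, ← hd]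
    exact degree_sub_lt_left (by rw [hd, degree_eq_natDegree h1.ne_zero, h2]) hP.ne_zero
      (by rw [hP.leadingCoeff, h1.leadingCoeff])
  · intro k hk
    rw [h k (Finset.mem_range.1 hk), eval_prod, Finset.prod_eq_zero hk (by simp)]

section
variable {κ : Type*} [Field κ] [CharZero κ]

/-- Evaluation of bivariate polynomials. -/
noncomputable def evalPair (a b : PowerSeries (HahnSeries ℤ κ)) :
    (PowerSeries κ)[X][X] →+* PowerSeries (HahnSeries ℤ κ) :=
  eval₂RingHom (eval₂RingHom (mu κ) a) b

theorem evalPair_C (a b : PowerSeries (HahnSeries ℤ κ)) (p : (PowerSeries κ)[X]) :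
    evalPair a b (C p) = p.eval₂ (mu κ) a := by simp [evalPair]

theorem evalPair_X (a b : PowerSeries (HahnSeries ℤ κ)) : evalPair a b X = b := by simp [evalPair]

theorem evalPair_map_C (a b : PowerSeries (HahnSeries ℤ κ)) (p : (PowerSeries κ)[X]) :
    evalPair a b (p.map C) = p.eval₂ (mu κ) b := by
  rw [evalPair, coe_eval₂RingHom, eval₂_map]
  congr 1
  ext1 f
  simp

theorem add_eq_add_of_sub_mul_eq_sub {A : Type*} [CommRing A] {x y p a b : A}
    (h : (x - y) * p = a - b) : x * p + b = a + y * p := by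
  linear_combination h

theorem evalPair_sub_relation (a b : PowerSeries (HahnSeries ℤ κ)) {p : (PowerSeries κ)[X]}
    {p₁ : (PowerSeries κ)[X][X]} (h : (C X - X) * p₁ = C p - p.map C) :
    (a - b) * evalPair a b p₁ = p.eval₂ (mu κ) a - p.eval₂ (mu κ) b := by
  have h1 : C X * p₁ + p.map C = C p + X * p₁ :=
    add_eq_add_of_sub_mul_eq_sub (A := (PowerSeries κ)[X][X]) h
  have h2 := congrArg (evalPair a b) h1
  rw [RingHom.map_add, RingHom.map_add, RingHom.map_mul, RingHom.map_mul, evalPair_C, evalPair_C,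
    evalPair_X, evalPair_map_C, eval₂_X] at h2
  linear_combination h2

/-- Minus the exponent of the second variable. -/
def lexDegree : ℤ ×ₗ ℤ →+ ℤ :=
  (-(AddMonoidHom.id ℤ)).comp ⟨⟨fun g : ℤ ×ₗ ℤ => (ofLex g).2, rfl⟩, fun _ _ => rfl⟩

theorem lexDegree_apply (a b : ℤ) : lexDegree (toLex (a, b)) = -b := rfl

theorem map_scale_fixed {ω : κ} (hω : ω ≠ 0) {m : ℕ} (h : ω ^ m = 1) (c : κ) (k : ℕ) :
    (scale (-(AddMonoidHom.id ℤ)) ω hω ^ k) (HahnSeries.single (-(m : ℤ)) c) =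
      HahnSeries.single (-(m : ℤ)) c := by
  ext g
  rw [coeff_scale_pow]
  by_cases hg : g = -(m : ℤ)
  · subst hg; simp [h]
  · rw [HahnSeries.coeff_single_of_ne hg, mul_zero]

theorem map_scale_mu {ω : κ} (hω : ω ≠ 0) (k : ℕ) (f : PowerSeries κ) :
    PowerSeries.map (scale (-(AddMonoidHom.id ℤ)) ω hω ^ k) (mu κ f) = mu κ f := by
  ext i g
  rw [PowerSeries.coeff_map, coeff_scale_pow, mu, PowerSeries.coeff_map]
  by_cases hg : g = 0
  · subst hg; simp
  · rw [HahnSeries.C_apply, HahnSeries.coeff_single_of_ne hg, mul_zero]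

theorem scale_pow_iota {ω : κ} (hω : ω ≠ 0) (k : ℕ) (f : PowerSeries (HahnSeries ℤ κ)) :
    (scale lexDegree ω hω ^ k) (iota κ f) =
      iota κ (PowerSeries.map (scale (-(AddMonoidHom.id ℤ)) ω hω ^ k) f) := by
  induction k generalizing f with
  | zero =>
    rw [pow_zero, RingHom.one_def, RingHom.id_apply]
    refine congrArg _ ?_
    ext i g
    rw [PowerSeries.coeff_map, coeff_scale_pow]; simp
  | succ k ih =>
    rw [pow_succ, RingHom.mul_def, RingHom.comp_apply]
    have h1 : scale lexDegree ω hω (iota κ f) =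
        iota κ (PowerSeries.map (scale (-(AddMonoidHom.id ℤ)) ω hω) f) := (iota_map_scale _ _ _ _).symm
    rw [h1, ih]
    congr 1

theorem core [IsAlgClosed κ] {v w : (PowerSeries κ)[X]} {v₁ w₁ α β : (PowerSeries κ)[X][X]}
    (hv₁ : (C X - X) * v₁ = C v - v.map C) (hw₁ : (C X - X) * w₁ = C w - w.map C)
    {N : ℕ} {s : (PowerSeries κ)[X][X]}
    (h : α * v₁ + β * w₁ = C (C PowerSeries.X) ^ N * (1 + C (C PowerSeries.X) * s))
    (hm : 0 < (v.map PowerSeries.constantCoeff).natDegree)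
    (hmn : (v.map PowerSeries.constantCoeff).natDegree ≤ (w.map PowerSeries.constantCoeff).natDegree) :
    (v.map PowerSeries.constantCoeff).natDegree ∣ (w.map PowerSeries.constantCoeff).natDegree := by
  obtain ⟨Ω, hΩ1, hΩ2, hΩ3⟩ := exists_monic_equation v hm
  obtain ⟨y, hy, hvy⟩ := exists_iterated_root v hm
  set V := v.map PowerSeries.constantCoeff with hV
  set W := w.map PowerSeries.constantCoeff with hW
  set m := V.natDegree with hmdef
  have hc : V.leadingCoeff ≠ 0 := leadingCoeff_ne_zero.2 (by rintro h; simp [hmdef, h] at hm)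
  have : NeZero (m : κ) := ⟨by exact_mod_cast hm.ne'⟩
  obtain ⟨ω, hω⟩ := HasEnoughRootsOfUnity.exists_primitiveRoot κ m
  have hω0 : ω ≠ 0 := hω.ne_zero hm.ne'
  let T : Twist (ℤ ×ₗ ℤ) κ m := Twist.ofScale lexDegree ω hm hω
  let ys : ℕ → PowerSeries (HahnSeries ℤ κ) := fun k =>
    PowerSeries.map (scale (-(AddMonoidHom.id ℤ)) ω hω0 ^ k) y
  have hmap : ∀ (p : (PowerSeries κ)[X]) k, PowerSeries.map (scale (-(AddMonoidHom.id ℤ)) ω hω0 ^ k)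
      (p.eval₂ (mu κ) y) = p.eval₂ (mu κ) (ys k) := by
    intro p k
    rw [hom_eval₂]
    congr 1
    ext1 f
    exact map_scale_mu hω0 k f
  have hys0 : ys 0 = y := by
    ext i g
    simp only [ys, PowerSeries.coeff_map, coeff_scale_pow]; simp
  have hTσ : ∀ k f, (T.σ ^ k) (iota κ f) =
      iota κ (PowerSeries.map (scale (-(AddMonoidHom.id ℤ)) ω hω0 ^ k) f) := fun k f =>
    scale_pow_iota hω0 k f
  have hvys : ∀ k, v.eval₂ (mu κ) (ys k) = PowerSeries.C (HahnSeries.single (-(m : ℤ)) V.leadingCoeff) := by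
    intro k
    rw [← hmap, hvy, PowerSeries.map_C, map_scale_fixed hω0 hω.pow_eq_one]
  have hlead : ∀ k, Lead (-1) (ω ^ k) (PowerSeries.constantCoeff (ys k)) := by
    intro k
    have h1 : PowerSeries.constantCoeff (ys k) =
        (scale (-(AddMonoidHom.id ℤ)) ω hω0 ^ k) (PowerSeries.constantCoeff y) := by
      rw [← PowerSeries.coeff_zero_eq_constantCoeff_apply, PowerSeries.coeff_map,
        PowerSeries.coeff_zero_eq_constantCoeff_apply]
    rw [h1]
    constructor
    · rw [coeff_scale_pow, hy.1]; simp
    · intro g hg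
      rw [coeff_scale_pow, hy.2 g hg, mul_zero]
  have hdist : ∀ k l, k < m → l < m → ys k = ys l → k = l := by
    intro k l hk hl hkl
    have h1 := (hlead k).1
    rw [hkl, (hlead l).1] at h1
    exact (hω.pow_inj hl hk h1).symm
  have hlead_sub : ∀ k, 0 < k → k < m → ∃ c, c ≠ 0 ∧
      Lead (toLex ((0 : ℤ), (-1 : ℤ))) c (iota κ (y - ys k)) := by
    intro k hk hkm
    refine ⟨1 - ω ^ k, ?_, ?_⟩
    · rw [sub_ne_zero]
      intro h1
      exact hω.pow_ne_one_of_pos_of_lt hk.ne' hkm h1.symm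
    · have := lead_iota 0 (y - ys k) (γ := -1) (c := 1 - ω ^ k) (by
        rw [map_sub]; exact hy.sub (hlead k))
      simpa using this
  -- the factorization of `Ω`
  set φ := evalMonomial m V.leadingCoeff with hφ
  have hΩφ : Ω.map φ = ∏ k ∈ Finset.range m, (X - C (ys k)) := by
    refine eq_prod_X_sub_C (hΩ1.map φ) (by rw [hΩ1.natDegree_map, hΩ2]) ?_ ?_
    · intro k hk l hl h; exact hdist k l hk hl h
    · intro k _
      rw [eval_map]
      exact hΩ3 _ _ (hvys k)
  -- the characteristic polynomial of `w`
  obtain ⟨Φ, hΦ⟩ := exists_map_eq_prod_eval (mapRingHom φ) (Ω.map C)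
    (C X - (w.map (PowerSeries.map C)).map C) (hΩ1.map _) (Finset.range m) (fun k => C (ys k)) (by
      have h1 := congrArg (Polynomial.map C) hΩφ
      rw [Polynomial.map_map] at h1 ⊢
      have h2 : (mapRingHom φ).comp C = C.comp φ := by ext1 f; simp
      rw [h2, h1, Polynomial.map_prod]
      simp)
  have hΦ' : Φ.map φ = ∏ k ∈ Finset.range m, (X - C (w.eval₂ (mu κ) (ys k))) := by
    rw [coe_mapRingHom] at hΦ
    rw [hΦ]
    refine Finset.prod_congr rfl fun k _ => ?_
    rw [Polynomial.map_sub, eval_sub, map_C, eval_C, coe_mapRingHom, map_X, Polynomial.map_map,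
      eval_map, eval₂_map, hom_eval₂]
    congr 2
    ext1 f
    simp only [RingHom.comp_apply, coe_mapRingHom, map_C]
    congr 1
    ext i g
    simp [hφ, evalMonomial, mu]
  have hj : ∀ k f, (T.σ ^ k) (iota κ (φ f)) = iota κ (φ f) := by
    intro k f
    rw [hTσ]
    congr 1
    ext1 i
    rw [PowerSeries.coeff_map, hφ, evalMonomial, PowerSeries.coeff_map, coe_eval₂RingHom, hom_eval₂,
      map_scale_fixed hω0 hω.pow_eq_one]
    congr 1
    ext a g
    rw [RingHom.comp_apply, coeff_scale_pow]
    by_cases hg : g = 0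
    · subst hg; simp
    · rw [HahnSeries.C_apply, HahnSeries.coeff_single_of_ne hg, mul_zero]
  have hposE : ∀ f ∈ orbitRing y, f ≠ 0 → 0 ≤ T.d (iota κ f).order := by
    intro f hf h0
    obtain ⟨k, e, c, hc, hL⟩ := exists_lead_of_mem_orbitRing hy hf h0
    rw [hL.order_eq hc]
    change (0 : ℤ) ≤ lexDegree _
    rw [lexDegree_apply]; omega
  have hyE : y ∈ orbitRing y := by
    have := eval₂_mem_orbitRing (y := y) (X : (PowerSeries κ)[X])
    rwa [eval₂_X] at this
  have hφE : ∀ f, φ f ∈ orbitRing y := evalMonomial_mem_orbitRing m _ hvy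
  -- collisions along the orbit
  have hrel : ∀ k, 0 < k → k < m → evalPair y (ys k) β * (w.eval₂ (mu κ) y - w.eval₂ (mu κ) (ys k)) =
      (y - ys k) * (PowerSeries.X ^ N * (1 + PowerSeries.X * evalPair y (ys k) s)) := by
    intro k hk hkm
    have hne : y - ys k ≠ 0 := by
      rw [sub_ne_zero]
      intro h
      rw [← hys0] at h
      have := hdist 0 k hm hkm h
      omega
    have h1 := evalPair_sub_relation y (ys k) hv₁
    have h2 := evalPair_sub_relation y (ys k) hw₁
    have h3 := congrArg (evalPair y (ys k)) h
    rw [RingHom.map_add, RingHom.map_mul, RingHom.map_mul] at h3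
    rw [hvys, hvy, sub_self] at h1
    rw [(mul_eq_zero.1 h1).resolve_left hne, mul_zero, zero_add] at h3
    rw [← h2]
    rw [RingHom.map_mul, RingHom.map_pow, RingHom.map_add, RingHom.map_mul, evalPair_C, eval₂_C, mu_X,
      RingHom.map_one] at h3
    rw [← h3]; ring
  obtain ⟨B, hB⟩ : ∃ B : orbitRing y, (orbitRing y).subtype B =
      ∏ k ∈ (Finset.range m).erase 0, evalPair y (ys k) β := by
    let φE : PowerSeries κ[X] →+* orbitRing y := φ.codRestrict (orbitRing y) hφE
    have hφE' : (orbitRing y).subtype.comp φE = φ := by ext1 f; rfl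
    have hroot : (Ω.map φE).IsRoot ⟨y, hyE⟩ := by
      refine (orbitRing y).subtype_injective ?_
      rw [eval_map, map_zero, hom_eval₂, hφE']
      exact hΩ3 _ _ hvy
    obtain ⟨Q, hQ⟩ := dvd_iff_isRoot.2 hroot
    have hQm : Q.Monic := Monic.of_mul_monic_left (monic_X_sub_C _) (hQ ▸ hΩ1.map φE)
    let μE : PowerSeries κ →+* orbitRing y := (mu κ).codRestrict (orbitRing y) fun f => by
      have := eval₂_mem_orbitRing (y := y) (C f)
      rwa [eval₂_C] at this
    have hμE : (orbitRing y).subtype.comp μE = mu κ := by ext1 f; rfl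
    obtain ⟨B, hB⟩ := exists_map_eq_prod_eval (orbitRing y).subtype Q
      (β.map (eval₂RingHom μE ⟨y, hyE⟩)) hQm ((Finset.range m).erase 0) ys (by
        have h1 := congrArg (Polynomial.map (orbitRing y).subtype) hQ
        rw [Polynomial.map_map, hφE', hΩφ, ← Finset.mul_prod_erase _ _ (Finset.mem_range.2 hm), hys0,
          Polynomial.map_mul, Polynomial.map_sub, map_X, map_C] at h1
        exact (mul_left_cancel₀ (X_sub_C_ne_zero y) h1).symm)
    refine ⟨B, hB.trans (Finset.prod_congr rfl fun k _ => ?_)⟩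
    rw [Polynomial.map_map, eval_map, evalPair, coe_eval₂RingHom]
    congr 1
    refine Polynomial.ringHom_ext (fun a => ?_) ?_
    · rw [RingHom.comp_apply, coe_eval₂RingHom, coe_eval₂RingHom, hom_eval₂, hμE]; rfl
    · rw [RingHom.comp_apply, coe_eval₂RingHom, coe_eval₂RingHom, eval₂_X, eval₂_X]; rfl
  have hLw : Lead (toLex ((0 : ℤ), -(W.natDegree : ℤ))) (W.leadingCoeff)
      (iota κ (w.eval₂ (mu κ) y)) := by
    have h1 := lead_eval₂ hy (by norm_num) W
    rw [hW, ← constantCoeff_eval₂_mu, ← hW, one_pow, mul_one] at h1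
    have := lead_iota 0 (w.eval₂ (mu κ) y) (h1.congr (by simp : _ = -(W.natDegree : ℤ)) rfl)
    simpa using this
  have hW0 : W.leadingCoeff ≠ 0 := leadingCoeff_ne_zero.2 (by rintro h; simp [h] at hmn; omega)
  have hone : ∀ (N : ℕ) s, Lead (toLex ((N : ℤ), (0 : ℤ))) 1
      (iota κ (PowerSeries.X ^ N * (1 + PowerSeries.X * s))) := fun N s =>
    lead_iota N _ (by simpa using Lead.one)
  have hσw : ∀ k, (T.σ ^ k) (iota κ (w.eval₂ (mu κ) y)) = iota κ (w.eval₂ (mu κ) (ys k)) := by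
    intro k; rw [hTσ, hmap]
  have hcoll : ∀ k, 0 < k → k < m → evalPair y (ys k) β ≠ 0 ∧
      w.eval₂ (mu κ) y - w.eval₂ (mu κ) (ys k) ≠ 0 ∧
      T.d (iota κ (evalPair y (ys k) β)).order +
        T.d (iota κ (w.eval₂ (mu κ) y - w.eval₂ (mu κ) (ys k))).order = 1 := by
    intro k hk hkm
    obtain ⟨c, hc, hL⟩ := hlead_sub k hk hkm
    have h1 := congrArg (iota κ) (hrel k hk hkm)
    have h2 := hL.mul (hone N (evalPair y (ys k) s))
    rw [← map_mul, ← h1, mul_one] at h2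
    have h3 := h2.ne_zero hc
    rw [map_mul] at h3 h2
    have h4 := h2.order_eq hc
    rw [HahnSeries.order_mul (left_ne_zero_of_mul h3) (right_ne_zero_of_mul h3)] at h4
    refine ⟨?_, ?_, ?_⟩
    · intro h; apply left_ne_zero_of_mul h3; rw [h, map_zero]
    · intro h; apply right_ne_zero_of_mul h3; rw [h, map_zero]
    · rw [← map_add, h4]; rfl
  refine T.dvd_of_diffSum_le (j := (iota κ).comp φ) (w := iota κ (w.eval₂ (mu κ) y)) (Φ := Φ)
    (fun p => ?_) ?_ ?_ ?_ ?_ hm ?_ hmn ?_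
  · simpa using hj 1 p
  · rw [← Polynomial.map_map, hΦ', Polynomial.map_prod]
    refine Finset.prod_congr rfl fun k _ => ?_
    rw [hσw, Polynomial.map_sub, map_X, map_C]
  · exact iota_injective.comp (evalMonomial_injective hm hc)
  · intro F hF
    have h1 : (F.map ((iota κ).comp φ)).eval (iota κ (w.eval₂ (mu κ) y)) =
        iota κ ((F.map φ).eval (w.eval₂ (mu κ) y)) := by
      rw [eval_map, eval_map, ← hom_eval₂]
    rw [h1] at hF ⊢
    refine hposE _ ?_ (by rintro h; rw [h, map_zero] at hF; exact hF rfl)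
    rw [eval_map, eval₂_eq_sum_range]
    exact sum_mem fun i _ => mul_mem (hφE _) (pow_mem (eval₂_mem_orbitRing w) i)
  · intro k hk hkm h
    rw [hσw] at h
    exact (hcoll k hk hkm).2.1 (sub_eq_zero.2 (iota_injective h).symm)
  · rw [hLw.order_eq hW0]
    change lexDegree _ = _
    rw [lexDegree_apply, neg_neg]
  · have h1 : T.diffSum (iota κ (w.eval₂ (mu κ) y)) m =
        ∑ k ∈ (Finset.range m).erase 0, (1 - T.d (iota κ (evalPair y (ys k) β)).order) := by
      unfold Twist.diffSum
      refine Finset.sum_congr ?_ ?_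
      · ext k
        simp only [Finset.mem_filter, Finset.mem_range, Finset.mem_erase]
        constructor
        · rintro ⟨h1, h2⟩
          exact ⟨by rintro rfl; exact h2 (dvd_zero _), h1⟩
        · rintro ⟨h1, h2⟩
          exact ⟨h2, fun h3 => by have := Nat.le_of_dvd (Nat.pos_of_ne_zero h1) h3; omega⟩
      · intro k hk
        rw [Finset.mem_erase, Finset.mem_range] at hk
        obtain ⟨-, -, h3⟩ := hcoll k (Nat.pos_of_ne_zero hk.1) hk.2
        rw [hσw, ← map_sub, ← h3]; ring
    have h2 : ∀ s : Finset ℕ, (∀ k ∈ s, evalPair y (ys k) β ≠ 0) →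
        T.d (iota κ (∏ k ∈ s, evalPair y (ys k) β)).order =
          ∑ k ∈ s, T.d (iota κ (evalPair y (ys k) β)).order := by
      intro s
      induction s using Finset.induction_on with
      | empty => simp
      | insert a s ha ih =>
        intro hs
        have h1 : ∀ f, f ≠ 0 → iota κ f ≠ 0 := fun f hf h => hf (iota_injective (h.trans (map_zero _).symm))
        rw [Finset.prod_insert ha, Finset.sum_insert ha, map_mul, HahnSeries.order_mul, map_add,
          ih fun k hk => hs k (Finset.mem_insert_of_mem hk)]
        · exact h1 _ (hs a (Finset.mem_insert_self _ _))
        · exact h1 _ (Finset.prod_ne_zero_iff.2 fun k hk => hs k (Finset.mem_insert_of_mem hk))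
    have hne : ∀ k ∈ (Finset.range m).erase 0, evalPair y (ys k) β ≠ 0 := fun k hk => by
      rw [Finset.mem_erase, Finset.mem_range] at hk
      exact (hcoll k (Nat.pos_of_ne_zero hk.1) hk.2).1
    have h3 := hposE _ (hB ▸ B.2 : _ ∈ orbitRing y) (Finset.prod_ne_zero_iff.2 hne)
    rw [h2 _ hne] at h3
    rw [h1, Finset.sum_sub_distrib, Finset.sum_const, Finset.card_erase_of_mem (Finset.mem_range.2 hm),
      Finset.card_range]
    simp only [nsmul_eq_mul, mul_one]
    omega

end
end Polynomial.GaProper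

namespace Polynomial.GaProper
open Polynomial

section
variable {R B : Type*} [CommRing R] [CommRing B] [Algebra R B] [Algebra ℚ B]

/-- The exponential of a derivation as a formal power series. -/
noncomputable def expSeries (D : Derivation R B B) (g : B) : PowerSeries B :=
  PowerSeries.mk fun j => ((j.factorial : ℚ)⁻¹) • (⇑D)^[j] g

theorem map_rat_smul (D : Derivation R B B) (q : ℚ) (g : B) : D (q • g) = q • D g :=
  _root_.map_rat_smul D q g

theorem coeff_expSeries (D : Derivation R B B) (g : B) (j : ℕ) :
    PowerSeries.coeff j (expSeries D g) = ((j.factorial : ℚ)⁻¹) • (⇑D)^[j] g :=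
  PowerSeries.coeff_mk _ _

theorem succ_mul_coeff_expSeries (D : Derivation R B B) (g : B) (j : ℕ) :
    ((j : ℚ) + 1) • PowerSeries.coeff (j + 1) (expSeries D g) = PowerSeries.coeff j (expSeries D (D g)) := by
  rw [coeff_expSeries, coeff_expSeries, smul_smul, Function.iterate_succ_apply]
  congr 1
  rw [Nat.factorial_succ]
  push_cast
  have : (j : ℚ) + 1 ≠ 0 := by positivity
  field_simp

theorem derivative_expSeries (D : Derivation R B B) (g : B) :
    PowerSeries.derivative B (expSeries D g) = expSeries D (D g) := by
  ext j
  rw [PowerSeries.coeff_derivative, ← succ_mul_coeff_expSeries, Algebra.smul_def, mul_comm]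
  simp

theorem expSeries_add (D : Derivation R B B) (g h : B) :
    expSeries D (g + h) = expSeries D g + expSeries D h := by
  ext j
  rw [map_add, coeff_expSeries, coeff_expSeries, coeff_expSeries, iterate_map_add, smul_add]

theorem expSeries_mul (D : Derivation R B B) (g h : B) :
    expSeries D (g * h) = expSeries D g * expSeries D h := by
  ext j
  induction j generalizing g h with
  | zero =>
    rw [coeff_expSeries, PowerSeries.coeff_zero_eq_constantCoeff_apply, map_mul,
      ← PowerSeries.coeff_zero_eq_constantCoeff_apply, ← PowerSeries.coeff_zero_eq_constantCoeff_apply,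
      coeff_expSeries, coeff_expSeries]
    simp
  | succ j ih =>
    have h1 : ((j : ℚ) + 1) • PowerSeries.coeff (j + 1) (expSeries D (g * h)) =
        ((j : ℚ) + 1) • PowerSeries.coeff (j + 1) (expSeries D g * expSeries D h) := by
      have h2 := congrArg (PowerSeries.coeff j)
        ((PowerSeries.derivative B).leibniz (expSeries D g) (expSeries D h))
      rw [PowerSeries.coeff_derivative, derivative_expSeries, derivative_expSeries, smul_eq_mul,
        smul_eq_mul, map_add, ← ih, mul_comm (expSeries D h), ← ih] at h2
      rw [succ_mul_coeff_expSeries, D.leibniz, expSeries_add, map_add, smul_eq_mul, smul_eq_mul,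
        mul_comm h, ← h2, Algebra.smul_def, mul_comm]
      simp
    have h3 : (j : ℚ) + 1 ≠ 0 := by positivity
    have h4 := congrArg (fun b => ((j : ℚ) + 1)⁻¹ • b) h1
    simpa [smul_smul, h3] using h4

theorem iterate_algebraMap (D : Derivation R B B) (r : R) {j : ℕ} (hj : j ≠ 0) :
    (⇑D)^[j] (algebraMap R B r) = 0 := by
  obtain ⟨i, rfl⟩ := Nat.exists_eq_succ_of_ne_zero hj
  rw [Function.iterate_succ_apply, D.map_algebraMap, iterate_map_zero]

theorem expSeries_of_eq_zero (D : Derivation R B B) {g : B} (h : D g = 0) :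
    expSeries D g = PowerSeries.C g := by
  ext j
  rw [coeff_expSeries, PowerSeries.coeff_C]
  split_ifs with hj
  · subst hj; simp
  · obtain ⟨i, rfl⟩ := Nat.exists_eq_succ_of_ne_zero hj
    rw [Function.iterate_succ_apply, h, iterate_map_zero, smul_zero]

/-- Local nilpotency. -/
def IsLocNilp (D : Derivation R B B) : Prop := ∀ g, ∃ n, (⇑D)^[n] g = 0

theorem iterate_eq_zero_of_le (D : Derivation R B B) {g : B} {n m : ℕ} (h : (⇑D)^[n] g = 0)
    (hm : n ≤ m) : (⇑D)^[m] g = 0 := by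
  obtain ⟨i, rfl⟩ := Nat.exists_eq_add_of_le' hm
  rw [Function.iterate_add_apply, h, iterate_map_zero]

theorem exists_iterate_eq_zero_iff (D : Derivation R B B) (g : B) :
    (∃ n, (⇑D)^[n] g = 0) ↔ ∃ P : B[X], (P : PowerSeries B) = expSeries D g := by
  constructor
  · rintro ⟨n, hn⟩
    refine ⟨∑ j ∈ Finset.range n, C (((j.factorial : ℚ)⁻¹) • (⇑D)^[j] g) * X ^ j, ?_⟩
    ext j
    rw [Polynomial.coeff_coe, finsetSum_coeff, coeff_expSeries]
    simp only [coeff_C_mul_X_pow]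
    rw [Finset.sum_ite_eq]
    split_ifs with hj
    · rfl
    · rw [iterate_eq_zero_of_le D hn (by simpa using hj), smul_zero]
  · rintro ⟨P, hP⟩
    refine ⟨P.natDegree + 1, ?_⟩
    have h1 := congrArg (PowerSeries.coeff (P.natDegree + 1)) hP
    rw [Polynomial.coeff_coe, coeff_eq_zero_of_natDegree_lt (Nat.lt_succ_self _), coeff_expSeries] at h1
    have h2 := congrArg (fun b => ((P.natDegree + 1).factorial : ℚ) • b) h1
    have h3 : ((P.natDegree + 1).factorial : ℚ) ≠ 0 := by positivity
    simpa only [smul_smul, mul_inv_cancel₀ h3, one_smul, smul_zero] using h2.symm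

/-- The subalgebra of elements on which the derivation is nilpotent. -/
def nilSubalgebra (D : Derivation R B B) : Subalgebra R B where
  carrier := {g | ∃ n, (⇑D)^[n] g = 0}
  add_mem' := by
    intro g h hg hh
    rw [Set.mem_ofPred_eq, exists_iterate_eq_zero_iff] at *
    obtain ⟨P, hP⟩ := hg
    obtain ⟨Q, hQ⟩ := hh
    exact ⟨P + Q, by rw [Polynomial.coe_add, hP, hQ, expSeries_add]⟩
  mul_mem' := by
    intro g h hg hh
    rw [Set.mem_ofPred_eq, exists_iterate_eq_zero_iff] at *
    obtain ⟨P, hP⟩ := hg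
    obtain ⟨Q, hQ⟩ := hh
    exact ⟨P * Q, by rw [Polynomial.coe_mul, hP, hQ, expSeries_mul]⟩
  algebraMap_mem' := fun r => ⟨1, iterate_algebraMap D r one_ne_zero⟩

theorem mem_nilSubalgebra (D : Derivation R B B) (g : B) :
    g ∈ nilSubalgebra D ↔ ∃ n, (⇑D)^[n] g = 0 := Iff.rfl

theorem mem_nilSubalgebra_of_map_mem (D : Derivation R B B) {g : B} (h : D g ∈ nilSubalgebra D) :
    g ∈ nilSubalgebra D := by
  obtain ⟨n, hn⟩ := h
  exact ⟨n + 1, hn⟩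

/-- The exponential of a locally nilpotent derivation. -/
noncomputable def expHom (D : Derivation R B B) (hD : IsLocNilp D) : B →+* B[X] where
  toFun g := ((exists_iterate_eq_zero_iff D g).1 (hD g)).choose
  map_one' := Polynomial.coe_injective B <| by
    rw [((exists_iterate_eq_zero_iff D _).1 (hD _)).choose_spec, expSeries_of_eq_zero D D.map_one_eq_zero]
    simp
  map_zero' := Polynomial.coe_injective B <| by
    rw [((exists_iterate_eq_zero_iff D _).1 (hD _)).choose_spec, expSeries_of_eq_zero D (map_zero D)]
    simp
  map_mul' g h := Polynomial.coe_injective B <| by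
    rw [Polynomial.coe_mul, ((exists_iterate_eq_zero_iff D _).1 (hD _)).choose_spec,
      ((exists_iterate_eq_zero_iff D _).1 (hD _)).choose_spec,
      ((exists_iterate_eq_zero_iff D _).1 (hD _)).choose_spec, expSeries_mul]
  map_add' g h := Polynomial.coe_injective B <| by
    rw [Polynomial.coe_add, ((exists_iterate_eq_zero_iff D _).1 (hD _)).choose_spec,
      ((exists_iterate_eq_zero_iff D _).1 (hD _)).choose_spec,
      ((exists_iterate_eq_zero_iff D _).1 (hD _)).choose_spec, expSeries_add]

theorem coe_expHom (D : Derivation R B B) (hD : IsLocNilp D) (g : B) :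
    (expHom D hD g : PowerSeries B) = expSeries D g :=
  ((exists_iterate_eq_zero_iff D g).1 (hD g)).choose_spec

theorem coeff_expHom (D : Derivation R B B) (hD : IsLocNilp D) (g : B) (j : ℕ) :
    (expHom D hD g).coeff j = ((j.factorial : ℚ)⁻¹) • (⇑D)^[j] g := by
  rw [← Polynomial.coeff_coe, coe_expHom, coeff_expSeries]

theorem expHom_eq_sum (D : Derivation R B B) (hD : IsLocNilp D) {g : B} {n : ℕ}
    (h : (⇑D)^[n] g = 0) :
    expHom D hD g = ∑ j ∈ Finset.range n, C (((j.factorial : ℚ)⁻¹) • (⇑D)^[j] g) * X ^ j := by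
  ext j
  rw [coeff_expHom, finsetSum_coeff]
  simp only [coeff_C_mul_X_pow]
  rw [Finset.sum_ite_eq]
  split_ifs with hj
  · rfl
  · rw [iterate_eq_zero_of_le D h (by simpa using hj), smul_zero]

theorem expHom_of_eq_zero (D : Derivation R B B) (hD : IsLocNilp D) {g : B} (h : D g = 0) :
    expHom D hD g = C g := by
  refine Polynomial.coe_injective B ?_
  rw [coe_expHom, expSeries_of_eq_zero D h, Polynomial.coe_C]

theorem expHom_of_map_eq_zero (D : Derivation R B B) (hD : IsLocNilp D) {g : B} (h : D (D g) = 0) :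
    expHom D hD g = C g + C (D g) * X := by
  rw [expHom_eq_sum D hD (n := 2) h]
  simp [Finset.sum_range_succ]

theorem natCast_coe {K : Subalgebra R B} (n : ℕ) : ((n : K) : B) = n := map_natCast K.val n

theorem map_aeval_slice {K : Subalgebra R B} (D : Derivation R B B) (hK : ∀ g ∈ K, D g = 0)
    {s : B} (hs : D s = 1) (P : K[X]) : D (aeval s P) = aeval s (derivative P) := by
  induction P using Polynomial.induction_on' with
  | add p q hp hq => simp only [map_add, hp, hq]
  | monomial n a =>
    rw [derivative_monomial, aeval_monomial, aeval_monomial, D.leibniz, D.leibniz_pow, hs]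
    have : D (algebraMap K B a) = 0 := hK _ a.2
    rw [this, map_mul, map_natCast]
    simp only [smul_eq_mul, mul_one, mul_zero, add_zero, nsmul_eq_mul]
    ring

theorem eq_zero_of_add_one_mul (n : ℕ) (b : B) (h : ((n : B) + 1) * b = 0) : b = 0 := by
  have h2 := congrArg (fun b => ((n : ℚ) + 1)⁻¹ • b) (show ((n : ℚ) + 1) • b = 0 by
    rw [Algebra.smul_def, ← h]; simp)
  have h3 : (n : ℚ) + 1 ≠ 0 := by positivity
  simpa only [smul_smul, inv_mul_cancel₀ h3, one_smul, smul_zero] using h2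

theorem aeval_slice_injective {K : Subalgebra R B} (D : Derivation R B B) (hK : ∀ g ∈ K, D g = 0)
    {s : B} (hs : D s = 1) : Function.Injective (aeval (R := K) s) := by
  have main : ∀ n (P : K[X]), P.natDegree ≤ n → aeval s P = 0 → P = 0 := by
    intro n
    induction n with
    | zero =>
      intro P hP h
      rw [eq_C_of_natDegree_le_zero hP, aeval_C] at h
      have h1 : P.coeff 0 = 0 := Subtype.ext h
      rw [eq_C_of_natDegree_le_zero hP, h1, C_0]
    | succ n ih =>
      intro P hP h
      have h1 := ih (derivative P) ((natDegree_derivative_le P).trans (by omega))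
        (by rw [← map_aeval_slice D hK hs, h, map_zero])
      have h2 : P.natDegree ≤ 0 := by
        rw [natDegree_le_iff_coeff_eq_zero]
        intro i hi
        obtain ⟨j, rfl⟩ := Nat.exists_eq_succ_of_ne_zero hi.ne'
        have h3 := congrArg (fun Q : K[X] => ((Q.coeff j : K) : B)) h1
        simp only [coeff_derivative, coeff_zero, Subalgebra.coe_mul, Subalgebra.coe_zero,
          Subalgebra.coe_add, natCast_coe, Subalgebra.coe_one] at h3
        exact Subtype.ext (eq_zero_of_add_one_mul j _ (by rw [mul_comm]; exact h3))
      rw [eq_C_of_natDegree_le_zero h2, aeval_C] at h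
      have h1 : P.coeff 0 = 0 := Subtype.ext h
      rw [eq_C_of_natDegree_le_zero h2, h1, C_0]
  refine (injective_iff_map_eq_zero _).2 fun P h => main _ P le_rfl h

theorem aeval_slice_surjective {K : Subalgebra R B} (D : Derivation R B B) (hD : IsLocNilp D)
    (hK : ∀ g, g ∈ K ↔ D g = 0) {s : B} (hs : D s = 1) :
    Function.Surjective (aeval (R := K) s) := by
  have hKq : ∀ (q : ℚ) (b : B), b ∈ K → q • b ∈ K := by
    intro q b hb
    rw [hK] at *
    rw [map_rat_smul, hb, smul_zero]
  have hint : ∀ P : K[X], ∃ Q : K[X], derivative Q = P := by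
    intro P
    induction P using Polynomial.induction_on' with
    | add p q hp hq =>
      obtain ⟨P, rfl⟩ := hp
      obtain ⟨Q, rfl⟩ := hq
      exact ⟨P + Q, map_add _ _ _⟩
    | monomial n a =>
      refine ⟨monomial (n + 1) ⟨((n : ℚ) + 1)⁻¹ • (a : B), hKq _ _ a.2⟩, ?_⟩
      rw [derivative_monomial]
      congr 1
      refine Subtype.ext ?_
      have h3 : (n : ℚ) + 1 ≠ 0 := by positivity
      simp only [Subalgebra.coe_mul, natCast_coe]
      rw [Algebra.smul_def, mul_assoc, mul_comm (a : B), ← mul_assoc]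
      have h4 : ((n + 1 : ℕ) : B) = algebraMap ℚ B ((n : ℚ) + 1) := by simp
      rw [h4, ← map_mul, inv_mul_cancel₀ h3, map_one, one_mul]
  have main : ∀ n g, (⇑D)^[n] g = 0 → ∃ P : K[X], aeval s P = g := by
    intro n
    induction n with
    | zero => intro g hg; exact ⟨0, by rw [map_zero]; exact hg.symm⟩
    | succ n ih =>
      intro g hg
      obtain ⟨P, hP⟩ := ih (D g) hg
      obtain ⟨Q, rfl⟩ := hint P
      have h1 : D (g - aeval s Q) = 0 := by rw [map_sub, map_aeval_slice D (fun g hg => (hK g).1 hg) hs, hP, sub_self]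
      refine ⟨Q + C ⟨_, (hK _).2 h1⟩, ?_⟩
      rw [map_add, aeval_C]
      change aeval s Q + (g - aeval s Q) = g
      ring
  intro g
  obtain ⟨n, hn⟩ := hD g
  exact main n g hn
end
end Polynomial.GaProper

namespace Polynomial.GaProper
open Polynomial

theorem isNilpotent_sub_of_isUnit_derivative {A : Type*} [CommRing A] [Algebra ℚ A] {Q : A[X]}
    (hQ0 : Q.coeff 0 = 0) (hq : IsUnit (derivative Q)) :
    IsUnit (Q.coeff 1) ∧ IsNilpotent (Q - C (Q.coeff 1) * X) := by
  obtain ⟨h0, h1⟩ := isUnit_iff_coeff_isUnit_isNilpotent.1 hq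
  rw [coeff_derivative] at h0
  refine ⟨by simpa using h0, ?_⟩
  rw [Polynomial.isNilpotent_iff]
  intro i
  match i with
  | 0 => simp [hQ0]
  | 1 => simp
  | i + 2 =>
    have h2 := h1 (i + 1) (by omega)
    rw [coeff_derivative] at h2
    rw [coeff_sub, coeff_C_mul, coeff_X_of_ne_one (by omega), mul_zero, sub_zero]
    have h3 : Q.coeff (i + 2) = algebraMap ℚ A ((i : ℚ) + 2)⁻¹ * (Q.coeff (i + 1 + 1) * (((i + 1 : ℕ) : A) + 1)) := by
      have h4 : (((i + 1 : ℕ) : A) + 1) = algebraMap ℚ A ((i : ℚ) + 2) := by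
        simp only [map_add, map_natCast, map_ofNat, Nat.cast_add, Nat.cast_one]; ring
      have h5 : (i : ℚ) + 2 ≠ 0 := by positivity
      rw [h4, mul_left_comm, ← map_mul, inv_mul_cancel₀ h5, map_one, mul_one]
    rw [h3]
    exact (Commute.all _ _).isNilpotent_mul_left h2

theorem IsNilpotent.comp {A : Type*} [CommRing A] {P : A[X]} (h : IsNilpotent P) (x : A[X]) :
    IsNilpotent (P.comp x) :=
  h.map (compRingHom x)

/-- A polynomial with invertible derivative over a `ℚ`-algebra is invertible under composition. -/
theorem exists_comp_inverse {A : Type*} [CommRing A] [Algebra ℚ A] {Q : A[X]}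
    (hQ0 : Q.coeff 0 = 0) (hq : IsUnit (derivative Q)) :
    ∃ G : A[X], Q.comp G = X ∧ G.comp Q = X := by
  obtain ⟨h1, h2⟩ := isNilpotent_sub_of_isUnit_derivative hQ0 hq
  obtain ⟨c, hc⟩ := h1.exists_left_inv
  have hev : ∀ (F x : A[X]), aeval x ((Q.map C) - C F) = Q.comp x - F := by
    intro F x
    rw [map_sub, aeval_C, aeval_def, eval₂_map]
    rfl
  have hev' : ∀ (F x : A[X]), aeval x (derivative ((Q.map C) - C F)) = (derivative Q).comp x := by
    intro F x
    rw [derivative_sub, derivative_C, sub_zero, derivative_map, aeval_def, eval₂_map]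
    rfl
  have hun : ∀ x : A[X], IsUnit ((derivative Q).comp x) := fun x => hq.map (compRingHom x)
  have h3 : IsNilpotent (Q.comp (C c * X) - X) := by
    have := IsNilpotent.comp h2 (C c * X)
    rwa [sub_comp, mul_comp, C_comp, X_comp, ← mul_assoc, ← C_mul, mul_comm _ c, hc, C_1, one_mul] at this
  obtain ⟨G, ⟨hG1, hG2⟩, -⟩ := existsUnique_nilpotent_sub_and_aeval_eq_zero
    (P := Q.map C - C X) (x := C c * X) (by rw [hev]; exact h3) (by rw [hev']; exact hun _)
  rw [hev, sub_eq_zero] at hG2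
  refine ⟨G, hG2, ?_⟩
  obtain ⟨G', -, hG'⟩ := existsUnique_nilpotent_sub_and_aeval_eq_zero
    (P := Q.map C - C Q) (x := X) (by rw [hev, comp_X, sub_self]; exact IsNilpotent.zero)
    (by rw [hev']; exact hun _)
  have e1 := hG' X ⟨by rw [sub_self]; exact IsNilpotent.zero, by rw [hev, comp_X, sub_self]⟩
  have e2 := hG' (G.comp Q) ⟨?_, by rw [hev, ← comp_assoc, hG2, X_comp, sub_self]⟩
  · rw [e1, e2]
  · have h4 := IsNilpotent.comp hG1 Q
    rw [sub_comp, mul_comp, C_comp, X_comp] at h4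
    have h5 := (Commute.all (C c) _).isNilpotent_mul_left h2
    have h6 := (Commute.all _ _).isNilpotent_sub h4 h5
    have h7 : C c * C (Q.coeff 1) = 1 := by rw [← C_mul, hc, C_1]
    convert h6 using 1
    linear_combination (- X : A[X]) * h7

theorem exists_eq_C_mul_of_map_mk_eq_zero {S : Type*} [CommRing S] {p : S} {F : S[X]}
    (h : F.map (Ideal.Quotient.mk (Ideal.span {p})) = 0) : ∃ N, F = C p * N := by
  have : C p ∣ F := by
    rw [C_dvd_iff_dvd_coeff]
    intro i
    have := congrArg (fun P => P.coeff i) h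
    simpa [Ideal.Quotient.eq_zero_iff_mem, Ideal.mem_span_singleton] using this
  exact this

theorem exists_antiderivative {S : Type*} [CommRing S] [Algebra ℚ S] (q : S[X]) :
    ∃ Q : S[X], Q.coeff 0 = 0 ∧ derivative Q = q := by
  induction q using Polynomial.induction_on' with
  | add p q hp hq =>
    obtain ⟨P, h1, rfl⟩ := hp
    obtain ⟨Q, h2, rfl⟩ := hq
    exact ⟨P + Q, by rw [coeff_add, h1, h2, add_zero], map_add _ _ _⟩
  | monomial n a =>
    refine ⟨monomial (n + 1) (algebraMap ℚ S ((n : ℚ) + 1)⁻¹ * a), by simp [coeff_monomial], ?_⟩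
    rw [derivative_monomial]
    congr 1
    have h4 : ((n + 1 : ℕ) : S) = algebraMap ℚ S ((n : ℚ) + 1) := by simp
    have h3 : (n : ℚ) + 1 ≠ 0 := by positivity
    rw [h4, mul_right_comm, ← map_mul, inv_mul_cancel₀ h3, map_one, one_mul]

theorem map_eval₂_of_map_eq_zero {R S B : Type*} [CommRing R] [CommRing S] [CommRing B] [Algebra R B]
    (D : Derivation R B B) (φ : S →+* B) (hφ : ∀ s, D (φ s) = 0) (b : B) (P : S[X]) :
    D (P.eval₂ φ b) = (derivative P).eval₂ φ b * D b := by
  induction P using Polynomial.induction_on' with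
  | add p q hp hq => simp only [map_add, eval₂_add, hp, hq, add_mul]
  | monomial n a =>
    rw [derivative_monomial, eval₂_monomial, eval₂_monomial, D.leibniz, D.leibniz_pow, hφ, map_mul,
      map_natCast]
    simp only [smul_eq_mul, mul_zero, add_zero, nsmul_eq_mul]
    ring

/-- Rank two: a triangular derivation without common zeros has a slice. -/
theorem exists_slice_of_isCoprime {R S B : Type*} [CommRing R] [CommRing S] [IsDomain S] [Algebra ℚ S]
    [CommRing B] [IsDomain B] [Algebra R B] (D : Derivation R B B) (φ : S →+* B)
    (hφ : Function.Injective φ) (hDφ : ∀ s, D (φ s) = 0) {z u : B} {p : S} {q : S[X]}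
    (hz : D z = φ p) (hu : D u = q.eval₂ φ z) (hpq : IsCoprime (C p) q)
    (hgen : ∀ T : Subring B, (∀ s, φ s ∈ T) → z ∈ T → u ∈ T → T = ⊤) :
    ∃ f s, D f = 0 ∧ D s = 1 ∧
      (∀ T : Subring B, (∀ s, φ s ∈ T) → f ∈ T → s ∈ T → T = ⊤) ∧
      ((p = 0 ∧ f = z) ∨ (p ≠ 0 ∧ ∃ Q : S[X], Q.coeff 0 = 0 ∧ f = φ p * u - Q.eval₂ φ z)) := by
  by_cases hp : p = 0
  · subst hp
    rw [C_0, isCoprime_zero_left] at hpq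
    obtain ⟨q₀, hq₀, rfl⟩ := Polynomial.isUnit_iff.1 hpq
    obtain ⟨c, hc⟩ := hq₀.exists_left_inv
    rw [eval₂_C] at hu
    refine ⟨z, φ c * u, by rw [hz, map_zero], ?_, ?_, Or.inl ⟨rfl, rfl⟩⟩
    · rw [D.leibniz, hu, hDφ, smul_zero, add_zero, smul_eq_mul, ← map_mul, hc, map_one]
    · intro T hT hz hs
      refine hgen T hT hz ?_
      have : u = φ q₀ * (φ c * u) := by rw [← mul_assoc, ← map_mul, mul_comm, mul_comm q₀, hc, map_one, mul_one]
      rw [this]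
      exact mul_mem (hT _) hs
  · obtain ⟨Q, hQ0, hQ⟩ := exists_antiderivative q
    let ν := Ideal.Quotient.mk (Ideal.span {p})
    have hunit : IsUnit (derivative (Q.map ν)) := by
      obtain ⟨α, β, h⟩ := hpq
      rw [derivative_map, hQ]
      refine IsUnit.of_mul_eq_one (β.map ν) ?_
      have h1 := congrArg (Polynomial.map ν) h
      have h2 : ν p = 0 := Ideal.Quotient.eq_zero_iff_mem.2 (Ideal.mem_span_singleton_self p)
      rw [Polynomial.map_add, Polynomial.map_mul, Polynomial.map_mul, map_C, h2, C_0, mul_zero, zero_add,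
        Polynomial.map_one] at h1
      rw [mul_comm, h1]
    obtain ⟨G', hG1, hG2⟩ := exists_comp_inverse (Q := Q.map ν) (by rw [coeff_map, hQ0, map_zero]) hunit
    obtain ⟨G, rfl⟩ := Polynomial.map_surjective ν Ideal.Quotient.mk_surjective G'
    obtain ⟨H₁, hH₁⟩ := exists_eq_C_mul_of_map_mk_eq_zero (p := p) (F := Q.comp G - X) (by
      rw [Polynomial.map_sub, map_comp, map_X, hG1, sub_self])
    obtain ⟨H₂, hH₂⟩ := exists_eq_C_mul_of_map_mk_eq_zero (p := p) (F := G.comp Q - X) (by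
      rw [Polynomial.map_sub, map_comp, map_X, hG2, sub_self])
    have hφp : φ p ≠ 0 := fun h => hp (hφ (h.trans (map_zero φ).symm))
    set f := φ p * u - Q.eval₂ φ z with hf
    have hDf : D f = 0 := by
      rw [hf, map_sub, D.leibniz, hDφ, map_eval₂_of_map_eq_zero D φ hDφ, hz, hu, hQ]
      simp only [smul_eq_mul]; ring
    have hcomp : ∀ (P Q : S[X]) (b : B), (P.comp Q).eval₂ φ b = P.eval₂ φ (Q.eval₂ φ b) :=
      fun P Q b => eval₂_comp φ
    have hQz : Q.eval₂ φ z = -f + φ p * u := by rw [hf]; ring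
    obtain ⟨M, hM⟩ : φ p * u ∣ G.eval₂ φ (-f + φ p * u) - G.eval₂ φ (-f) := by
      have := sub_dvd_eval_sub (-f + φ p * u) (-f) (G.map φ)
      rwa [eval_map, eval_map, add_sub_cancel_left] at this
    have e2 := congrArg (Polynomial.eval₂ φ z) hH₂
    rw [eval₂_sub, hcomp, hQz, eval₂_X, eval₂_mul, eval₂_C] at e2
    have hzs : z = G.eval₂ φ (-f) + φ p * (u * M - H₂.eval₂ φ z) := by linear_combination hM - e2
    set s := u * M - H₂.eval₂ φ z with hs
    refine ⟨f, s, hDf, ?_, ?_, Or.inr ⟨hp, Q, hQ0, rfl⟩⟩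
    · have h1 := congrArg D hzs
      rw [map_add, map_eval₂_of_map_eq_zero D φ hDφ, map_neg, hDf, neg_zero, mul_zero, zero_add, D.leibniz,
        hDφ, smul_zero, add_zero, hz, smul_eq_mul] at h1
      exact (mul_left_cancel₀ hφp ((mul_one _).trans h1)).symm
    · intro T hT hfT hsT
      have hpoly : ∀ (P : S[X]) b, b ∈ T → P.eval₂ φ b ∈ T := by
        intro P b hb
        rw [eval₂_eq_sum_range]
        exact sum_mem fun i _ => mul_mem (hT _) (pow_mem hb i)
      have hzT : z ∈ T := by
        rw [hzs]; exact add_mem (hpoly _ _ (neg_mem hfT)) (mul_mem (hT _) hsT)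
      refine hgen T hT hzT ?_
      -- `u` is a polynomial in `f` and `s`
      let φT : S →+* T := φ.codRestrict T hT
      let F : T := ⟨f, hfT⟩
      let s₁ : T := ⟨s, hsT⟩
      have hval : ∀ (P : S[X]) (b : T), ((P.eval₂ φT b : T) : B) = P.eval₂ φ (b : B) := by
        intro P b
        exact hom_eval₂ P φT T.subtype b
      obtain ⟨N, hN⟩ : φT p * s₁ ∣ Q.eval₂ φT (G.eval₂ φT (-F) + φT p * s₁) -
          Q.eval₂ φT (G.eval₂ φT (-F)) := by
        have := sub_dvd_eval_sub (G.eval₂ φT (-F) + φT p * s₁) (G.eval₂ φT (-F)) (Q.map φT)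
        rwa [eval_map, eval_map, add_sub_cancel_left] at this
      have hN' := congrArg (fun b : T => (b : B)) hN
      simp only [AddSubgroupClass.coe_sub, hval, Subring.coe_add, Subring.coe_mul, Subring.coe_neg] at hN'
      change Polynomial.eval₂ φ (G.eval₂ φ (-f) + φ p * s) Q - Q.eval₂ φ (G.eval₂ φ (-f)) =
        φ p * s * (N : B) at hN'
      rw [← hzs, hQz] at hN'
      have e1 := congrArg (Polynomial.eval₂ φ (-f)) hH₁
      rw [eval₂_sub, hcomp, eval₂_X, eval₂_mul, eval₂_C] at e1
      have : u = s * N + H₁.eval₂ φ (-f) := by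
        refine mul_left_cancel₀ hφp ?_
        linear_combination hN' + e1
      rw [this]
      exact add_mem (mul_mem hsT N.2) (hpoly _ _ (neg_mem hfT))

end Polynomial.GaProper

namespace Polynomial.GaProper
open Polynomial

section
variable {K : Type*} [CommRing K]

/-- Polynomials in the first variable. -/
noncomputable def yHom (K : Type*) [CommRing K] : K[X] →+* MvPolynomial (Fin 3) K :=
  eval₂RingHom MvPolynomial.C (MvPolynomial.X 0)

/-- Polynomials in the first variable and a second element. -/
noncomputable def pairHom (f : MvPolynomial (Fin 3) K) : K[X][X] →+* MvPolynomial (Fin 3) K :=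
  eval₂RingHom (yHom K) f

theorem yHom_C (c : K) : yHom K (C c) = MvPolynomial.C c := by simp [yHom]
theorem yHom_X : yHom K X = MvPolynomial.X 0 := by simp [yHom]
theorem pairHom_C (f : MvPolynomial (Fin 3) K) (p : K[X]) : pairHom f (C p) = yHom K p := by
  simp [pairHom]
theorem pairHom_X (f : MvPolynomial (Fin 3) K) : pairHom f X = f := by
  simp [pairHom]
theorem pairHom_apply (f : MvPolynomial (Fin 3) K) (V : K[X][X]) :
    pairHom f V = V.eval₂ (yHom K) f := rfl

/-- Triangular derivations of a polynomial ring in three variables. -/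
structure Triangular (D : Derivation K (MvPolynomial (Fin 3) K) (MvPolynomial (Fin 3) K))
    (a : K) (p : K[X]) (q : K[X][X]) : Prop where
  map_y : D (MvPolynomial.X 0) = MvPolynomial.C a
  map_z : D (MvPolynomial.X 1) = yHom K p
  map_u : D (MvPolynomial.X 2) = pairHom (MvPolynomial.X 1) q

theorem derivation_C (D : Derivation K (MvPolynomial (Fin 3) K) (MvPolynomial (Fin 3) K)) (c : K) :
    D (MvPolynomial.C c) = 0 := D.map_algebraMap c

theorem derivation_yHom (D : Derivation K (MvPolynomial (Fin 3) K) (MvPolynomial (Fin 3) K)) (P : K[X]) :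
    D (yHom K P) = yHom K (derivative P) * D (MvPolynomial.X 0) :=
  map_eval₂_of_map_eq_zero D MvPolynomial.C (derivation_C D) _ _

/-- Derivation of a polynomial in two elements. -/
theorem derivation_pairHom (D : Derivation K (MvPolynomial (Fin 3) K) (MvPolynomial (Fin 3) K))
    (f : MvPolynomial (Fin 3) K) (V : K[X][X]) :
    ∃ g, D (pairHom f V) = g * D (MvPolynomial.X 0) + pairHom f (derivative V) * D f := by
  induction V using Polynomial.induction_on' with
  | add p q hp hq =>
    obtain ⟨g, hg⟩ := hp
    obtain ⟨h, hh⟩ := hq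
    exact ⟨g + h, by rw [map_add, map_add, hg, hh, derivative_add, map_add]; ring⟩
  | monomial n P =>
    refine ⟨yHom K (derivative P) * f ^ n, ?_⟩
    rw [derivative_monomial, pairHom_apply, pairHom_apply, eval₂_monomial, eval₂_monomial, D.leibniz,
      D.leibniz_pow, derivation_yHom, map_mul, map_natCast]
    simp only [smul_eq_mul, nsmul_eq_mul]
    ring

/-- Test curves. -/
noncomputable def curve (K : Type*) [CommRing K] (b : Bool) (N : ℕ) : MvPolynomial (Fin 3) K →ₐ[K] K[X] :=
  MvPolynomial.aeval (if b then ![X, 0, X ^ N] else ![X, X ^ N, 0])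

theorem curve_yHom (b : Bool) (N : ℕ) (P : K[X]) : curve K b N (yHom K P) = P := by
  have : ((curve K b N : MvPolynomial (Fin 3) K →+* K[X]).comp (yHom K)) = RingHom.id _ := by
    refine Polynomial.ringHom_ext (fun c => ?_) ?_
    · simp [yHom, curve, Polynomial.algebraMap_eq]
    · cases b <;> simp [yHom, curve]
  exact congrArg (fun φ : K[X] →+* K[X] => φ P) this

theorem yHom_injective : Function.Injective (yHom K) :=
  Function.LeftInverse.injective (curve_yHom true 0)

theorem curve_pairHom (b : Bool) (N : ℕ) (f : MvPolynomial (Fin 3) K) (V : K[X][X]) :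
    curve K b N (pairHom f V) = V.eval (curve K b N f) := by
  have : ((curve K b N : MvPolynomial (Fin 3) K →+* K[X]).comp (pairHom f)) =
      evalRingHom (curve K b N f) := by
    refine Polynomial.ringHom_ext (fun c => ?_) ?_
    · simp [pairHom, curve_yHom]
    · simp [pairHom]
  exact congrArg (fun φ : K[X][X] →+* K[X] => φ V) this

theorem curve_map {L : Type*} [CommRing L] (σ : K →+* L) (b : Bool) (N : ℕ)
    (g : MvPolynomial (Fin 3) K) : curve L b N (MvPolynomial.map σ g) = (curve K b N g).map σ := by
  have : ((curve L b N : MvPolynomial (Fin 3) L →+* L[X]).comp (MvPolynomial.map σ)) =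
      (mapRingHom σ).comp (curve K b N : MvPolynomial (Fin 3) K →+* K[X]) := by
    refine MvPolynomial.ringHom_ext (fun c => ?_) fun i => ?_
    · simp [curve, Polynomial.algebraMap_eq]
    · cases b <;> fin_cases i <;> simp [curve]
  exact congrArg (fun φ : MvPolynomial (Fin 3) K →+* L[X] => φ g) this

/-- Degree of a bivariate polynomial along a curve of large degree. -/
theorem degree_eval_of_large [IsDomain K] {V : K[X][X]} (hV : V ≠ 0) {F : K[X]}
    (hF : ∀ i, (V.coeff i).natDegree < F.natDegree) :
    (V.eval F).degree = (V.leadingCoeff.natDegree + F.natDegree * V.natDegree : ℕ) := by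
  have hF0 : F ≠ 0 := by rintro rfl; simpa using hF 0
  have hlc : V.leadingCoeff ≠ 0 := leadingCoeff_ne_zero.2 hV
  rw [eval_eq_sum_range, Finset.sum_range_succ, degree_add_eq_right_of_degree_lt]
  · rw [coeff_natDegree, degree_mul, degree_pow, degree_eq_natDegree hlc, degree_eq_natDegree hF0]
    push_cast
    rw [nsmul_eq_mul, mul_comm (F.natDegree : WithBot ℕ)]
  · rw [coeff_natDegree, degree_mul, degree_pow, degree_eq_natDegree hlc, degree_eq_natDegree hF0]
    refine lt_of_lt_of_le (b := ((F.natDegree * V.natDegree : ℕ) : WithBot ℕ)) ?_ ?_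
    · refine (degree_sum_le _ _).trans_lt ?_
      rw [Finset.sup_lt_iff (WithBot.bot_lt_coe _)]
      intro i hi
      rw [Finset.mem_range] at hi
      refine degree_le_natDegree.trans_lt (Nat.cast_lt.2 ?_)
      calc (V.coeff i * F ^ i).natDegree ≤ (V.coeff i).natDegree + i * F.natDegree := by
            refine natDegree_mul_le.trans ?_
            rw [natDegree_pow]
        _ < F.natDegree + i * F.natDegree := by have := hF i; omega
        _ = F.natDegree * (i + 1) := by ring
        _ ≤ F.natDegree * V.natDegree := Nat.mul_le_mul_left _ hi
    · rw [nsmul_eq_mul, ← Nat.cast_mul, mul_comm V.natDegree, ← Nat.cast_add]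
      exact_mod_cast Nat.le_add_left _ _

end

section
variable {K : Type*} [CommRing K] [Algebra ℚ K]
  {D : Derivation K (MvPolynomial (Fin 3) K) (MvPolynomial (Fin 3) K)} {a : K} {p : K[X]} {q : K[X][X]}

theorem Triangular.yHom_mem (h : Triangular D a p q) (P : K[X]) : yHom K P ∈ nilSubalgebra D := by
  have h0 : MvPolynomial.X 0 ∈ nilSubalgebra D :=
    mem_nilSubalgebra_of_map_mem D (by rw [h.map_y]; exact (nilSubalgebra D).algebraMap_mem a)
  rw [yHom, coe_eval₂RingHom, eval₂_eq_sum_range]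
  exact sum_mem fun i _ => mul_mem ((nilSubalgebra D).algebraMap_mem _) (pow_mem h0 i)

theorem Triangular.pairHom_mem (h : Triangular D a p q) (P : K[X][X]) :
    pairHom (MvPolynomial.X 1) P ∈ nilSubalgebra D := by
  have h1 : MvPolynomial.X 1 ∈ nilSubalgebra D :=
    mem_nilSubalgebra_of_map_mem D (by rw [h.map_z]; exact h.yHom_mem p)
  rw [pairHom_apply, eval₂_eq_sum_range]
  exact sum_mem fun i _ => mul_mem (h.yHom_mem _) (pow_mem h1 i)

theorem Triangular.isLocNilp (h : Triangular D a p q) : IsLocNilp D := by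
  intro g
  rw [← mem_nilSubalgebra]
  have h2 : MvPolynomial.X 2 ∈ nilSubalgebra D :=
    mem_nilSubalgebra_of_map_mem D (by rw [h.map_u]; exact h.pairHom_mem q)
  have h1 : MvPolynomial.X 1 ∈ nilSubalgebra D :=
    mem_nilSubalgebra_of_map_mem D (by rw [h.map_z]; exact h.yHom_mem p)
  have h0 : MvPolynomial.X 0 ∈ nilSubalgebra D :=
    mem_nilSubalgebra_of_map_mem D (by rw [h.map_y]; exact (nilSubalgebra D).algebraMap_mem a)
  induction g using MvPolynomial.induction_on with
  | C c => exact (nilSubalgebra D).algebraMap_mem c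
  | add f g hf hg => exact add_mem hf hg
  | mul_X f i hf =>
    refine mul_mem hf ?_
    fin_cases i
    exacts [h0, h1, h2]

/-- The ideal of the fixed locus. -/
noncomputable def fixedIdeal (a : K) (p : K[X]) (q : K[X][X]) : Ideal (MvPolynomial (Fin 3) K) :=
  Ideal.span {MvPolynomial.C a, yHom K p, pairHom (MvPolynomial.X 1) q}

theorem mem_fixedIdeal (g : MvPolynomial (Fin 3) K) : g ∈ fixedIdeal a p q ↔ ∃ x y z,
    g = x * MvPolynomial.C a + y * yHom K p + z * pairHom (MvPolynomial.X 1) q := by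
  simp only [fixedIdeal, Ideal.mem_span_insert, Ideal.mem_span_singleton']
  constructor
  · rintro ⟨x, _, ⟨y, _, ⟨z, rfl⟩, rfl⟩, rfl⟩
    exact ⟨x, y, z, by ring⟩
  · rintro ⟨x, y, z, rfl⟩
    exact ⟨x, _, ⟨y, _, ⟨z, rfl⟩, rfl⟩, by ring⟩

theorem Triangular.map_mem_fixedIdeal (h : Triangular D a p q) (g : MvPolynomial (Fin 3) K) :
    D g ∈ fixedIdeal a p q := by
  induction g using MvPolynomial.induction_on with
  | C c => rw [derivation_C]; exact zero_mem _
  | add f g hf hg => rw [map_add]; exact add_mem hf hg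
  | mul_X f i hf =>
    rw [D.leibniz]
    refine add_mem (Ideal.mul_mem_left _ _ ?_) (Ideal.mul_mem_left _ _ hf)
    fin_cases i
    · change D (MvPolynomial.X 0) ∈ _
      rw [h.map_y]; exact Ideal.subset_span (by simp)
    · change D (MvPolynomial.X 1) ∈ _
      rw [h.map_z]; exact Ideal.subset_span (by simp)
    · change D (MvPolynomial.X 2) ∈ _
      rw [h.map_u]; exact Ideal.subset_span (by simp)

/-- Properness of the action generated by a locally nilpotent derivation. -/
def Proper (D : Derivation K (MvPolynomial (Fin 3) K) (MvPolynomial (Fin 3) K)) (hD : IsLocNilp D) : Prop :=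
  ∃ (m : ℕ) (f g : Fin m → MvPolynomial (Fin 3) K), ∑ i, C (f i) * expHom D hD (g i) = X

theorem Triangular.one_mem_fixedIdeal (h : Triangular D a p q) {hD : IsLocNilp D} (hP : Proper D hD) :
    1 ∈ fixedIdeal a p q := by
  obtain ⟨m, f, g, hfg⟩ := hP
  have h1 := congrArg (fun P => P.coeff 1) hfg
  simp only [finsetSum_coeff, coeff_C_mul, coeff_expHom, coeff_X_one] at h1
  rw [← h1]
  refine sum_mem fun i _ => Ideal.mul_mem_left _ _ ?_
  simpa using h.map_mem_fixedIdeal (g i)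

theorem isCoprime_of_one_mem_fixedIdeal (h1 : 1 ∈ fixedIdeal (0 : K) p q) : IsCoprime (C p) q := by
  obtain ⟨x, y, z, h⟩ := (mem_fixedIdeal _).1 h1
  let θ : MvPolynomial (Fin 3) K →+* K[X][X] :=
    MvPolynomial.eval₂Hom (C.comp C) ![C X, X, 0]
  have hy : θ.comp (yHom K) = C := by
    refine Polynomial.ringHom_ext (fun c => ?_) ?_ <;> simp [θ, yHom]
  have hz : θ.comp (pairHom (MvPolynomial.X 1)) = RingHom.id _ := by
    refine Polynomial.ringHom_ext (fun c => ?_) ?_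
    · rw [RingHom.comp_apply, pairHom_C, ← RingHom.comp_apply, hy]; rfl
    · rw [RingHom.comp_apply, pairHom_X]; simp [θ]
  have h2 := congrArg θ h
  rw [map_one, map_add, map_add, map_mul, map_mul, map_mul, map_zero, map_zero, mul_zero, zero_add,
    ← RingHom.comp_apply θ, hy, ← RingHom.comp_apply θ, hz] at h2
  exact ⟨θ y, θ z, h2.symm⟩

/-- The rank two case over a domain. -/
theorem Triangular.exists_slice [IsDomain K] (h : Triangular D 0 p q) (h1 : 1 ∈ fixedIdeal (0 : K) p q) :
    ∃ f s, D f = 0 ∧ D s = 1 ∧ (∀ g, D g = 0 → ∃ V, g = pairHom f V) ∧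
      (MvPolynomial.pderiv 1 f ≠ 0 ∨ MvPolynomial.pderiv 2 f ≠ 0) ∧
      ∃ b e, ∀ N, (curve K b N f).natDegree = N + e := by
  have hDφ : ∀ P, D (yHom K P) = 0 := fun P => by
    rw [derivation_yHom, h.map_y, map_zero, mul_zero]
  obtain ⟨f, s, hf, hs, hgen, hcase⟩ := exists_slice_of_isCoprime D (yHom K) yHom_injective hDφ
    (z := MvPolynomial.X 1) (u := MvPolynomial.X 2) (p := p) (q := q) h.map_z h.map_u (isCoprime_of_one_mem_fixedIdeal h1) (by
      intro T hT hz hu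
      rw [eq_top_iff]
      rintro g -
      induction g using MvPolynomial.induction_on with
      | C c => rw [← yHom_C]; exact hT _
      | add f g hf hg => exact add_mem hf hg
      | mul_X f i hf =>
        refine mul_mem hf ?_
        fin_cases i
        · have := hT X; rwa [yHom_X] at this
        · exact hz
        · exact hu)
  refine ⟨f, s, hf, hs, ?_, ?_, ?_⟩
  · let A : Subalgebra K (MvPolynomial (Fin 3) K) :=
      { (pairHom f).range with
        algebraMap_mem' := fun c => ⟨C (C c), by rw [pairHom_C, yHom_C]; rfl⟩ }
    have hDA : ∀ g ∈ A, D g = 0 := by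
      rintro _ ⟨V, rfl⟩
      obtain ⟨g, hg⟩ := derivation_pairHom D f V
      rw [hg, h.map_y, hf, map_zero, mul_zero, mul_zero, add_zero]
    have hT := hgen (aeval (R := A) s).range.toSubring ?_ ?_ ?_
    · intro g hg
      have hgT : g ∈ (aeval (R := A) s).range.toSubring := hT ▸ Subring.mem_top g
      obtain ⟨P, rfl⟩ := hgT
      change D (aeval s P) = 0 at hg
      rw [map_aeval_slice D hDA hs, map_eq_zero_iff _ (aeval_slice_injective D hDA hs)] at hg
      have : CharZero (MvPolynomial (Fin 3) K) := algebraRat.charZero _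
      have : CharZero A := ⟨fun m n hmn => by
        have h2 := congrArg Subtype.val hmn
        rw [natCast_coe, natCast_coe] at h2
        exact_mod_cast h2⟩
      have h2 := derivative_eq_zero.1 hg
      rw [eq_C_of_natDegree_eq_zero h2]
      obtain ⟨V, hV⟩ := (P.coeff 0).2
      exact ⟨V, (aeval_C s _).trans hV.symm⟩
    · intro P
      exact ⟨C ⟨_, ⟨C P, pairHom_C f P⟩⟩, aeval_C s _⟩
    · exact ⟨C ⟨_, ⟨X, pairHom_X f⟩⟩, aeval_C s _⟩
    · exact ⟨X, aeval_X s⟩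
  · rcases hcase with ⟨-, rfl⟩ | ⟨hp, Q, -, rfl⟩
    · left; rw [MvPolynomial.pderiv_X_self]; exact one_ne_zero
    · right
      have h2 : ∀ P, MvPolynomial.pderiv 2 (yHom K P) = 0 := fun P => by
        rw [derivation_yHom, MvPolynomial.pderiv_X_of_ne (by decide), mul_zero]
      rw [map_sub, Derivation.leibniz, h2, map_eval₂_of_map_eq_zero _ _ h2,
        MvPolynomial.pderiv_X_self, MvPolynomial.pderiv_X_of_ne (by decide), mul_zero, sub_zero, smul_zero,
        add_zero, smul_eq_mul, mul_one]
      exact fun h3 => hp (yHom_injective (h3.trans (map_zero _).symm))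
  · rcases hcase with ⟨-, rfl⟩ | ⟨hp, Q, hQ, rfl⟩
    · exact ⟨false, 0, fun N => by simp [curve]⟩
    · refine ⟨true, p.natDegree, fun N => ?_⟩
      have h2 : curve K true N (Q.eval₂ (yHom K) (MvPolynomial.X 1)) = 0 := by
        rw [← pairHom_apply, curve_pairHom]
        simp [curve, ← coeff_zero_eq_eval_zero, hQ]
      have h3 : curve K true N (MvPolynomial.X 2) = X ^ N := by simp [curve]
      rw [map_sub, h2, sub_zero, map_mul, curve_yHom, h3, natDegree_mul hp (pow_ne_zero _ X_ne_zero),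
        natDegree_X_pow, add_comm]

end
end Polynomial.GaProper

namespace Polynomial.GaProper
open Polynomial

section
variable {R B : Type*} [CommRing R] [IsDomain R] [CommRing B] [Algebra R B]

/-- Elements with a nonzero multiple in a given subalgebra. -/
def sat (T : Subalgebra R B) : Subalgebra R B where
  carrier := {g | ∃ r : R, r ≠ 0 ∧ r • g ∈ T}
  add_mem' := by
    rintro g h ⟨r, hr, hg⟩ ⟨s, hs, hh⟩
    refine ⟨r * s, mul_ne_zero hr hs, ?_⟩
    rw [smul_add, mul_comm r, mul_smul, mul_comm s, mul_smul]
    exact add_mem (T.smul_mem hg _) (T.smul_mem hh _)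
  mul_mem' := by
    rintro g h ⟨r, hr, hg⟩ ⟨s, hs, hh⟩
    refine ⟨r * s, mul_ne_zero hr hs, ?_⟩
    rw [← smul_mul_smul_comm]
    exact mul_mem hg hh
  algebraMap_mem' := fun r => ⟨1, one_ne_zero, T.smul_mem (T.algebraMap_mem r) _⟩

theorem mem_sat {T : Subalgebra R B} {g : B} : g ∈ sat T ↔ ∃ r : R, r ≠ 0 ∧ r • g ∈ T := Iff.rfl

theorem le_sat (T : Subalgebra R B) : T ≤ sat T := fun g hg => ⟨1, one_ne_zero, by rwa [one_smul]⟩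

theorem sat_le_sat {S T : Subalgebra R B} (h : S ≤ sat T) : sat S ≤ sat T := by
  rintro g ⟨r, hr, hg⟩
  obtain ⟨s, hs, hh⟩ := h hg
  exact ⟨s * r, mul_ne_zero hs hr, by rwa [mul_smul]⟩

theorem mem_sat_of_smul_mem {T : Subalgebra R B} {g : B} {r : R} (hr : r ≠ 0) (h : r • g ∈ sat T) :
    g ∈ sat T := by
  obtain ⟨s, hs, hh⟩ := h
  exact ⟨s * r, mul_ne_zero hs hr, by rwa [mul_smul]⟩

end

section
variable {R B : Type*} [CommRing R] [CommRing B] [Algebra R B]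

theorem derivation_aeval_pair (d : Derivation R B B) (v w : B) (P : MvPolynomial (Fin 2) R) :
    d (MvPolynomial.aeval ![v, w] P) = MvPolynomial.aeval ![v, w] (MvPolynomial.pderiv 0 P) * d v +
      MvPolynomial.aeval ![v, w] (MvPolynomial.pderiv 1 P) * d w := by
  induction P using MvPolynomial.induction_on with
  | C c => simp
  | add f g hf hg => simp only [map_add, hf, hg]; ring
  | mul_X f i hf =>
    simp only [map_mul, Derivation.leibniz, hf, MvPolynomial.aeval_X, smul_eq_mul, map_add]
    fin_cases i
    · simp [MvPolynomial.pderiv_X]; ring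
    · simp [MvPolynomial.pderiv_X]; ring

theorem MvPolynomial_eq_C_of_pderiv_eq_zero {σ : Type*} [IsDomain R] [CharZero R] {P : MvPolynomial σ R}
    (h : ∀ i, MvPolynomial.pderiv i P = 0) : P = MvPolynomial.C (P.coeff 0) := by
  classical
  ext m
  rw [MvPolynomial.coeff_C]
  split_ifs with hm
  · rw [hm]
  · obtain ⟨i, hi⟩ : ∃ i, m i ≠ 0 := by
      by_contra! h0
      exact hm (Finsupp.ext fun i => (h0 i).symm)
    have h1 := congrArg (MvPolynomial.coeff (m - Finsupp.single i 1)) (h i)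
    rw [MvPolynomial.coeff_pderiv, MvPolynomial.coeff_zero] at h1
    have h2 : m - Finsupp.single i 1 + Finsupp.single i 1 = m :=
      tsub_add_cancel_of_le (by
        rw [Finsupp.single_le_iff]; omega)
    rw [h2] at h1
    exact (mul_eq_zero.1 h1).resolve_right (Nat.cast_add_one_ne_zero _)

/-- The Jacobian criterion for two elements. -/
theorem aeval_pair_injective [IsDomain R] [CharZero R] [IsDomain B] [FaithfulSMul R B]
    (d e : Derivation R B B) {v w : B} (h : d v * e w - e v * d w ≠ 0) :
    Function.Injective (MvPolynomial.aeval (R := R) ![v, w]) := by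
  have main : ∀ n (P : MvPolynomial (Fin 2) R), P.totalDegree ≤ n →
      MvPolynomial.aeval ![v, w] P = 0 → P = 0 := by
    intro n
    induction n with
    | zero =>
      intro P hP h0
      rw [MvPolynomial.totalDegree_eq_zero_iff_eq_C.1 (Nat.le_zero.1 hP)] at h0 ⊢
      rw [MvPolynomial.aeval_C, map_eq_zero_iff _ (FaithfulSMul.algebraMap_injective R B)] at h0
      rw [h0, map_zero]
    | succ n ih =>
      intro P hP h0
      have hd := derivation_aeval_pair d v w P
      have he := derivation_aeval_pair e v w P
      rw [h0, map_zero] at hd he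
      have h1 : MvPolynomial.aeval ![v, w] (MvPolynomial.pderiv 0 P) * (d v * e w - e v * d w) = 0 := by
        linear_combination -(e w) * hd + d w * he
      have h2 : MvPolynomial.aeval ![v, w] (MvPolynomial.pderiv 1 P) * (d v * e w - e v * d w) = 0 := by
        linear_combination (e v) * hd - d v * he
      have hdeg : ∀ i, (MvPolynomial.pderiv i P).totalDegree ≤ n := by
        intro i
        rw [MvPolynomial.totalDegree, Finset.sup_le_iff]
        intro m hm
        rw [MvPolynomial.mem_support_iff, MvPolynomial.coeff_pderiv] at hm
        have h1 := (MvPolynomial.le_totalDegree (MvPolynomial.mem_support_iff.2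
          (left_ne_zero_of_mul hm))).trans hP
        rw [Finsupp.sum_add_index' (by simp) (by simp), Finsupp.sum_single_index rfl] at h1
        omega
      have h3 := MvPolynomial_eq_C_of_pderiv_eq_zero (P := P) fun i => by
        refine ih _ (hdeg i) ?_
        fin_cases i
        · exact (mul_eq_zero.1 h1).resolve_right h
        · exact (mul_eq_zero.1 h2).resolve_right h
      rw [h3, MvPolynomial.aeval_C, map_eq_zero_iff _ (FaithfulSMul.algebraMap_injective R B)] at h0
      rw [h3, h0, map_zero]
  exact (injective_iff_map_eq_zero _).2 fun P h => main _ P le_rfl h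

theorem mem_adjoin_pair {v w g : B} :
    g ∈ Algebra.adjoin R {v, w} ↔ ∃ P : MvPolynomial (Fin 2) R, MvPolynomial.aeval ![v, w] P = g := by
  rw [show ({v, w} : Set B) = Set.range ![v, w] by simp [Set.pair_comm], Algebra.adjoin_range_eq_range_aeval]
  rfl

end
end Polynomial.GaProper

namespace Polynomial.GaProper
open Polynomial

/-- Constants of a locally nilpotent derivation obtained from an element with constant derivative. -/
theorem exists_constant_of_iterate {R B : Type*} [CommRing R] [CommRing B] [Algebra R B] [Algebra ℚ B]
    (D : Derivation R B B) {y : B} {a : R} (hy : D y = algebraMap R B a) (g : B) (n : ℕ) :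
    ∃ f, D f = ((-1) ^ n * (n.factorial : ℚ)⁻¹) • (y ^ n * (⇑D)^[n + 1] g) ∧
      ∀ T : Subalgebra R B, (∀ (q : ℚ) x, x ∈ T → q • x ∈ T) → y ∈ T → (∀ j, (⇑D)^[j + 1] g ∈ T) →
        f - a ^ n • g ∈ T := by
  induction n with
  | zero => exact ⟨g, by simp, fun T _ _ _ => by simp⟩
  | succ n ih =>
    obtain ⟨f, hf, hT⟩ := ih
    refine ⟨a • f + ((-1) ^ (n + 1) * ((n + 1).factorial : ℚ)⁻¹) • (y ^ (n + 1) * (⇑D)^[n + 1] g), ?_, ?_⟩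
    · rw [map_add, D.map_smul, hf, map_rat_smul, D.leibniz, D.leibniz_pow, hy,
        ← Function.iterate_succ_apply' D]
      have h3 : (n : ℚ) + 1 ≠ 0 := by positivity
      have h4 : ((n + 1).factorial : ℚ)⁻¹ = ((n : ℚ) + 1)⁻¹ * (n.factorial : ℚ)⁻¹ := by
        rw [Nat.factorial_succ]; push_cast; rw [mul_inv]
      have h5 : algebraMap ℚ B ((n : ℚ) + 1)⁻¹ * ((n : B) + 1) = 1 := by
        have : (n : B) + 1 = algebraMap ℚ B ((n : ℚ) + 1) := by simp
        rw [this, ← map_mul, inv_mul_cancel₀ h3, map_one]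
      simp only [nsmul_eq_mul, smul_eq_mul]
      simp only [h4, Algebra.smul_def, map_mul, Nat.add_sub_cancel, Nat.cast_add, Nat.cast_one, map_pow, map_neg,
        map_one]
      linear_combination (-(-1) ^ n) * algebraMap ℚ B (n.factorial : ℚ)⁻¹ * y ^ n * algebraMap R B a *
        (⇑D)^[n + 1] g * h5
    · intro T hq hyT hgT
      have : a • f + ((-1) ^ (n + 1) * ((n + 1).factorial : ℚ)⁻¹) • (y ^ (n + 1) * (⇑D)^[n + 1] g) -
          a ^ (n + 1) • g = a • (f - a ^ n • g) +
            ((-1) ^ (n + 1) * ((n + 1).factorial : ℚ)⁻¹) • (y ^ (n + 1) * (⇑D)^[n + 1] g) := by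
        rw [smul_sub, smul_smul, pow_succ' a]; abel
      rw [this]
      exact add_mem (T.smul_mem (hT T hq hyT hgT) _) (hq _ _ (mul_mem (pow_mem hyT _) (hgT n)))

section
variable {K : Type*} [CommRing K]
  {D : Derivation K (MvPolynomial (Fin 3) K) (MvPolynomial (Fin 3) K)} {a c : K} {p : K[X]} {q : K[X][X]}
  {v w : MvPolynomial (Fin 3) K}

theorem Triangular.apply (h : Triangular D a p q) (g : MvPolynomial (Fin 3) K) :
    D g = MvPolynomial.C a * MvPolynomial.pderiv 0 g + yHom K p * MvPolynomial.pderiv 1 g +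
      pairHom (MvPolynomial.X 1) q * MvPolynomial.pderiv 2 g := by
  have : D = (MvPolynomial.C a : MvPolynomial (Fin 3) K) • MvPolynomial.pderiv (0 : Fin 3) +
      yHom K p • MvPolynomial.pderiv (1 : Fin 3) +
      pairHom (MvPolynomial.X 1) q • MvPolynomial.pderiv (2 : Fin 3) := by
    refine MvPolynomial.derivation_ext fun i => ?_
    fin_cases i
    · simp [h.map_y, MvPolynomial.pderiv_X]
    · simp [h.map_z, MvPolynomial.pderiv_X]
    · simp [h.map_u, MvPolynomial.pderiv_X]
  exact congrArg (fun d : Derivation K (MvPolynomial (Fin 3) K) (MvPolynomial (Fin 3) K) => d g) this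

variable [IsDomain K]

/-- Two constants generating the field of constants over the coefficients, with their Jacobian. -/
structure Pair (D : Derivation K (MvPolynomial (Fin 3) K) (MvPolynomial (Fin 3) K)) (a : K)
    (v w : MvPolynomial (Fin 3) K) (c : K) : Prop where
  map_left : D v = 0
  map_right : D w = 0
  ne_zero : c ≠ 0
  dvd : ∃ M, c ∣ a ^ M
  jac : MvPolynomial.pderiv 1 v * MvPolynomial.pderiv 2 w - MvPolynomial.pderiv 2 v * MvPolynomial.pderiv 1 w =
    MvPolynomial.C (c * a)
  mem_sat : ∀ g, g ∈ sat (Algebra.adjoin K {v, w, MvPolynomial.X 0})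

theorem mem_of_variables {T : Subalgebra K (MvPolynomial (Fin 3) K)} (h0 : MvPolynomial.X 0 ∈ T)
    (h1 : MvPolynomial.X 1 ∈ T) (h2 : MvPolynomial.X 2 ∈ T) (g : MvPolynomial (Fin 3) K) : g ∈ T := by
  induction g using MvPolynomial.induction_on with
  | C c => exact T.algebraMap_mem c
  | add f g hf hg => exact add_mem hf hg
  | mul_X f i hf =>
    refine mul_mem hf ?_
    fin_cases i
    exacts [h0, h1, h2]

theorem yHom_mem_of_mem {T : Subalgebra K (MvPolynomial (Fin 3) K)} (h0 : MvPolynomial.X 0 ∈ T) (P : K[X]) :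
    yHom K P ∈ T := by
  rw [yHom, coe_eval₂RingHom, eval₂_eq_sum_range]
  exact sum_mem fun i _ => mul_mem (T.algebraMap_mem _) (pow_mem h0 i)

theorem pairHom_mem_of_mem {T : Subalgebra K (MvPolynomial (Fin 3) K)} (h0 : MvPolynomial.X 0 ∈ T)
    {f : MvPolynomial (Fin 3) K} (h1 : f ∈ T) (P : K[X][X]) : pairHom f P ∈ T := by
  rw [pairHom_apply, eval₂_eq_sum_range]
  exact sum_mem fun i _ => mul_mem (yHom_mem_of_mem h0 _) (pow_mem h1 i)

theorem Pair.jac_p (h : Pair D a v w c) (ht : Triangular D a p q) (ha : a ≠ 0) :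
    MvPolynomial.pderiv 2 v * MvPolynomial.pderiv 0 w - MvPolynomial.pderiv 0 v * MvPolynomial.pderiv 2 w =
      MvPolynomial.C c * yHom K p := by
  have h1 := h.map_left
  have h2 := h.map_right
  have h3 := h.jac
  rw [ht.apply] at h1 h2
  have ha' : (MvPolynomial.C a : MvPolynomial (Fin 3) K) ≠ 0 := by simpa using ha
  refine mul_left_cancel₀ ha' ?_
  rw [map_mul] at h3
  linear_combination MvPolynomial.pderiv 2 v * h2 - MvPolynomial.pderiv 2 w * h1 + yHom K p * h3

theorem Pair.jac_q (h : Pair D a v w c) (ht : Triangular D a p q) (ha : a ≠ 0) :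
    MvPolynomial.pderiv 0 v * MvPolynomial.pderiv 1 w - MvPolynomial.pderiv 1 v * MvPolynomial.pderiv 0 w =
      MvPolynomial.C c * pairHom (MvPolynomial.X 1) q := by
  have h1 := h.map_left
  have h2 := h.map_right
  have h3 := h.jac
  rw [ht.apply] at h1 h2
  have ha' : (MvPolynomial.C a : MvPolynomial (Fin 3) K) ≠ 0 := by simpa using ha
  refine mul_left_cancel₀ ha' ?_
  rw [map_mul] at h3
  linear_combination MvPolynomial.pderiv 1 w * h1 - MvPolynomial.pderiv 1 v * h2 + pairHom (MvPolynomial.X 1) q * h3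

theorem Pair.swap (h : Pair D a v w c) : Pair D a w v (-c) where
  map_left := h.map_right
  map_right := h.map_left
  ne_zero := neg_ne_zero.2 h.ne_zero
  dvd := h.dvd.imp fun _ => (neg_dvd).2
  jac := by
    have := h.jac
    rw [neg_mul, map_neg]
    linear_combination -this
  mem_sat g := by
    rw [Set.insert_comm]
    exact h.mem_sat g

theorem sat_adjoin_le {v w v' w' : MvPolynomial (Fin 3) K}
    (h : ∀ g, g ∈ sat (Algebra.adjoin K {v, w, MvPolynomial.X 0}))
    (hv : v ∈ sat (Algebra.adjoin K {v', w', MvPolynomial.X 0}))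
    (hw : w ∈ sat (Algebra.adjoin K {v', w', MvPolynomial.X 0})) (g : MvPolynomial (Fin 3) K) :
    g ∈ sat (Algebra.adjoin K {v', w', MvPolynomial.X 0}) := by
  refine sat_le_sat (Algebra.adjoin_le ?_) (h g)
  rintro _ (rfl | rfl | rfl)
  exacts [hv, hw, le_sat _ (Algebra.subset_adjoin (by simp))]

/-- Subtracting from the second constant a polynomial in the first one. -/
theorem Pair.sub (h : Pair D a v w c) {G : MvPolynomial (Fin 3) K} (hG : D G = 0)
    (hGv : G ∈ Algebra.adjoin K {v})
    {g : MvPolynomial (Fin 3) K} (hg : ∀ i, MvPolynomial.pderiv i G = g * MvPolynomial.pderiv i v) :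
    Pair D a v (w - G) c where
  map_left := h.map_left
  map_right := by rw [map_sub, h.map_right, hG, sub_zero]
  ne_zero := h.ne_zero
  dvd := h.dvd
  jac := by
    rw [map_sub, map_sub, hg, hg]
    linear_combination h.jac
  mem_sat := by
    refine sat_adjoin_le h.mem_sat (le_sat _ (Algebra.subset_adjoin (by simp))) (le_sat _ ?_)
    rw [← sub_add_cancel w G]
    refine add_mem (Algebra.subset_adjoin (by simp)) (Algebra.adjoin_mono ?_ hGv)
    simp

theorem Pair.sub_pow (h : Pair D a v w c) (r : K) (k : ℕ) :
    Pair D a v (w - MvPolynomial.C r * v ^ k) c := by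
  refine h.sub (g := MvPolynomial.C r * (k : MvPolynomial (Fin 3) K) * v ^ (k - 1)) ?_ ?_ fun i => ?_
  · rw [D.leibniz, D.leibniz_pow, h.map_left, derivation_C]
    simp
  · exact mul_mem (Subalgebra.algebraMap_mem _ r) (pow_mem (Algebra.subset_adjoin (by simp)) _)
  · rw [Derivation.leibniz, Derivation.leibniz_pow, derivation_C]
    simp only [smul_eq_mul, nsmul_eq_mul]
    ring

/-- Dividing the second constant by a common factor of its coefficients and of the Jacobian. -/
theorem Pair.div {π c' : K} (h : Pair D a v (MvPolynomial.C π * w) (π * c')) : Pair D a v w c' := by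
  have hπ : π ≠ 0 := left_ne_zero_of_mul h.ne_zero
  have hπ' : (MvPolynomial.C π : MvPolynomial (Fin 3) K) ≠ 0 := by simpa using hπ
  refine ⟨h.map_left, ?_, right_ne_zero_of_mul h.ne_zero, ?_, ?_, ?_⟩
  · have := h.map_right
    rw [D.leibniz, derivation_C, smul_zero, add_zero, smul_eq_mul] at this
    exact (mul_eq_zero.1 this).resolve_left hπ'
  · exact h.dvd.imp fun _ => (dvd_mul_left _ _).trans
  · refine mul_left_cancel₀ hπ' ?_
    have := h.jac
    simp only [Derivation.leibniz, derivation_C, smul_eq_mul] at this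
    rw [← map_mul, ← mul_assoc π, ← this]
    ring
  · refine sat_adjoin_le h.mem_sat (le_sat _ (Algebra.subset_adjoin (by simp))) (le_sat _ ?_)
    exact mul_mem (Subalgebra.algebraMap_mem _ π) (Algebra.subset_adjoin (by simp))

end

section
variable {K : Type*} [CommRing K] [IsDomain K] [Algebra ℚ K]
  {D : Derivation K (MvPolynomial (Fin 3) K) (MvPolynomial (Fin 3) K)} {a : K} {p : K[X]} {q : K[X][X]}

theorem pderiv_two_of_mem (T : MvPolynomial (Fin 3) K) (hT : T ∈ Algebra.adjoin K {MvPolynomial.X 0, MvPolynomial.X 1}) :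
    MvPolynomial.pderiv (2 : Fin 3) T = 0 := by
  induction hT using Algebra.adjoin_induction with
  | mem x hx =>
    rcases hx with rfl | rfl
    · rw [MvPolynomial.pderiv_X_of_ne (by decide)]
    · rw [MvPolynomial.pderiv_X_of_ne (by decide)]
  | algebraMap r => exact derivation_C _ r
  | add x y _ _ hx hy => rw [map_add, hx, hy, add_zero]
  | mul x y _ _ hx hy => rw [Derivation.leibniz, hx, hy, smul_zero, smul_zero, add_zero]

theorem pderiv_of_mem_adjoin_singleton {i : Fin 3} (hi : i ≠ 0) (T : MvPolynomial (Fin 3) K)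
    (hT : T ∈ Algebra.adjoin K {MvPolynomial.X 0}) :
    MvPolynomial.pderiv i T = 0 := by
  induction hT using Algebra.adjoin_induction with
  | mem x hx =>
    rw [Set.mem_singleton_iff.1 hx, MvPolynomial.pderiv_X_of_ne hi.symm]
  | algebraMap r => exact derivation_C _ r
  | add x y _ _ hx hy => rw [map_add, hx, hy, add_zero]
  | mul x y _ _ hx hy => rw [Derivation.leibniz, hx, hy, smul_zero, smul_zero, add_zero]

theorem iterate_mem_of_map_mem {T : Subalgebra K (MvPolynomial (Fin 3) K)} (hT : ∀ x ∈ T, D x ∈ T)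
    {g : MvPolynomial (Fin 3) K} (hg : D g ∈ T) (j : ℕ) : (⇑D)^[j + 1] g ∈ T := by
  induction j with
  | zero => exact hg
  | succ j ih => rw [Function.iterate_succ_apply']; exact hT _ ih

theorem map_mem_adjoin {S : Set (MvPolynomial (Fin 3) K)} (hS : ∀ x ∈ S, D x ∈ Algebra.adjoin K S)
    (x : MvPolynomial (Fin 3) K) (hx : x ∈ Algebra.adjoin K S) : D x ∈ Algebra.adjoin K S := by
  induction hx using Algebra.adjoin_induction with
  | mem x hx => exact hS x hx
  | algebraMap r => rw [D.map_algebraMap]; exact zero_mem _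
  | add x y _ _ hx hy => rw [map_add]; exact add_mem hx hy
  | mul x y hx' hy' hx hy =>
    rw [Derivation.leibniz]; exact add_mem (mul_mem hx' hy) (mul_mem hy' hx)

theorem Triangular.exists_pair (ht : Triangular D a p q) (ha : a ≠ 0) :
    ∃ v w c, Pair D a v w c := by
  have hqs : ∀ (T : Subalgebra K (MvPolynomial (Fin 3) K)) (r : ℚ) (x), x ∈ T → r • x ∈ T := by
    intro T r x hx
    rw [← algebraMap_smul K]
    exact T.smul_mem hx _
  obtain ⟨n1, hn1⟩ := ht.isLocNilp (MvPolynomial.X 1)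
  obtain ⟨n2, hn2⟩ := ht.isLocNilp (MvPolynomial.X 2)
  obtain ⟨n, hn1', hn2'⟩ : ∃ n, n1 ≤ n + 1 + 1 ∧ n2 ≤ n + 1 + 1 := ⟨n1 + n2, by omega, by omega⟩
  have hn3 := iterate_eq_zero_of_le D hn1 hn1'
  have hn4 := iterate_eq_zero_of_le D hn2 hn2'
  obtain ⟨v, hv, hv'⟩ := exists_constant_of_iterate D ht.map_y (MvPolynomial.X 1) (n + 1)
  obtain ⟨w, hw, hw'⟩ := exists_constant_of_iterate D ht.map_y (MvPolynomial.X 2) (n + 1)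
  rw [hn3, mul_zero, smul_zero] at hv
  rw [hn4, mul_zero, smul_zero] at hw
  have h0 : ∀ S : Set (MvPolynomial (Fin 3) K), MvPolynomial.X 0 ∈ S → MvPolynomial.X 0 ∈ Algebra.adjoin K S :=
    fun S h => Algebra.subset_adjoin h
  have hv1 := hv' (Algebra.adjoin K {MvPolynomial.X 0}) (hqs _) (h0 _ (by simp))
    (iterate_mem_of_map_mem (map_mem_adjoin (by
      intro x hx
      rw [Set.mem_singleton_iff.1 hx, ht.map_y]; exact Subalgebra.algebraMap_mem _ a))
      (by rw [ht.map_z]; exact yHom_mem_of_mem (h0 _ (by simp)) _))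
  have hw1 := hw' (Algebra.adjoin K {MvPolynomial.X 0, MvPolynomial.X 1}) (hqs _) (h0 _ (by simp))
    (iterate_mem_of_map_mem (map_mem_adjoin (by
      rintro x (rfl | rfl)
      · rw [ht.map_y]; exact Subalgebra.algebraMap_mem _ a
      · rw [ht.map_z]; exact yHom_mem_of_mem (h0 _ (by simp)) _))
      (by rw [ht.map_u]; exact pairHom_mem_of_mem (h0 _ (by simp)) (Algebra.subset_adjoin (by simp)) _))
  have ha2 : a ^ (n + 1) ≠ 0 := pow_ne_zero _ ha
  have hX0 : MvPolynomial.X 0 ∈ Algebra.adjoin K {v, w, MvPolynomial.X 0} := h0 _ (by simp)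
  have hX1 : MvPolynomial.X 1 ∈ sat (Algebra.adjoin K {v, w, MvPolynomial.X 0}) := by
    refine ⟨a ^ (n + 1), ha2, ?_⟩
    have h1 : v - (v - a ^ (n + 1) • MvPolynomial.X 1) ∈ Algebra.adjoin K {v, w, MvPolynomial.X 0} :=
      sub_mem (Algebra.subset_adjoin (by simp)) (Algebra.adjoin_mono (by simp) hv1)
    rwa [sub_sub_cancel] at h1
  have hX2 : MvPolynomial.X 2 ∈ sat (Algebra.adjoin K {v, w, MvPolynomial.X 0}) := by
    refine mem_sat_of_smul_mem ha2 ?_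
    have h2 : Algebra.adjoin K {MvPolynomial.X 0, MvPolynomial.X 1} ≤
        sat (Algebra.adjoin K {v, w, MvPolynomial.X 0}) := by
      refine Algebra.adjoin_le ?_
      rintro x (rfl | rfl)
      exacts [le_sat _ hX0, hX1]
    have h1 : w - (w - a ^ (n + 1) • MvPolynomial.X 2) ∈ sat (Algebra.adjoin K {v, w, MvPolynomial.X 0}) :=
      sub_mem (le_sat _ (Algebra.subset_adjoin (by simp))) (h2 hw1)
    rwa [sub_sub_cancel] at h1
  refine ⟨v, w, a ^ (n + 1) * a ^ n, hv, hw, mul_ne_zero ha2 (pow_ne_zero _ ha), ⟨n + 1 + n, (pow_add a (n + 1) n).symm.dvd⟩,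
    ?_, mem_of_variables (le_sat _ hX0) hX1 hX2⟩
  have h1 := pderiv_of_mem_adjoin_singleton (i := 1) (by decide) _ hv1
  have h2 := pderiv_of_mem_adjoin_singleton (i := 2) (by decide) _ hv1
  have h3 := pderiv_two_of_mem _ hw1
  rw [map_sub, Derivation.map_smul, sub_eq_zero] at h1 h2 h3
  rw [h1, h2, h3, MvPolynomial.pderiv_X_self, MvPolynomial.pderiv_X_self, MvPolynomial.pderiv_X_of_ne (by decide),
    smul_zero, zero_mul, sub_zero, MvPolynomial.smul_eq_C_mul, mul_one, ← map_mul]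
  congr 1
  ring
end
end Polynomial.GaProper

namespace Polynomial.GaProper
open Polynomial

section
variable {R : Type*} [CommRing R] [IsDomain R] [Algebra ℚ R]
  {D : Derivation R (MvPolynomial (Fin 3) R) (MvPolynomial (Fin 3) R)} {a c : R} {p : R[X]} {q : R[X][X]}
  {v w : MvPolynomial (Fin 3) R} {Λ : Type*} [CommRing Λ] [IsDomain Λ]

/-- Two points with the same invariants lie on the same orbit. -/
theorem exists_eval₂_expHom (ht : Triangular D a p q) (h : Pair D a v w c) (ha : a ≠ 0)
    (hD : IsLocNilp D) (hP : Proper D hD) (b b' : MvPolynomial (Fin 3) R →+* Λ)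
    (hC : ∀ r, b (MvPolynomial.C r) = b' (MvPolynomial.C r))
    (hr : ∀ r, r ≠ 0 → b (MvPolynomial.C r) ≠ 0) (hv : b v = b' v) (hw : b w = b' w) :
    ∃ T, ∀ g, (expHom D hD g).eval₂ b T = b' g := by
  let ι := algebraMap Λ (FractionRing Λ)
  have hι : Function.Injective ι := IsFractionRing.injective Λ _
  have hA : ι (b (MvPolynomial.C a)) ≠ 0 := (map_ne_zero_iff _ hι).2 (hr a ha)
  let t := (ι (b' (MvPolynomial.X 0)) - ι (b (MvPolynomial.X 0))) / ι (b (MvPolynomial.C a))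
  let E : MvPolynomial (Fin 3) R →+* FractionRing Λ := (eval₂RingHom (ι.comp b) t).comp (expHom D hD)
  have hE : ∀ g, E g = (expHom D hD g).eval₂ (ι.comp b) t := fun g => rfl
  have hEC : ∀ g, D g = 0 → E g = ι (b g) := fun g hg => by
    rw [hE, expHom_of_eq_zero D hD hg, eval₂_C]; rfl
  let S : Subalgebra R (MvPolynomial (Fin 3) R) :=
    { E.eqLocus (ι.comp b') with
      algebraMap_mem' := fun r => by
        change E (MvPolynomial.C r) = ι (b' (MvPolynomial.C r))
        rw [hEC _ (derivation_C D r), hC] }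
  have hS : ∀ g, g ∈ S ↔ E g = ι (b' g) := fun g => Iff.rfl
  have hall : ∀ g, E g = ι (b' g) := by
    intro g
    obtain ⟨r, hr0, hrg⟩ := h.mem_sat g
    have h1 : r • g ∈ S := by
      refine (Algebra.adjoin_le ?_ : _ ≤ S) hrg
      rintro x (rfl | rfl | rfl)
      · rw [SetLike.mem_coe, hS, hEC _ h.map_left, hv]
      · rw [SetLike.mem_coe, hS, hEC _ h.map_right, hw]
      · rw [SetLike.mem_coe, hS, hE, expHom_of_map_eq_zero D hD (by rw [ht.map_y, derivation_C]), ht.map_y,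
          eval₂_add, eval₂_C, eval₂_mul, eval₂_C, eval₂_X, RingHom.comp_apply, RingHom.comp_apply,
          mul_div_cancel₀ _ hA, add_sub_cancel]
    rw [hS, MvPolynomial.smul_eq_C_mul, map_mul, map_mul, map_mul, hEC _ (derivation_C D r), hC] at h1
    exact mul_left_cancel₀ ((map_ne_zero_iff _ hι).2 (hC r ▸ hr r hr0)) h1
  obtain ⟨m, f, g, hfg⟩ := hP
  refine ⟨∑ i, b (f i) * b' (g i), fun x => hι ?_⟩
  have h1 := congrArg (eval₂ (ι.comp b) t) hfg
  rw [eval₂_finsetSum, eval₂_X] at h1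
  simp only [eval₂_mul, eval₂_C] at h1
  have h2 : ι (∑ i, b (f i) * b' (g i)) = t := by
    rw [map_sum, ← h1]
    refine Finset.sum_congr rfl fun i _ => ?_
    rw [map_mul, ← hall, hE]; rfl
  rw [hom_eval₂, h2, ← hall]
  exact (hE x).symm

theorem map_mem_of_eval₂_expHom {b b' : MvPolynomial (Fin 3) R →+* Λ}
    (hD : IsLocNilp D) {T : Λ} (hT0 : T ≠ 0) (hT : ∀ g, (expHom D hD g).eval₂ b T = b' g)
    {A : Λ} (hdiv : ∀ g, A * T ∣ b' g - b g) {𝔫 : Ideal Λ} (hA : A ∈ 𝔫)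
    {J : Ideal (MvPolynomial (Fin 3) R)} (hJ : ∀ x ∈ J, D x ∈ J) (hbJ : ∀ x ∈ J, b x ∈ 𝔫)
    {g : MvPolynomial (Fin 3) R} (hg : D (D g) ∈ J) : b (D g) ∈ 𝔫 := by
  have hJi : ∀ i, (⇑D)^[i + 2] g ∈ J := by
    intro i
    induction i with
    | zero => exact hg
    | succ i ih => rw [show i + 1 + 2 = (i + 2) + 1 by ring, Function.iterate_succ_apply']; exact hJ _ ih
  set P := expHom D hD g with hPdef
  obtain ⟨β, hβ⟩ := hdiv g
  have h1 : P = (divX (divX P) * X + C (D g)) * X + C g := by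
    conv_lhs => rw [← divX_mul_X_add P, ← divX_mul_X_add (divX P)]
    rw [coeff_divX, hPdef, coeff_expHom, coeff_expHom]
    simp
  have h2 := hT g
  rw [← hPdef, h1, eval₂_add, eval₂_mul, eval₂_add, eval₂_mul, eval₂_X, eval₂_C, eval₂_C] at h2
  have h3 : b (D g) = A * β - (divX (divX P)).eval₂ b T * T := by
    refine mul_left_cancel₀ hT0 ?_
    linear_combination h2 + hβ
  rw [h3]
  refine sub_mem (Ideal.mul_mem_right _ _ hA) (Ideal.mul_mem_right _ _ ?_)
  rw [eval₂_eq_sum_range]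
  refine sum_mem fun i _ => Ideal.mul_mem_right _ _ (hbJ _ ?_)
  rw [coeff_divX, coeff_divX, hPdef, coeff_expHom, Algebra.smul_def]
  exact Ideal.mul_mem_left _ _ (hJi i)

theorem Triangular.map_fixedIdeal_le_of_eval₂ (ht : Triangular D a p q) {b b' : MvPolynomial (Fin 3) R →+* Λ}
    (hD : IsLocNilp D) {T : Λ} (hT0 : T ≠ 0) (hT : ∀ g, (expHom D hD g).eval₂ b T = b' g)
    (hdiv : ∀ g, b' (MvPolynomial.X 0) - b (MvPolynomial.X 0) ∣ b' g - b g) {𝔫 : Ideal Λ}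
    (hA : b (MvPolynomial.C a) ∈ 𝔫) : ∀ x ∈ fixedIdeal a p q, b x ∈ 𝔫 := by
  have h0 : b' (MvPolynomial.X 0) - b (MvPolynomial.X 0) = b (MvPolynomial.C a) * T := by
    rw [← hT, expHom_of_map_eq_zero D hD (by rw [ht.map_y, derivation_C]), ht.map_y, eval₂_add, eval₂_mul,
      eval₂_X, eval₂_C, eval₂_C, add_sub_cancel_left]
  rw [h0] at hdiv
  have hp : b (yHom R p) ∈ 𝔫 := by
    rw [← ht.map_z]
    refine map_mem_of_eval₂_expHom hD hT0 hT hdiv hA (J := Ideal.span {MvPolynomial.C a}) ?_ ?_ ?_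
    · intro x hx
      obtain ⟨y, rfl⟩ := Ideal.mem_span_singleton'.1 hx
      rw [D.leibniz, derivation_C, smul_zero, zero_add, smul_eq_mul, mul_comm]
      exact Ideal.mul_mem_left _ _ (Ideal.mem_span_singleton_self _)
    · intro x hx
      obtain ⟨y, rfl⟩ := Ideal.mem_span_singleton'.1 hx
      rw [map_mul]; exact Ideal.mul_mem_left _ _ hA
    · rw [ht.map_z, derivation_yHom, ht.map_y]
      exact Ideal.mul_mem_left _ _ (Ideal.mem_span_singleton_self _)
  have hq : b (pairHom (MvPolynomial.X 1) q) ∈ 𝔫 := by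
    rw [← ht.map_u]
    refine map_mem_of_eval₂_expHom hD hT0 hT hdiv hA (J := Ideal.span {MvPolynomial.C a, yHom R p}) ?_ ?_ ?_
    · intro x hx
      obtain ⟨y, z, rfl⟩ := Ideal.mem_span_pair.1 hx
      rw [map_add, D.leibniz, D.leibniz, derivation_C, derivation_yHom, ht.map_y]
      refine Ideal.mem_span_pair.2 ⟨D y + z * yHom R (derivative p), D z, ?_⟩
      simp only [smul_eq_mul]
      ring
    · intro x hx
      obtain ⟨y, z, rfl⟩ := Ideal.mem_span_pair.1 hx
      rw [map_add, map_mul, map_mul]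
      exact add_mem (Ideal.mul_mem_left _ _ hA) (Ideal.mul_mem_left _ _ hp)
    · obtain ⟨g, hg⟩ := derivation_pairHom D (MvPolynomial.X 1) q
      rw [ht.map_u, hg, ht.map_y, ht.map_z]
      exact Ideal.mem_span_pair.2 ⟨g, _, rfl⟩
  intro x hx
  obtain ⟨y, z, u, rfl⟩ := (mem_fixedIdeal _).1 hx
  rw [map_add, map_add, map_mul, map_mul, map_mul]
  exact add_mem (add_mem (Ideal.mul_mem_left _ _ hA) (Ideal.mul_mem_left _ _ hp)) (Ideal.mul_mem_left _ _ hq)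

theorem Triangular.map_fixedIdeal_le_of_derivation (ht : Triangular D a p q) (h : Pair D a v w c)
    {b : MvPolynomial (Fin 3) R →+* Λ} (hr : ∀ r, r ≠ 0 → b (MvPolynomial.C r) ≠ 0)
    (δ : MvPolynomial (Fin 3) R →+ Λ) (hmul : ∀ x y, δ (x * y) = b x * δ y + b y * δ x)
    (hC : ∀ r, δ (MvPolynomial.C r) = 0) (hX : δ (MvPolynomial.X 0) = 1) (hv : δ v = 0) (hw : δ w = 0)
    {𝔫 : Ideal Λ} (hA : b (MvPolynomial.C a) ∈ 𝔫) : ∀ x ∈ fixedIdeal a p q, b x ∈ 𝔫 := by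
  let S : Subalgebra R (MvPolynomial (Fin 3) R) :=
    { carrier := {x | b (MvPolynomial.C a) * δ x = b (D x)}
      mul_mem' := by
        intro x y hx hy
        rw [Set.mem_ofPred_eq] at *
        rw [hmul, D.leibniz, map_add, smul_eq_mul, smul_eq_mul, map_mul, map_mul, ← hx, ← hy]
        ring
      add_mem' := by
        intro x y hx hy
        rw [Set.mem_ofPred_eq] at *
        rw [map_add, map_add, map_add, mul_add, hx, hy]
      algebraMap_mem' := fun r => by
        rw [Set.mem_ofPred_eq, D.map_algebraMap, map_zero]
        exact (congrArg _ (hC r)).trans (mul_zero _) }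
  have hS : ∀ x, x ∈ S ↔ b (MvPolynomial.C a) * δ x = b (D x) := fun x => Iff.rfl
  have hall : ∀ g, b (MvPolynomial.C a) * δ g = b (D g) := by
    intro g
    obtain ⟨r, hr0, hrg⟩ := h.mem_sat g
    have h1 : r • g ∈ S := by
      refine (Algebra.adjoin_le ?_ : _ ≤ S) hrg
      rintro x (rfl | rfl | rfl)
      · rw [SetLike.mem_coe, hS, hv, h.map_left, map_zero, mul_zero]
      · rw [SetLike.mem_coe, hS, hw, h.map_right, map_zero, mul_zero]
      · rw [SetLike.mem_coe, hS, hX, mul_one, ht.map_y]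
    rw [hS, MvPolynomial.smul_eq_C_mul, hmul, hC, D.leibniz, derivation_C, smul_zero, add_zero, smul_eq_mul,
      map_mul, mul_zero, add_zero] at h1
    refine mul_left_cancel₀ (hr r hr0) ?_
    linear_combination h1
  intro x hx
  obtain ⟨y, z, u, rfl⟩ := (mem_fixedIdeal _).1 hx
  rw [map_add, map_add, map_mul, map_mul, map_mul, ← ht.map_z, ← ht.map_u, ← hall, ← hall]
  exact add_mem (add_mem (Ideal.mul_mem_left _ _ hA) (Ideal.mul_mem_left _ _ (Ideal.mul_mem_right _ _ hA)))
    (Ideal.mul_mem_left _ _ (Ideal.mul_mem_right _ _ hA))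

end

/-- Divided differences. -/
theorem exists_dividedDifference {O : Type*} [CommRing O] (P : O[X]) :
    ∃ P₁ : O[X][X], (C X - X) * P₁ = C P - P.map C := by
  have h := X_sub_C_dvd_sub_C_eval (a := (X : O[X])) (p := P.map C)
  rw [← eval₂_eq_eval_map, eval₂_C_X] at h
  obtain ⟨Q, hQ⟩ := h
  exact ⟨Q, by linear_combination hQ⟩

theorem eval_dividedDifference {O : Type*} [CommRing O] {P : O[X]} {P₁ : O[X][X]}
    (h : (C X - X) * P₁ = C P - P.map C) : P₁.eval X = derivative P := by
  have h1 := congrArg (fun Q => (derivative Q).eval X) h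
  simp only [derivative_mul, derivative_sub, derivative_C, derivative_X, derivative_map, eval_add, eval_mul,
    eval_sub, eval_C, eval_X, eval_zero, eval_one] at h1
  rw [← eval₂_eq_eval_map, eval₂_C_X] at h1
  linear_combination -h1

theorem exists_domain_quotient.{u} {A : Type u} [CommRing A] (Q : Ideal A) (hQ : Q.IsPrime) :
    ∃ (Λ : Type u) (_ : CommRing Λ) (_ : IsDomain Λ) (j : A →+* Λ),
      Function.Surjective j ∧ ∀ x, j x = 0 ↔ x ∈ Q :=
  ⟨A ⧸ Q, inferInstance, inferInstance, Ideal.Quotient.mk Q, Ideal.Quotient.mk_surjective,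
    fun _ => Ideal.Quotient.eq_zero_iff_mem⟩

section
variable {R : Type*} [CommRing R] [IsDomain R] [Algebra ℚ R]
  {D : Derivation R (MvPolynomial (Fin 3) R) (MvPolynomial (Fin 3) R)} {a c : R} {p : R[X]} {q : R[X][X]}
  {v w : MvPolynomial (Fin 3) R} {O : Type*} [CommRing O]

/-- The divided differences of the two invariants along a test curve generate, up to a power of the
parameter, a unit near the special fibre. -/
theorem exists_dividedDifference_combination (ht : Triangular D a p q) (h : Pair D a v w c) (ha : a ≠ 0)
    (hD : IsLocNilp D) (hP : Proper D hD) {ϖ : O} (hϖ : ∀ o : O, o ≠ 0 → ∃ (n : ℕ) (u : Oˣ), o = u * ϖ ^ n) (ρ : R →+* O) (hρ : Function.Injective ρ)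
    (hρa : ϖ ∣ ρ a) (ψ : MvPolynomial (Fin 3) R →+* O[X])
    (hψC : ∀ r, ψ (MvPolynomial.C r) = C (ρ r)) (hψX : ψ (MvPolynomial.X 0) = X)
    {v₁ w₁ : O[X][X]}
    (hv₁ : (C X - X) * v₁ = C (ψ v) - (ψ v).map C) (hw₁ : (C X - X) * w₁ = C (ψ w) - (ψ w).map C) :
    ∃ (α β s : O[X][X]) (N : ℕ),
      α * v₁ + β * w₁ = C (C ϖ) ^ N * (1 + C (C ϖ) * s) := by
  by_contra! hcon
  let τ : O[X][X] := C (C ϖ)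
  let S : Submonoid O[X][X] :=
    { carrier := {x | ∃ (s : O[X][X]) (N : ℕ), x = τ ^ N * (1 + τ * s)}
      one_mem' := ⟨0, 0, by rw [mul_zero, add_zero, pow_zero, mul_one]⟩
      mul_mem' := by
        rintro _ _ ⟨s, N, rfl⟩ ⟨t, M, rfl⟩
        exact ⟨s + t + τ * s * t, N + M, by rw [pow_add]; ring⟩ }
  have hS : ∀ x, x ∈ S ↔ ∃ (s : O[X][X]) (N : ℕ), x = τ ^ N * (1 + τ * s) := fun x => Iff.rfl
  obtain ⟨Q, hQ, hIQ, hQS⟩ := Ideal.exists_le_prime_disjoint (Ideal.span {v₁, w₁}) S (by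
    rw [Set.disjoint_left]
    rintro x hx ⟨s, N, rfl⟩
    obtain ⟨α, β, hαβ⟩ := Ideal.mem_span_pair.1 hx
    exact hcon α β s N hαβ)
  rw [Set.disjoint_left] at hQS
  obtain ⟨Λ, _, _, j, hjs, hj⟩ := exists_domain_quotient Q hQ
  have hv0 : j v₁ = 0 := (hj _).2 (hIQ (Ideal.subset_span (by simp)))
  have hw0 : j w₁ = 0 := (hj _).2 (hIQ (Ideal.subset_span (by simp)))
  have hτ0 : j τ ≠ 0 := fun h0 => hQS ((hj _).1 h0)
    ((hS _).2 ⟨0, 1, by rw [mul_zero, add_zero, pow_one, mul_one]⟩)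
  have hτu : ¬ IsUnit (j τ) := by
    intro hu
    obtain ⟨s', hs'⟩ := hu.exists_right_inv
    obtain ⟨s, rfl⟩ := hjs s'
    refine hQS (a := 1 + τ * (-s)) ((hj _).1 ?_) ((hS _).2 ⟨-s, 0, by rw [pow_zero, one_mul]⟩)
    rw [map_add, map_one, map_mul, map_neg, mul_neg]
    exact add_neg_eq_zero.2 hs'.symm
  obtain ⟨𝔫, h𝔫, hτ𝔫⟩ := exists_max_ideal_of_mem_nonunits (a := j τ) hτu
  have hO : ∀ o : O, o ≠ 0 → j (C (C o)) ≠ 0 := by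
    intro o ho
    obtain ⟨n, u, hu⟩ := hϖ o ho
    rw [hu, C_mul, C_mul, C_pow, C_pow, map_mul, map_pow]
    exact mul_ne_zero (((u.isUnit.map (C : O →+* _)).map (C : _ →+* O[X][X])).map j).ne_zero
      (pow_ne_zero _ hτ0)
  let b : MvPolynomial (Fin 3) R →+* Λ := (j.comp C).comp ψ
  let b' : MvPolynomial (Fin 3) R →+* Λ := (j.comp (mapRingHom C)).comp ψ
  have hb : ∀ g, b g = j (C (ψ g)) := fun g => rfl
  have hb' : ∀ g, b' g = j ((ψ g).map C) := fun g => rfl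
  have hbr : ∀ r, r ≠ 0 → b (MvPolynomial.C r) ≠ 0 := fun r hr => by
    rw [hb, hψC]
    exact hO _ ((map_ne_zero_iff _ hρ).2 hr)
  have hsub : ∀ g x, (C X - X) * x = C (ψ g) - (ψ g).map C → j x = 0 → b g = b' g := by
    intro g x hx hx0
    have := congrArg j hx
    rw [map_mul, hx0, mul_zero, map_sub] at this
    exact (sub_eq_zero.1 this.symm)
  have hvb := hsub v v₁ hv₁ hv0
  have hwb := hsub w w₁ hw₁ hw0
  have hA𝔫 : b (MvPolynomial.C a) ∈ 𝔫 := by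
    obtain ⟨o, ho⟩ := hρa
    rw [hb, hψC, ho, C_mul, C_mul, map_mul]
    exact Ideal.mul_mem_right _ _ hτ𝔫
  obtain ⟨T, hT⟩ := exists_eval₂_expHom ht h ha hD hP b b' (fun r => by
    rw [hb, hb', hψC, map_C]) hbr hvb hwb
  have hfix : ∀ x ∈ fixedIdeal a p q, b x ∈ 𝔫 := by
    rcases eq_or_ne T 0 with rfl | hT0
    · have hbb : ∀ g, b g = b' g := fun g => by
        rw [← hT, eval₂_at_zero, coeff_expHom]
        simp
      have hjX : j.comp (mapRingHom C) = j.comp C := by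
        refine Polynomial.ringHom_ext (fun o => ?_) ?_
        · simp
        · have := hbb (MvPolynomial.X 0)
          rw [hb, hb', hψX] at this
          exact this.symm
      have hev : ∀ P : O[X][X], j P = j (C (P.eval X)) := by
        have h1 : j = (j.comp C).comp (evalRingHom X) := by
          refine Polynomial.ringHom_ext (fun o => ?_) ?_
          · simp
          · have := hbb (MvPolynomial.X 0)
            rw [hb, hb', hψX, map_X] at this
            simpa using this.symm
        exact fun P => congrArg (fun φ : O[X][X] →+* _ => φ P) h1
      refine ht.map_fixedIdeal_le_of_derivation h hbr
        (((j.comp C).toAddMonoidHom.comp (derivative (R := O)).toAddMonoidHom).comp ψ.toAddMonoidHom)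
        ?_ ?_ ?_ ?_ ?_ hA𝔫
      · intro x y
        change j (C (derivative (ψ (x * y)))) = b x * j (C (derivative (ψ y))) + b y * j (C (derivative (ψ x)))
        rw [map_mul, derivative_mul, C_add, C_mul, C_mul, map_add, map_mul, map_mul, hb, hb]
        ring
      · intro r
        change j (C (derivative (ψ _))) = 0
        rw [hψC, derivative_C, C_0, map_zero]
      · change j (C (derivative (ψ _))) = 1
        rw [hψX, derivative_X, C_1, map_one]
      · change j (C (derivative (ψ _))) = 0
        rw [← eval_dividedDifference hv₁, ← hev, hv0]
      · change j (C (derivative (ψ _))) = 0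
        rw [← eval_dividedDifference hw₁, ← hev, hw0]
    · refine ht.map_fixedIdeal_le_of_eval₂ hD hT0 hT (fun g => ?_) hA𝔫
      obtain ⟨x, hx⟩ := exists_dividedDifference (ψ g)
      refine ⟨j x, ?_⟩
      have := congrArg j hx
      rw [map_mul, map_sub, map_sub] at this
      rw [hb, hb', hb, hb', hψX, map_X]
      linear_combination this
  refine h𝔫.ne_top ((Ideal.eq_top_iff_one _).2 ?_)
  rw [← map_one b]
  exact hfix _ (ht.one_mem_fixedIdeal hP)

end
end Polynomial.GaProper

namespace Polynomial.GaProper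
open Polynomial

section
variable {k : Type*} [Field k] [CharZero k]
  {D : Derivation k[X] (MvPolynomial (Fin 3) k[X]) (MvPolynomial (Fin 3) k[X])} {a c : k[X]} {p : k[X][X]}
  {q : k[X][X][X]} {v w : MvPolynomial (Fin 3) k[X]}

/-- Expansion at a point of the affine line. -/
noncomputable def expansion {L : Type*} [Field L] (σ : k[X] →+* L) : k[X] →+* PowerSeries L :=
  (coeToPowerSeries.ringHom.comp (taylorAlgHom (σ X) : L[X] →+* L[X])).comp (mapRingHom (σ.comp C))

theorem expansion_injective {L : Type*} [Field L] (σ : k[X] →+* L) : Function.Injective (expansion σ) := by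
  refine (Polynomial.coe_injective L).comp ((taylor_injective (σ X)).comp ?_)
  exact map_injective _ (σ.comp C).injective

theorem constantCoeff_expansion {L : Type*} [Field L] (σ : k[X] →+* L) :
    (PowerSeries.constantCoeff).comp (expansion σ) = σ := by
  refine Polynomial.ringHom_ext (fun c => ?_) ?_
  · simp [expansion]
  · simp [expansion]

/-- Divisibility of the degrees of the invariants along a test curve in a singular fibre. -/
theorem Pair.natDegree_dvd (h : Pair D a v w c) (ht : Triangular D a p q) (ha : a ≠ 0)
    (hD : IsLocNilp D) (hP : Proper D hD) {κ : Type*} [Field κ] [CharZero κ] (σ : k[X] →+* κ) (hσ : σ a = 0)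
    (b : Bool) (N : ℕ) (hm : 0 < (curve κ b N (MvPolynomial.map σ v)).natDegree)
    (hmn : (curve κ b N (MvPolynomial.map σ v)).natDegree ≤ (curve κ b N (MvPolynomial.map σ w)).natDegree) :
    (curve κ b N (MvPolynomial.map σ v)).natDegree ∣ (curve κ b N (MvPolynomial.map σ w)).natDegree := by
  let L := AlgebraicClosure κ
  have hL : CharZero L := charZero_of_injective_algebraMap (algebraMap κ L).injective
  let σ' : k[X] →+* L := (algebraMap κ L).comp σ
  let ρ := expansion σ'
  let ψ : MvPolynomial (Fin 3) k[X] →+* (PowerSeries L)[X] :=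
    (mapRingHom ρ).comp (curve k[X] b N : MvPolynomial (Fin 3) k[X] →+* k[X][X])
  have hψ : ∀ g, ((ψ g).map PowerSeries.constantCoeff).natDegree = (curve κ b N (MvPolynomial.map σ g)).natDegree := by
    intro g
    change (((curve k[X] b N g).map ρ).map _).natDegree = _
    rw [Polynomial.map_map, constantCoeff_expansion, curve_map, ← Polynomial.map_map,
      natDegree_map_eq_of_injective (algebraMap κ L).injective]
  have hρa : PowerSeries.X ∣ ρ a := by
    rw [PowerSeries.X_dvd_iff]
    change ((PowerSeries.constantCoeff).comp (expansion σ')) a = 0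
    rw [constantCoeff_expansion, RingHom.comp_apply, hσ, map_zero]
  obtain ⟨v₁, hv₁⟩ := exists_dividedDifference (ψ v)
  obtain ⟨w₁, hw₁⟩ := exists_dividedDifference (ψ w)
  obtain ⟨α, β, s, M, hs⟩ := exists_dividedDifference_combination ht h ha hD hP (ϖ := PowerSeries.X)
    (fun o ho => IsDiscreteValuationRing.eq_unit_mul_pow_irreducible ho PowerSeries.X_irreducible) ρ
    (expansion_injective σ') hρa ψ (fun r => by simp [ψ, curve, Polynomial.algebraMap_eq])
    (by cases b <;> simp [ψ, curve]) hv₁ hw₁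
  rw [← hψ, ← hψ] at *
  exact core hv₁ hw₁ hs hm hmn

end
end Polynomial.GaProper

namespace Polynomial.GaProper
open Polynomial

section
variable {κ : Type*} [Field κ]

theorem exists_natDegree_coeff_lt (V : κ[X][X]) : ∃ n, ∀ i, (V.coeff i).natDegree < n := by
  refine ⟨V.support.sup (fun i => (V.coeff i).natDegree) + 1, fun i => Nat.lt_succ_of_le ?_⟩
  by_cases hi : i ∈ V.support
  · exact Finset.le_sup (f := fun i => (V.coeff i).natDegree) hi
  · rw [notMem_support_iff.1 hi, natDegree_zero]; exact Nat.zero_le _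

/-- Degrees along curves of large degree detect the lexicographic degree. -/
theorem natDegree_eval_of_large {V : κ[X][X]} (hV : V ≠ 0) {F : ℕ → κ[X]} {e : ℕ}
    (hF : ∀ N, (F N).natDegree = N + e) :
    ∃ N₀, ∀ N, N₀ ≤ N → (V.eval (F N)) ≠ 0 ∧
      (V.eval (F N)).natDegree = V.leadingCoeff.natDegree + (N + e) * V.natDegree := by
  obtain ⟨n, hn⟩ := exists_natDegree_coeff_lt V
  refine ⟨n, fun N hN => ?_⟩
  have h1 := degree_eval_of_large hV (F := F N) (fun i => by rw [hF]; exact (hn i).trans_le (by omega))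
  refine ⟨fun h0 => ?_, by rw [natDegree_eq_of_degree_eq_some h1, hF]⟩
  rw [h0, degree_zero] at h1
  exact absurd h1.symm (WithBot.coe_ne_bot)

theorem eq_mul_of_mul_eq {α₁ α₂ β₁ β₂ k N : ℕ} (h : k * (α₁ + N * α₂) = β₁ + N * β₂)
    (hN : β₂ * α₁ + β₁ < N) (hα : 0 < α₂ ∨ β₂ = 0 ∧ α₂ = 0) : β₂ = k * α₂ ∧ β₁ = k * α₁ := by
  rcases hα with hα | ⟨rfl, rfl⟩
  · have hk : k ≤ β₂ := by
      by_contra! hk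
      have h1 : k * (N * 1) ≤ k * (α₁ + N * α₂) :=
        Nat.mul_le_mul_left _ ((Nat.mul_le_mul_left _ hα).trans (Nat.le_add_left _ _))
      have h2 : (β₂ + 1) * N ≤ k * N := Nat.mul_le_mul_right _ hk
      nlinarith
    have h3 : k * α₁ ≤ β₂ * α₁ := Nat.mul_le_mul_right _ hk
    have h4 : β₂ = k * α₂ := by
      rcases lt_trichotomy β₂ (k * α₂) with h5 | h5 | h5
      · have : N * (β₂ + 1) ≤ N * (k * α₂) := Nat.mul_le_mul_left _ h5
        nlinarith
      · exact h5
      · have : N * (k * α₂ + 1) ≤ N * β₂ := Nat.mul_le_mul_left _ h5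
        nlinarith
    refine ⟨h4, ?_⟩
    rw [h4] at h
    nlinarith
  · simp at h ⊢
    exact h.symm

theorem exists_mul_of_forall_dvd {V W : κ[X][X]} {F : ℕ → κ[X]} {e : ℕ}
    (hF : ∀ N, (F N).natDegree = N + e)
    (hVW : 0 < V.natDegree ∧ 0 < W.natDegree ∨
      (V.natDegree = 0 ∧ W.natDegree = 0) ∧ 0 < V.leadingCoeff.natDegree ∧ 0 < W.leadingCoeff.natDegree)
    (h : ∀ N, 0 < (V.eval (F N)).natDegree → (V.eval (F N)).natDegree ≤ (W.eval (F N)).natDegree →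
      (V.eval (F N)).natDegree ∣ (W.eval (F N)).natDegree)
    (h' : ∀ N, 0 < (W.eval (F N)).natDegree → (W.eval (F N)).natDegree ≤ (V.eval (F N)).natDegree →
      (W.eval (F N)).natDegree ∣ (V.eval (F N)).natDegree) :
    (∃ k, W.natDegree = k * V.natDegree ∧ W.leadingCoeff.natDegree = k * V.leadingCoeff.natDegree) ∨
      ∃ k, V.natDegree = k * W.natDegree ∧ V.leadingCoeff.natDegree = k * W.leadingCoeff.natDegree := by
  have hV : V ≠ 0 := by rintro rfl; simp at hVW
  have hW : W ≠ 0 := by rintro rfl; simp at hVW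
  obtain ⟨N₁, hN₁⟩ := natDegree_eval_of_large hV hF
  obtain ⟨N₂, hN₂⟩ := natDegree_eval_of_large hW hF
  obtain ⟨N, hNN₁, hNN₂, hNa, hNb⟩ : ∃ N, N₁ ≤ N ∧ N₂ ≤ N ∧
      W.natDegree * V.leadingCoeff.natDegree + W.leadingCoeff.natDegree < N + e ∧
      V.natDegree * W.leadingCoeff.natDegree + V.leadingCoeff.natDegree < N + e :=
    ⟨N₁ + N₂ + (W.natDegree * V.leadingCoeff.natDegree + W.leadingCoeff.natDegree) +
      (V.natDegree * W.leadingCoeff.natDegree + V.leadingCoeff.natDegree) + 1,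
      by omega, by omega, by omega, by omega⟩
  have h1 := (hN₁ N hNN₁).2
  have h2 := (hN₂ N hNN₂).2
  have h3 := h N
  have h4 := h' N
  rw [h1, h2] at h3 h4
  have hNe : 0 < N + e := by omega
  rcases le_total (V.leadingCoeff.natDegree + (N + e) * V.natDegree)
    (W.leadingCoeff.natDegree + (N + e) * W.natDegree) with hle | hle
  · left
    obtain ⟨k, hk⟩ := h3 (by
      rcases hVW with h5 | h5
      · have := Nat.mul_pos hNe h5.1; omega
      · omega) hle
    exact ⟨k, eq_mul_of_mul_eq (by rw [hk, mul_comm]) hNa (by omega)⟩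
  · right
    obtain ⟨k, hk⟩ := h4 (by
      rcases hVW with h5 | h5
      · have := Nat.mul_pos hNe h5.2; omega
      · omega) hle
    exact ⟨k, eq_mul_of_mul_eq (by rw [hk, mul_comm]) hNb (by omega)⟩

/-- Cancelling the lexicographic leading term. -/
theorem exists_lex_lt {V W : κ[X][X]} {k : ℕ} (h1 : W.natDegree = k * V.natDegree)
    (h2 : W.leadingCoeff.natDegree = k * V.leadingCoeff.natDegree)
    (hW : 0 < W.natDegree ∨ 0 < W.leadingCoeff.natDegree) :
    ∃ r : κ, (W - C (C r) * V ^ k).natDegree < W.natDegree ∨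
      (W - C (C r) * V ^ k).natDegree = W.natDegree ∧
      (W - C (C r) * V ^ k).leadingCoeff.natDegree < W.leadingCoeff.natDegree := by
  have hW0 : W ≠ 0 := by rintro rfl; simp at hW
  have hV0 : V ≠ 0 := by rintro rfl; simp [h1, h2] at hW
  have hv : V.leadingCoeff.leadingCoeff ^ k ≠ 0 := by simp [hV0]
  set r := W.leadingCoeff.leadingCoeff / V.leadingCoeff.leadingCoeff ^ k with hr
  have hr0 : r ≠ 0 := div_ne_zero (by simp [hW0]) hv
  refine ⟨r, ?_⟩
  have hC : (C (C r) : κ[X][X]) ≠ 0 := by simpa using hr0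
  set U := C (C r) * V ^ k with hU
  have hUd : U.natDegree = W.natDegree := by
    rw [hU, natDegree_C_mul (by simpa using hr0), natDegree_pow, h1]
  have hUl : U.leadingCoeff = C r * V.leadingCoeff ^ k := by
    rw [hU, leadingCoeff_mul, leadingCoeff_C, leadingCoeff_pow]
  have hUld : U.leadingCoeff.natDegree = W.leadingCoeff.natDegree := by
    rw [hUl, natDegree_C_mul hr0, natDegree_pow, h2]
  have hUll : U.leadingCoeff.leadingCoeff = W.leadingCoeff.leadingCoeff := by
    rw [hUl, leadingCoeff_mul, leadingCoeff_C, leadingCoeff_pow, hr, div_mul_cancel₀ _ hv]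
  have hle : (W - U).natDegree ≤ W.natDegree := (natDegree_sub_le _ _).trans (by rw [hUd, max_self])
  rcases hle.lt_or_eq with h3 | h3
  · exact Or.inl h3
  refine Or.inr ⟨h3, ?_⟩
  have h4 : (W - U).leadingCoeff = W.leadingCoeff - U.leadingCoeff := by
    rw [leadingCoeff, h3, coeff_sub, leadingCoeff, leadingCoeff, hUd]
  have h5 : (W.leadingCoeff - U.leadingCoeff).natDegree ≤ W.leadingCoeff.natDegree :=
    (natDegree_sub_le _ _).trans (by rw [hUld, max_self])
  have h6 : (W.leadingCoeff - U.leadingCoeff).coeff W.leadingCoeff.natDegree = 0 := by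
    rw [coeff_sub, coeff_natDegree, ← hUll, ← hUld, coeff_natDegree, sub_self]
  rw [h4]
  refine lt_of_le_of_ne h5 fun h7 => ?_
  have h8 : W.leadingCoeff - U.leadingCoeff = 0 := by
    rw [← leadingCoeff_eq_zero, leadingCoeff, h7, h6]
  have h9 : W - U = 0 := by rw [← leadingCoeff_eq_zero, h4, h8]
  rw [h8, natDegree_zero] at h7
  rw [h9, natDegree_zero] at h3
  omega

end
end Polynomial.GaProper

namespace Polynomial.GaProper
open Polynomial

section
variable {K L : Type*} [CommRing K] [CommRing L] (σ : K →+* L)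
  {D : Derivation K (MvPolynomial (Fin 3) K) (MvPolynomial (Fin 3) K)}
  {D' : Derivation L (MvPolynomial (Fin 3) L) (MvPolynomial (Fin 3) L)} {a : K} {p : K[X]} {q : K[X][X]}

theorem map_yHom (P : K[X]) : MvPolynomial.map σ (yHom K P) = yHom L (P.map σ) := by
  have : (MvPolynomial.map σ : MvPolynomial (Fin 3) K →+* _).comp (yHom K) = (yHom L).comp (mapRingHom σ) := by
    refine Polynomial.ringHom_ext (fun c => ?_) ?_
    · simp [yHom]
    · simp [yHom]
  exact congrArg (fun φ : K[X] →+* MvPolynomial (Fin 3) L => φ P) this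

theorem map_pairHom (f : MvPolynomial (Fin 3) K) (V : K[X][X]) : MvPolynomial.map σ (pairHom f V) =
    pairHom (MvPolynomial.map σ f) (V.map (mapRingHom σ)) := by
  have : (MvPolynomial.map σ : MvPolynomial (Fin 3) K →+* _).comp (pairHom f) =
      (pairHom (MvPolynomial.map σ f)).comp (mapRingHom (mapRingHom σ)) := by
    refine Polynomial.ringHom_ext (fun c => ?_) ?_
    · simp [pairHom_C, map_yHom]
    · simp [pairHom_X]
  exact congrArg (fun φ : K[X][X] →+* MvPolynomial (Fin 3) L => φ V) this

theorem one_mem_fixedIdeal_map [Algebra ℚ K] [Algebra ℚ L] (h : 1 ∈ fixedIdeal a p q) :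
    1 ∈ fixedIdeal (σ a) (p.map σ) (q.map (mapRingHom σ)) := by
  obtain ⟨x, y, z, h⟩ := (mem_fixedIdeal _).1 h
  refine (mem_fixedIdeal _).2 ⟨MvPolynomial.map σ x, MvPolynomial.map σ y, MvPolynomial.map σ z, ?_⟩
  have := congrArg (MvPolynomial.map σ) h
  simpa [map_yHom, map_pairHom] using this

theorem exists_triangular (a : K) (p : K[X]) (q : K[X][X]) :
    ∃ D : Derivation K (MvPolynomial (Fin 3) K) (MvPolynomial (Fin 3) K), Triangular D a p q :=
  ⟨MvPolynomial.mkDerivation K ![MvPolynomial.C a, yHom K p, pairHom (MvPolynomial.X 1) q],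
    by simp [MvPolynomial.mkDerivation_X], by simp [MvPolynomial.mkDerivation_X],
    by simp [MvPolynomial.mkDerivation_X]⟩

theorem Triangular.map_apply (h : Triangular D a p q)
    (h' : Triangular D' (σ a) (p.map σ) (q.map (mapRingHom σ))) (g : MvPolynomial (Fin 3) K) :
    MvPolynomial.map σ (D g) = D' (MvPolynomial.map σ g) := by
  rw [h.apply, h'.apply]
  simp [map_yHom, map_pairHom, MvPolynomial.pderiv_map]

/-- The constants of a fibre of a triangular derivation over which the first coefficient vanishes are
the polynomials in the first variable and in `f`. -/
structure Fibre (D : Derivation K (MvPolynomial (Fin 3) K) (MvPolynomial (Fin 3) K)) (σ : K →+* L)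
    (f : MvPolynomial (Fin 3) L) : Prop where
  exists_eq : ∀ g, MvPolynomial.map σ (D g) = 0 → ∃ V, MvPolynomial.map σ g = pairHom f V
  pderiv_ne : MvPolynomial.pderiv 1 f ≠ 0 ∨ MvPolynomial.pderiv 2 f ≠ 0
  degree_curve : ∃ b e, ∀ N, (curve L b N f).natDegree = N + e

theorem Triangular.exists_fibre [IsDomain L] [Algebra ℚ K] [Algebra ℚ L] (h : Triangular D a p q)
    (h1 : 1 ∈ fixedIdeal a p q) (hσ : σ a = 0) : ∃ f, Fibre D σ f := by
  obtain ⟨D', hD'⟩ := exists_triangular (σ a) (p.map σ) (q.map (mapRingHom σ))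
  have h2 := one_mem_fixedIdeal_map σ h1
  have h3 := h.map_apply σ hD'
  rw [hσ] at hD' h2
  obtain ⟨f, s, -, -, hgen, hne, hdeg⟩ := hD'.exists_slice h2
  exact ⟨f, fun g hg => hgen _ (by rw [← h3, hg]), hne, hdeg⟩

end

theorem adjoin_pair_sub {R B : Type*} [CommRing R] [CommRing B] [Algebra R B] {v w G : B}
    (hG : G ∈ Algebra.adjoin R {v}) : Algebra.adjoin R {v, w - G} = Algebra.adjoin R {v, w} := by
  refine le_antisymm (Algebra.adjoin_le ?_) (Algebra.adjoin_le ?_)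
  · rintro x (rfl | rfl)
    · exact Algebra.subset_adjoin (by simp)
    · exact sub_mem (Algebra.subset_adjoin (by simp)) (Algebra.adjoin_mono (by simp) hG)
  · rintro x (hx | hx)
    · exact Algebra.subset_adjoin (by simp [hx])
    · rw [hx, ← sub_add_cancel w G]
      exact add_mem (Algebra.subset_adjoin (by simp)) (Algebra.adjoin_mono (by simp) hG)

section
variable {k : Type*} [Field k] [CharZero k]
  {D : Derivation k[X] (MvPolynomial (Fin 3) k[X]) (MvPolynomial (Fin 3) k[X])} {a c : k[X]} {p : k[X][X]}
  {q : k[X][X][X]} {v w : MvPolynomial (Fin 3) k[X]}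
  {κ : Type*} [Field κ] [CharZero κ] {σ : k[X] →+* κ} {f : MvPolynomial (Fin 3) κ}

/-- Euclidean reduction of two constants along a singular fibre. -/
theorem Pair.exists_reduced (h : Pair D a v w c) (ht : Triangular D a p q) (ha : a ≠ 0)
    (hD : IsLocNilp D) (hP : Proper D hD) (hσs : Function.Surjective σ) (hσ : σ a = 0) (hf : Fibre D σ f) :
    ∃ v' w' c' V W, Pair D a v' w' c' ∧ (c' = c ∨ c' = -c) ∧
      Algebra.adjoin k[X] {v', w'} = Algebra.adjoin k[X] {v, w} ∧
      MvPolynomial.map σ v' = pairHom f V ∧ MvPolynomial.map σ w' = pairHom f W ∧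
      V.natDegree = 0 ∧ ((V.coeff 0).natDegree = 0 ∨ 0 < W.natDegree) := by
  obtain ⟨b, e, hdeg⟩ := hf.degree_curve
  have key : ∀ n m v w c V W, Pair D a v w c → MvPolynomial.map σ v = pairHom f V →
      MvPolynomial.map σ w = pairHom f W → V.natDegree + W.natDegree = n →
      V.leadingCoeff.natDegree + W.leadingCoeff.natDegree = m →
      ∃ v' w' c' V W, Pair D a v' w' c' ∧ (c' = c ∨ c' = -c) ∧
        Algebra.adjoin k[X] {v', w'} = Algebra.adjoin k[X] {v, w} ∧
        MvPolynomial.map σ v' = pairHom f V ∧ MvPolynomial.map σ w' = pairHom f W ∧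
        V.natDegree = 0 ∧ ((V.coeff 0).natDegree = 0 ∨ 0 < W.natDegree) := by
    intro n
    induction n using Nat.strong_induction_on with
    | _ n ihn =>
    intro m
    induction m using Nat.strong_induction_on with
    | _ m ihm =>
    have step : ∀ v w c V W j, Pair D a v w c → MvPolynomial.map σ v = pairHom f V →
        MvPolynomial.map σ w = pairHom f W → V.natDegree + W.natDegree = n →
        V.leadingCoeff.natDegree + W.leadingCoeff.natDegree = m →
        W.natDegree = j * V.natDegree → W.leadingCoeff.natDegree = j * V.leadingCoeff.natDegree →
        (0 < W.natDegree ∨ 0 < W.leadingCoeff.natDegree) →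
        ∃ v' w' c' V W, Pair D a v' w' c' ∧ (c' = c ∨ c' = -c) ∧
          Algebra.adjoin k[X] {v', w'} = Algebra.adjoin k[X] {v, w} ∧
          MvPolynomial.map σ v' = pairHom f V ∧ MvPolynomial.map σ w' = pairHom f W ∧
          V.natDegree = 0 ∧ ((V.coeff 0).natDegree = 0 ∨ 0 < W.natDegree) := by
      intro v w c V W j h hv hw hn hm h1 h2 h3
      obtain ⟨r', hr'⟩ := exists_lex_lt h1 h2 h3
      obtain ⟨r, rfl⟩ := hσs r'
      have hw' : MvPolynomial.map σ (w - MvPolynomial.C r * v ^ j) = pairHom f (W - C (C (σ r)) * V ^ j) := by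
        rw [map_sub, map_mul, map_pow, MvPolynomial.map_C, hv, hw, map_sub, map_mul, map_pow, pairHom_C, yHom_C]
      have had : Algebra.adjoin k[X] {v, w - MvPolynomial.C r * v ^ j} = Algebra.adjoin k[X] {v, w} :=
        adjoin_pair_sub (mul_mem (Subalgebra.algebraMap_mem _ r) (pow_mem (Algebra.subset_adjoin (by simp)) _))
      rw [← had]
      rcases hr' with hr' | ⟨hr', hr''⟩
      · exact ihn _ (by omega) _ _ _ _ _ _ (h.sub_pow r j) hv hw' rfl rfl
      · exact ihm _ (by omega) _ _ _ _ _ (h.sub_pow r j) hv hw' (by omega) rfl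
    intro v w c V W h hv hw hn hm
    by_cases hterm : V.natDegree = 0 ∧ ((V.coeff 0).natDegree = 0 ∨ 0 < W.natDegree)
    · exact ⟨v, w, c, V, W, h, Or.inl rfl, rfl, hv, hw, hterm⟩
    by_cases hterm' : W.natDegree = 0 ∧ ((W.coeff 0).natDegree = 0 ∨ 0 < V.natDegree)
    · exact ⟨w, v, -c, W, V, h.swap, Or.inr rfl, by rw [Set.pair_comm], hw, hv, hterm'⟩
    have hVW : 0 < V.natDegree ∧ 0 < W.natDegree ∨ (V.natDegree = 0 ∧ W.natDegree = 0) ∧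
        0 < V.leadingCoeff.natDegree ∧ 0 < W.leadingCoeff.natDegree := by
      by_cases hV0 : V.natDegree = 0
      · by_cases hW0 : W.natDegree = 0
        · rw [leadingCoeff, leadingCoeff, hV0, hW0]
          omega
        · omega
      · omega
    rcases exists_mul_of_forall_dvd (F := fun N => curve κ b N f) hdeg hVW
      (fun N => by
        rw [← curve_pairHom, ← curve_pairHom, ← hv, ← hw]
        exact h.natDegree_dvd ht ha hD hP σ hσ b N)
      (fun N => by
        rw [← curve_pairHom, ← curve_pairHom, ← hv, ← hw]
        exact h.swap.natDegree_dvd ht ha hD hP σ hσ b N) with ⟨j, h1, h2⟩ | ⟨j, h1, h2⟩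
    · exact step v w c V W j h hv hw hn hm h1 h2 (by omega)
    · obtain ⟨v', w', c', V', W', h3, h4, h5, h6⟩ := step w v (-c) W V j h.swap hw hv (by omega) (by omega) h1 h2 (by omega)
      refine ⟨v', w', c', V', W', h3, ?_, ?_, h6⟩
      · rw [neg_neg] at h4; exact h4.symm
      · rw [h5, Set.pair_comm]
  obtain ⟨V, hV⟩ := hf.exists_eq v (by rw [h.map_left, map_zero])
  obtain ⟨W, hW⟩ := hf.exists_eq w (by rw [h.map_right, map_zero])
  exact key _ _ v w c V W h hV hW rfl rfl

end
end Polynomial.GaProper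

namespace Polynomial.GaProper
open Polynomial

theorem exists_residue.{u} {k : Type u} [Field k] [CharZero k] {π : k[X]} (hπ : Irreducible π) :
    ∃ (κ : Type u) (_ : Field κ) (_ : CharZero κ) (σ : k[X] →+* κ), Function.Surjective σ ∧
      ∀ r, σ r = 0 ↔ π ∣ r := by
  have : (Ideal.span {π}).IsMaximal := PrincipalIdealRing.isMaximal_of_irreducible hπ
  let := Ideal.Quotient.field (Ideal.span {π})
  refine ⟨k[X] ⧸ Ideal.span {π}, inferInstance, ?_, Ideal.Quotient.mk _, Ideal.Quotient.mk_surjective,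
    fun r => by rw [Ideal.Quotient.eq_zero_iff_mem, Ideal.mem_span_singleton]⟩
  exact charZero_of_injective_ringHom ((Ideal.Quotient.mk (Ideal.span {π})).comp (C : k →+* k[X])).injective

theorem map_aeval_pair {K L : Type*} [CommRing K] [CommRing L] (σ : K →+* L) (v w : MvPolynomial (Fin 3) K)
    (P : MvPolynomial (Fin 2) K) : MvPolynomial.map σ (MvPolynomial.aeval ![v, w] P) =
      MvPolynomial.aeval ![MvPolynomial.map σ v, MvPolynomial.map σ w] (MvPolynomial.map σ P) := by
  induction P using MvPolynomial.induction_on with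
  | C c => simp
  | add f g hf hg => rw [map_add, map_add, hf, hg, map_add, map_add]
  | mul_X f i hf =>
    rw [map_mul, map_mul, hf, map_mul, map_mul, MvPolynomial.map_X, MvPolynomial.aeval_X, MvPolynomial.aeval_X]
    fin_cases i <;> rfl

section
variable {L : Type*} [Field L]

theorem pderiv_yHom {i : Fin 3} (hi : i ≠ 0) (P : L[X]) : MvPolynomial.pderiv i (yHom L P) = 0 := by
  rw [derivation_yHom, MvPolynomial.pderiv_X_of_ne hi.symm, mul_zero]

theorem pderiv_zero_yHom (P : L[X]) : MvPolynomial.pderiv 0 (yHom L P) = yHom L (derivative P) := by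
  rw [derivation_yHom, MvPolynomial.pderiv_X_self, mul_one]

theorem pderiv_pairHom {i : Fin 3} (hi : i ≠ 0) (f : MvPolynomial (Fin 3) L) (W : L[X][X]) :
    MvPolynomial.pderiv i (pairHom f W) = pairHom f (derivative W) * MvPolynomial.pderiv i f := by
  obtain ⟨g, hg⟩ := derivation_pairHom (MvPolynomial.pderiv i) f W
  rw [hg, MvPolynomial.pderiv_X_of_ne hi.symm, mul_zero, zero_add]

theorem pairHom_injective {f : MvPolynomial (Fin 3) L} {b : Bool} {e : ℕ}
    (hf : ∀ N, (curve L b N f).natDegree = N + e) : Function.Injective (pairHom f) := by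
  rw [injective_iff_map_eq_zero]
  intro V hV
  by_contra hV0
  obtain ⟨N, hN⟩ := natDegree_eval_of_large hV0 hf
  exact (hN N le_rfl).1 (by rw [← curve_pairHom, hV, map_zero])

variable [CharZero L]

theorem natDegree_eq_one_of_isUnit_derivative {V : L[X]} (h : IsUnit (derivative V)) : V.natDegree = 1 := by
  have h1 := natDegree_eq_zero_of_isUnit h
  rw [natDegree_derivative] at h1
  have h2 : V.natDegree ≠ 0 := fun h2 => h.ne_zero (derivative_of_natDegree_zero h2)
  omega

/-- If the derivative of `V` is a unit then the first variable is an affine function of `V`. -/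
theorem mem_of_isUnit_derivative {V : L[X]} (h : IsUnit (yHom L (derivative V)))
    {T : Subalgebra L (MvPolynomial (Fin 3) L)} (hV : yHom L V ∈ T) : MvPolynomial.X 0 ∈ T := by
  have h1 : IsUnit (derivative V) := by
    have := h.map (curve L true 0)
    rwa [curve_yHom] at this
  obtain ⟨α, β, rfl⟩ := exists_eq_X_add_C_of_natDegree_le_one (natDegree_eq_one_of_isUnit_derivative h1).le
  have hα : α ≠ 0 := by
    rintro rfl
    simp at h1
  rw [map_add, map_mul, yHom_C, yHom_C, yHom_X] at hV
  have h2 := T.smul_mem (sub_mem hV (T.algebraMap_mem β)) α⁻¹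
  rwa [← MvPolynomial.algebraMap_eq, add_sub_cancel_right, ← Algebra.smul_def, smul_smul, inv_mul_cancel₀ hα,
    one_smul] at h2

theorem mem_of_isUnit_pairHom_derivative {f : MvPolynomial (Fin 3) L} {W : L[X][X]} {b : Bool} {e : ℕ}
    (hf : ∀ N, (curve L b N f).natDegree = N + e) (h : IsUnit (pairHom f (derivative W)))
    {T : Subalgebra L (MvPolynomial (Fin 3) L)} (h0 : MvPolynomial.X 0 ∈ T) (hW : pairHom f W ∈ T) : f ∈ T := by
  have hW0 : derivative W ≠ 0 := by
    intro h1
    rw [h1, map_zero] at h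
    exact not_isUnit_zero h
  obtain ⟨N, hN⟩ := natDegree_eval_of_large hW0 hf
  have h1 := (hN (N + 1) (by omega)).2
  have h2 := natDegree_eq_zero_of_isUnit (h.map (curve L b (N + 1)))
  rw [curve_pairHom] at h2
  rw [h2] at h1
  have h3 : (derivative W).natDegree = 0 := by
    have h4 : (N + 1 + e) * (derivative W).natDegree = 0 := by omega
    exact (mul_eq_zero.1 h4).resolve_left (by omega)
  have h4 : (derivative W).leadingCoeff.natDegree = 0 := by omega
  rw [leadingCoeff, h3] at h4
  rw [natDegree_derivative] at h3
  obtain ⟨α, β, rfl⟩ := exists_eq_X_add_C_of_natDegree_le_one (p := W) (by omega)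
  have hα : α ≠ 0 := by
    rintro rfl
    simp at hW0
  have h5 : α.natDegree = 0 := by simpa using h4
  rw [natDegree_eq_zero] at h5
  obtain ⟨γ, rfl⟩ := h5
  have hγ : γ ≠ 0 := by simpa using hα
  rw [map_add, map_mul, pairHom_C, pairHom_C, pairHom_X, yHom_C] at hW
  have h2 := T.smul_mem (sub_mem hW (yHom_mem_of_mem h0 β)) γ⁻¹
  rwa [← MvPolynomial.algebraMap_eq, add_sub_cancel_right, ← Algebra.smul_def, smul_smul, inv_mul_cancel₀ hγ,
    one_smul] at h2

end

section
variable {k : Type*} [Field k] [CharZero k]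
  {D : Derivation k[X] (MvPolynomial (Fin 3) k[X]) (MvPolynomial (Fin 3) k[X])} {a c : k[X]} {p : k[X][X]}
  {q : k[X][X][X]} {v w : MvPolynomial (Fin 3) k[X]}

section
variable {κ : Type*} [Field κ] [CharZero κ] {σ : k[X] →+* κ} {f : MvPolynomial (Fin 3) κ}

theorem Pair.map_jac_q (h : Pair D a v w c) (ht : Triangular D a p q) (ha : a ≠ 0) {V : κ[X]} {W : κ[X][X]}
    (hv : MvPolynomial.map σ v = yHom κ V) (hw : MvPolynomial.map σ w = pairHom f W) :
    yHom κ (derivative V) * pairHom f (derivative W) * MvPolynomial.pderiv 1 f =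
      MvPolynomial.C (σ c) * pairHom (MvPolynomial.X 1) (q.map (mapRingHom σ)) := by
  have := congrArg (MvPolynomial.map σ) (h.jac_q ht ha)
  rw [map_sub, map_mul, map_mul, ← MvPolynomial.pderiv_map, ← MvPolynomial.pderiv_map, ← MvPolynomial.pderiv_map,
    ← MvPolynomial.pderiv_map, hv, hw, map_mul, MvPolynomial.map_C, map_pairHom, pderiv_zero_yHom,
    pderiv_yHom (by decide), pderiv_pairHom (by decide), MvPolynomial.map_X] at this
  linear_combination this

theorem Pair.map_jac_p (h : Pair D a v w c) (ht : Triangular D a p q) (ha : a ≠ 0) {V : κ[X]} {W : κ[X][X]}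
    (hv : MvPolynomial.map σ v = yHom κ V) (hw : MvPolynomial.map σ w = pairHom f W) :
    -(yHom κ (derivative V) * pairHom f (derivative W) * MvPolynomial.pderiv 2 f) =
      MvPolynomial.C (σ c) * yHom κ (p.map σ) := by
  have := congrArg (MvPolynomial.map σ) (h.jac_p ht ha)
  rw [map_sub, map_mul, map_mul, ← MvPolynomial.pderiv_map, ← MvPolynomial.pderiv_map, ← MvPolynomial.pderiv_map,
    ← MvPolynomial.pderiv_map, hv, hw, map_mul, MvPolynomial.map_C, map_yHom, pderiv_zero_yHom,
    pderiv_yHom (i := 2) (by decide), pderiv_pairHom (i := 2) (by decide)] at this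
  linear_combination this

/-- A prime factor of the Jacobian can be removed. -/
theorem Pair.exists_div (h : Pair D a v w c) (ht : Triangular D a p q) (ha : a ≠ 0)
    (hD : IsLocNilp D) (hP : Proper D hD) {π : k[X]} (hσs : Function.Surjective σ) (hσ : ∀ r, σ r = 0 ↔ π ∣ r)
    (hπ : Prime π) (hc : π ∣ c) : ∃ v' w' c', Pair D a v' w' c' ∧ Associated c (π * c') := by
  obtain ⟨M, hM⟩ := h.dvd
  have hσa : σ a = 0 := (hσ a).2 (hπ.dvd_of_dvd_pow (hc.trans hM))
  obtain ⟨f, hf⟩ := ht.exists_fibre σ (ht.one_mem_fixedIdeal hP) hσa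
  obtain ⟨v, w, c', V, W, h, hcc', -, hv, hw, hV, hVW⟩ := h.exists_reduced ht ha hD hP hσs hσa hf
  have hc' : π ∣ c' := by rcases hcc' with rfl | rfl; exacts [hc, (dvd_neg).2 hc]
  have hass : Associated c c' := by
    rcases hcc' with rfl | rfl
    exacts [Associated.refl _, (Associated.refl c).neg_right]
  obtain ⟨V, rfl⟩ := natDegree_eq_zero.1 hV
  rw [coeff_C_zero] at hVW
  rw [pairHom_C] at hv
  by_cases hV0 : V.natDegree = 0
  · obtain ⟨r', rfl⟩ := natDegree_eq_zero.1 hV0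
    obtain ⟨r, rfl⟩ := hσs r'
    have h1 := h.swap.sub_pow r 0
    have h2 : MvPolynomial.map σ (v - MvPolynomial.C r * w ^ 0) = 0 := by
      rw [pow_zero, mul_one, map_sub, hv, yHom_C, MvPolynomial.map_C, sub_self]
    rw [← MvPolynomial.C_dvd_iff_map_hom_eq_zero σ π hσ] at h2
    obtain ⟨v', hv'⟩ := h2
    rw [hv'] at h1
    obtain ⟨c'', rfl⟩ := hc'
    rw [← mul_neg] at h1
    exact ⟨_, _, _, h1.div, by rw [mul_neg]; exact hass.neg_right⟩
  · exfalso
    obtain ⟨b, e, hdeg⟩ := hf.degree_curve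
    have hσc : σ c' = 0 := (hσ _).2 hc'
    have hq := h.map_jac_q ht ha hv hw
    have hp := h.map_jac_p ht ha hv hw
    rw [hσc, map_zero, zero_mul] at hq hp
    have h1 : yHom κ (derivative V) ≠ 0 := by
      rw [map_ne_zero_iff _ yHom_injective]
      intro h0
      exact hV0 (derivative_eq_zero.1 h0)
    have h2 : pairHom f (derivative W) ≠ 0 := by
      rw [map_ne_zero_iff _ (pairHom_injective hdeg)]
      intro h0
      have := derivative_eq_zero.1 h0
      omega
    rcases hf.pderiv_ne with h3 | h3
    · exact mul_ne_zero (mul_ne_zero h1 h2) h3 hq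
    · exact mul_ne_zero (mul_ne_zero h1 h2) h3 (neg_eq_zero.1 hp)

/-- Over a singular fibre every constant is a polynomial in the two invariants when their Jacobian is a
unit. -/
theorem Pair.exists_map_eq (h : Pair D a v w c) (ht : Triangular D a p q) (ha : a ≠ 0)
    (hD : IsLocNilp D) (hP : Proper D hD) (hσs : Function.Surjective σ) (hσa : σ a = 0)
    (hc : IsUnit c) {g : MvPolynomial (Fin 3) k[X]} (hg : MvPolynomial.map σ (D g) = 0) :
    ∃ G ∈ Algebra.adjoin k[X] {v, w}, MvPolynomial.map σ G = MvPolynomial.map σ g := by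
  have hone := ht.one_mem_fixedIdeal hP
  obtain ⟨f, hf⟩ := ht.exists_fibre σ hone hσa
  obtain ⟨v, w, c', V, W, h, hcc', had, hv, hw, hV, hVW⟩ := h.exists_reduced ht ha hD hP hσs hσa hf
  rw [← had]
  have hc' : IsUnit c' := by rcases hcc' with rfl | rfl; exacts [hc, hc.neg]
  obtain ⟨V, rfl⟩ := natDegree_eq_zero.1 hV
  rw [pairHom_C] at hv
  obtain ⟨b, e, hdeg⟩ := hf.degree_curve
  have hq := h.map_jac_q ht ha hv hw
  have hp := h.map_jac_p ht ha hv hw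
  obtain ⟨x, y, z, hxyz⟩ := (mem_fixedIdeal _).1 (one_mem_fixedIdeal_map σ hone)
  rw [hσa, map_zero, mul_zero, zero_add] at hxyz
  have hunit : IsUnit (yHom κ (derivative V) * pairHom f (derivative W)) := by
    obtain ⟨d, hd⟩ := (hc'.map (MvPolynomial.C.comp σ : k[X] →+* MvPolynomial (Fin 3) κ)).exists_left_inv
    rw [RingHom.comp_apply] at hd
    refine IsUnit.of_mul_eq_one (d * (z * MvPolynomial.pderiv 1 f - y * MvPolynomial.pderiv 2 f)) ?_
    linear_combination d * z * hq + d * y * hp - d * MvPolynomial.C (σ c') * hxyz + hd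
  rw [IsUnit.mul_iff] at hunit
  obtain ⟨U, hU⟩ := hf.exists_eq g hg
  have h0 : MvPolynomial.X 0 ∈ Algebra.adjoin κ {MvPolynomial.map σ v, MvPolynomial.map σ w} :=
    mem_of_isUnit_derivative hunit.1 (hv ▸ Algebra.subset_adjoin (by simp))
  have h1 : f ∈ Algebra.adjoin κ {MvPolynomial.map σ v, MvPolynomial.map σ w} :=
    mem_of_isUnit_pairHom_derivative hdeg hunit.2 h0 (hw ▸ Algebra.subset_adjoin (by simp))
  obtain ⟨P', hP'⟩ := mem_adjoin_pair.1 (pairHom_mem_of_mem h0 h1 U)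
  obtain ⟨P, rfl⟩ := MvPolynomial.map_surjective σ hσs P'
  refine ⟨MvPolynomial.aeval ![v, w] P, mem_adjoin_pair.2 ⟨P, rfl⟩, ?_⟩
  rw [hU, ← hP', map_aeval_pair]

end

theorem Pair.map_eq_zero_of_mem (h : Pair D a v w c) {x : MvPolynomial (Fin 3) k[X]}
    (hx : x ∈ Algebra.adjoin k[X] {v, w}) : D x = 0 := by
  induction hx using Algebra.adjoin_induction with
  | mem x hx =>
    rcases hx with rfl | rfl
    exacts [h.map_left, h.map_right]
  | algebraMap r => exact D.map_algebraMap r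
  | add x y _ _ hx hy => rw [map_add, hx, hy, add_zero]
  | mul x y _ _ hx hy => rw [D.leibniz, hx, hy, smul_zero, smul_zero, add_zero]

theorem Triangular.exists_unit_pair (ht : Triangular D a p q) (ha : a ≠ 0) (hD : IsLocNilp D)
    (hP : Proper D hD) : ∃ v w c, Pair D a v w c ∧ IsUnit c := by
  obtain ⟨v, w, c, h⟩ := ht.exists_pair ha
  have key : ∀ v w c', Associated c' c → Pair D a v w c' → ∃ v w c, Pair D a v w c ∧ IsUnit c := by
    clear h
    induction c using WfDvdMonoid.induction_on_irreducible with
    | zero =>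
      intro v w c' hc' h
      exact absurd ((associated_zero_iff_eq_zero c').1 hc') h.ne_zero
    | unit u hu =>
      intro v w c' hc' h
      exact ⟨v, w, c', h, hc'.symm.isUnit hu⟩
    | mul r π hr hπ ih =>
      intro v w c' hc' h
      obtain ⟨κ, _, _, σ, hσs, hσ⟩ := exists_residue hπ
      obtain ⟨v', w', c'', h', hc''⟩ := h.exists_div ht ha hD hP hσs hσ hπ.prime
        ((dvd_mul_right π r).trans hc'.symm.dvd)
      exact ih v' w' c'' ((hc''.symm.trans hc').of_mul_left (Associated.refl π) hπ.ne_zero) h'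
  exact key v w c (Associated.refl c) h

/-- If the Jacobian is a unit, the algebra generated by the two invariants is saturated. -/
theorem Pair.mem_adjoin_of_smul_mem (h : Pair D a v w c) (ht : Triangular D a p q) (ha : a ≠ 0)
    (hone : 1 ∈ fixedIdeal a p q) (hc : IsUnit c) {r : k[X]} (hr : r ≠ 0) {g : MvPolynomial (Fin 3) k[X]}
    (hg : MvPolynomial.C r * g ∈ Algebra.adjoin k[X] {v, w}) : g ∈ Algebra.adjoin k[X] {v, w} := by
  induction r using WfDvdMonoid.induction_on_irreducible generalizing g with
  | zero => exact absurd rfl hr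
  | unit u hu =>
    obtain ⟨u', hu'⟩ := hu.exists_left_inv
    have := (Algebra.adjoin k[X] {v, w}).smul_mem hg u'
    rwa [Algebra.smul_def, MvPolynomial.algebraMap_eq, ← mul_assoc, ← map_mul, hu', map_one, one_mul] at this
  | mul r π hr' hπ ih =>
    refine ih hr' ?_
    rw [map_mul, mul_assoc] at hg
    obtain ⟨κ, _, _, σ, hσs, hσ⟩ := exists_residue hπ
    obtain ⟨P, hP⟩ := mem_adjoin_pair.1 hg
    have hσc : (MvPolynomial.C (σ c) : MvPolynomial (Fin 3) κ) ≠ 0 := by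
      simpa using (hc.map σ).ne_zero
    have hinj : Function.Injective
        (MvPolynomial.aeval (R := κ) ![MvPolynomial.map σ v, MvPolynomial.map σ w]) := by
      by_contra hinj
      have h1 := mt (aeval_pair_injective (R := κ) (MvPolynomial.pderiv (1 : Fin 3)) (MvPolynomial.pderiv (2 : Fin 3))
        (v := MvPolynomial.map σ v) (w := MvPolynomial.map σ w)) hinj
      have h2 := mt (aeval_pair_injective (R := κ) (MvPolynomial.pderiv (2 : Fin 3)) (MvPolynomial.pderiv (0 : Fin 3))
        (v := MvPolynomial.map σ v) (w := MvPolynomial.map σ w)) hinj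
      have h3 := mt (aeval_pair_injective (R := κ) (MvPolynomial.pderiv (0 : Fin 3)) (MvPolynomial.pderiv (1 : Fin 3))
        (v := MvPolynomial.map σ v) (w := MvPolynomial.map σ w)) hinj
      simp only [not_not, MvPolynomial.pderiv_map, ← map_mul, ← map_sub, h.jac, h.jac_p ht ha,
        h.jac_q ht ha] at h1 h2 h3
      simp only [map_mul, MvPolynomial.map_C, map_yHom, map_pairHom, mul_eq_zero, hσc, false_or] at h1 h2 h3
      obtain ⟨x, y, z, hxyz⟩ := (mem_fixedIdeal _).1 (one_mem_fixedIdeal_map σ hone)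
      rw [h1, h2] at hxyz
      rw [MvPolynomial.map_X] at h3
      rw [h3] at hxyz
      simp at hxyz
    have h1 : MvPolynomial.map σ P = 0 := by
      rw [← map_eq_zero_iff _ hinj, ← map_aeval_pair, hP, map_mul, MvPolynomial.map_C, (hσ π).2 dvd_rfl, map_zero, zero_mul]
    rw [← MvPolynomial.C_dvd_iff_map_hom_eq_zero σ π hσ] at h1
    obtain ⟨Q, rfl⟩ := h1
    rw [map_mul, MvPolynomial.aeval_C, MvPolynomial.algebraMap_eq] at hP
    rw [← mul_left_cancel₀ (by simpa using hπ.ne_zero) hP]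
    exact mem_adjoin_pair.2 ⟨Q, rfl⟩

/-- If the Jacobian is a unit, the two invariants generate the constants. -/
theorem Pair.mem_adjoin (h : Pair D a v w c) (ht : Triangular D a p q) (ha : a ≠ 0) (hD : IsLocNilp D)
    (hone : 1 ∈ fixedIdeal a p q) (hc : IsUnit c) {g : MvPolynomial (Fin 3) k[X]} (hg : D g = 0) :
    g ∈ Algebra.adjoin k[X] {v, w} := by
  obtain ⟨r, hr, hrg⟩ := h.mem_sat g
  refine h.mem_adjoin_of_smul_mem ht ha hone hc hr ?_
  set A := Algebra.adjoin k[X] {v, w} with hA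
  have h1 : Algebra.adjoin k[X] {v, w, MvPolynomial.X 0} ≤
      ((aeval (R := A) (MvPolynomial.X 0 : MvPolynomial (Fin 3) k[X])).restrictScalars k[X]).range := by
    refine Algebra.adjoin_le ?_
    rintro x (rfl | rfl | rfl)
    · exact ⟨C ⟨x, Algebra.subset_adjoin (by simp)⟩, by simp⟩
    · exact ⟨C ⟨x, Algebra.subset_adjoin (by simp)⟩, by simp⟩
    · exact ⟨X, by simp⟩
  obtain ⟨P, hP⟩ := h1 hrg
  change aeval (R := A) (MvPolynomial.X 0 : MvPolynomial (Fin 3) k[X]) P = r • g at hP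
  rw [← MvPolynomial.algebraMap_eq, ← Algebra.smul_def]
  have hE := congrArg (expHom D hD) hP
  have h2 : (expHom D hD).comp (algebraMap A (MvPolynomial (Fin 3) k[X])) =
      C.comp (algebraMap A (MvPolynomial (Fin 3) k[X])) :=
    RingHom.ext fun x => expHom_of_eq_zero D hD (h.map_eq_zero_of_mem x.2)
  rw [aeval_def, hom_eval₂, h2, expHom_of_map_eq_zero D hD (by rw [ht.map_y, derivation_C]), ht.map_y,
    expHom_of_eq_zero D hD (by rw [D.map_smul, hg, smul_zero]), ← eval₂_map, ← comp] at hE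
  have h3 := congrArg natDegree hE
  rw [natDegree_comp, natDegree_C, add_comm, natDegree_linear (by simpa using ha), mul_one,
    natDegree_map_eq_of_injective (FaithfulSMul.algebraMap_injective A _), natDegree_eq_zero] at h3
  obtain ⟨x, rfl⟩ := h3
  rw [aeval_C] at hP
  rw [← hP]
  exact x.2

/-- An element with derivative in the coefficients can be divided by the prime factors of its derivative. -/
theorem Pair.exists_slice (h : Pair D a v w c) (ht : Triangular D a p q) (ha : a ≠ 0) (hD : IsLocNilp D)
    (hP : Proper D hD) (hc : IsUnit c) : ∃ s, D s = 1 := by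
  have key : ∀ r, r ∣ a → ∀ g, D g = MvPolynomial.C r → ∃ s, D s = 1 := by
    intro r
    induction r using WfDvdMonoid.induction_on_irreducible with
    | zero => exact fun h0 => absurd (zero_dvd_iff.1 h0) ha
    | unit u hu =>
      intro _ g hg
      obtain ⟨u', hu'⟩ := hu.exists_left_inv
      refine ⟨MvPolynomial.C u' * g, ?_⟩
      rw [D.leibniz, derivation_C, hg, smul_zero, add_zero, smul_eq_mul, ← map_mul, hu', map_one]
    | mul r π hr hπ ih =>
      intro hra g hg
      obtain ⟨κ, _, _, σ, hσs, hσ⟩ := exists_residue hπ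
      obtain ⟨G, hG, hGg⟩ := h.exists_map_eq ht ha hD hP hσs ((hσ a).2 ((dvd_mul_right _ _).trans hra)) hc (g := g)
        (by rw [hg, map_mul, map_mul, MvPolynomial.map_C, (hσ π).2 dvd_rfl, map_zero, zero_mul])
      have h1 : MvPolynomial.map σ (g - G) = 0 := by rw [map_sub, hGg, sub_self]
      rw [← MvPolynomial.C_dvd_iff_map_hom_eq_zero σ π hσ] at h1
      obtain ⟨g', hg'⟩ := h1
      refine ih ((dvd_mul_left _ _).trans hra) g' ?_
      have h2 := congrArg D hg'
      rw [map_sub, hg, h.map_eq_zero_of_mem hG, sub_zero, D.leibniz, derivation_C, smul_zero, add_zero,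
        smul_eq_mul, map_mul] at h2
      exact (mul_left_cancel₀ (by simpa using hπ.ne_zero) h2).symm
  exact key a dvd_rfl _ ht.map_y

end
end Polynomial.GaProper

namespace Polynomial.GaProper
open Polynomial

section
variable {k : Type*} [Field k] [CharZero k]

/-- A proper triangular derivation over the affine line has a slice, and its constants form a polynomial
ring in two variables. -/
theorem Triangular.exists_slice_and_generators
    {D : Derivation k[X] (MvPolynomial (Fin 3) k[X]) (MvPolynomial (Fin 3) k[X])} {a : k[X]} {p : k[X][X]}
    {q : k[X][X][X]} (ht : Triangular D a p q) (hD : IsLocNilp D) (hP : Proper D hD) :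
    ∃ s v w, D s = 1 ∧ Function.Injective (MvPolynomial.aeval (R := k[X]) ![v, w]) ∧
      ∀ g, g ∈ Algebra.adjoin k[X] {v, w} ↔ D g = 0 := by
  have hone := ht.one_mem_fixedIdeal hP
  by_cases ha : a = 0
  · subst ha
    obtain ⟨f, s, hf, hs, hgen, hne, -⟩ := ht.exists_slice hone
    have h0 : D (MvPolynomial.X 0) = 0 := by rw [ht.map_y, map_zero]
    refine ⟨s, MvPolynomial.X 0, f, hs, ?_, fun g => ⟨fun hg => ?_, fun hg => ?_⟩⟩
    · rcases hne with h | h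
      · refine aeval_pair_injective (MvPolynomial.pderiv 0) (MvPolynomial.pderiv 1) ?_
        rwa [MvPolynomial.pderiv_X_self, MvPolynomial.pderiv_X_of_ne (by decide), one_mul, zero_mul, sub_zero]
      · refine aeval_pair_injective (MvPolynomial.pderiv 0) (MvPolynomial.pderiv 2) ?_
        rwa [MvPolynomial.pderiv_X_self, MvPolynomial.pderiv_X_of_ne (by decide), one_mul, zero_mul, sub_zero]
    · induction hg using Algebra.adjoin_induction with
      | mem x hx =>
        rcases hx with rfl | rfl
        exacts [h0, hf]
      | algebraMap r => exact D.map_algebraMap r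
      | add x y _ _ hx hy => rw [map_add, hx, hy, add_zero]
      | mul x y _ _ hx hy => rw [D.leibniz, hx, hy, smul_zero, smul_zero, add_zero]
    · obtain ⟨V, rfl⟩ := hgen g hg
      exact pairHom_mem_of_mem (Algebra.subset_adjoin (by simp)) (Algebra.subset_adjoin (by simp)) V
  · obtain ⟨v, w, c, h, hc⟩ := ht.exists_unit_pair ha hD hP
    obtain ⟨s, hs⟩ := h.exists_slice ht ha hD hP hc
    refine ⟨s, v, w, hs, ?_, fun g => ⟨h.map_eq_zero_of_mem, h.mem_adjoin ht ha hD hone hc⟩⟩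
    refine aeval_pair_injective (MvPolynomial.pderiv 1) (MvPolynomial.pderiv 2) ?_
    rw [h.jac]
    simpa using ⟨hc.ne_zero, ha⟩

/-- The first variable as a coefficient. -/
noncomputable def consEquiv (k : Type*) [Field k] (n : ℕ) :
    MvPolynomial (Fin (n + 1)) k ≃ₐ[k] MvPolynomial (Fin n) k[X] :=
  (MvPolynomial.renameEquiv k (finSuccEquiv n)).trans (MvPolynomial.optionEquivRight k (Fin n))

theorem consEquiv_zero (n : ℕ) : consEquiv k n (MvPolynomial.X 0) = MvPolynomial.C X := by
  simp [consEquiv]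

theorem consEquiv_succ (n : ℕ) (i : Fin n) : consEquiv k n (MvPolynomial.X i.succ) = MvPolynomial.X i := by
  simp [consEquiv]

variable (D : Derivation k (MvPolynomial (Fin 4) k) (MvPolynomial (Fin 4) k))

theorem map_consEquiv_symm_C (hx : D (MvPolynomial.X 0) = 0) (r : k[X]) :
    D ((consEquiv k 3).symm (MvPolynomial.C r)) = 0 := by
  have h1 : (consEquiv k 3).symm (MvPolynomial.C X) = MvPolynomial.X 0 := by
    rw [AlgEquiv.symm_apply_eq, consEquiv_zero]
  induction r using Polynomial.induction_on with
  | C c =>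
    have : (MvPolynomial.C (C c) : MvPolynomial (Fin 3) k[X]) = algebraMap k _ c := rfl
    rw [this, AlgEquiv.commutes, D.map_algebraMap]
  | add p q hp hq => rw [map_add, map_add, map_add, hp, hq, add_zero]
  | monomial n c h =>
    rw [pow_succ, ← mul_assoc, map_mul, map_mul, D.leibniz, h, h1, hx, smul_zero, smul_zero, add_zero]

/-- A derivation vanishing on the first variable, seen over the polynomials in this variable. -/
noncomputable def consDerivation (hx : D (MvPolynomial.X 0) = 0) :
    Derivation k[X] (MvPolynomial (Fin 3) k[X]) (MvPolynomial (Fin 3) k[X]) :=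
  Derivation.mk'
    { toFun := fun g => consEquiv k 3 (D ((consEquiv k 3).symm g))
      map_add' := fun x y => by rw [map_add, map_add, map_add]
      map_smul' := fun r x => by
        rw [Algebra.smul_def, map_mul, D.leibniz, MvPolynomial.algebraMap_eq, map_consEquiv_symm_C D hx, smul_zero,
          add_zero, smul_eq_mul, map_mul, AlgEquiv.apply_symm_apply, RingHom.id_apply, Algebra.smul_def,
          MvPolynomial.algebraMap_eq] }
    fun x y => by
      simp only [LinearMap.coe_mk, AddHom.coe_mk, smul_eq_mul]
      rw [map_mul, D.leibniz, map_add, smul_eq_mul, smul_eq_mul, map_mul, map_mul, AlgEquiv.apply_symm_apply,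
        AlgEquiv.apply_symm_apply]

theorem consDerivation_apply (hx : D (MvPolynomial.X 0) = 0) (g : MvPolynomial (Fin 4) k) :
    consDerivation D hx (consEquiv k 3 g) = consEquiv k 3 (D g) := by
  change consEquiv k 3 (D ((consEquiv k 3).symm (consEquiv k 3 g))) = _
  rw [AlgEquiv.symm_apply_apply]

theorem mem_of_mem_adjoin {S : Set (MvPolynomial (Fin 4) k)} {g : MvPolynomial (Fin 4) k}
    (hg : g ∈ Algebra.adjoin k S) {T : Subring (MvPolynomial (Fin 3) k[X])} (hC : ∀ r, MvPolynomial.C r ∈ T)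
    (hS : ∀ x ∈ S, consEquiv k 3 x ∈ T) : consEquiv k 3 g ∈ T := by
  induction hg using Algebra.adjoin_induction with
  | mem x hx => exact hS x hx
  | algebraMap r =>
    rw [AlgEquiv.commutes]
    exact hC (C r)
  | add x y _ _ hx hy => rw [map_add]; exact add_mem hx hy
  | mul x y _ _ hx hy => rw [map_mul]; exact mul_mem hx hy

theorem exists_triangular_consDerivation (hx : D (MvPolynomial.X 0) = 0)
    (hy : D (MvPolynomial.X 1) ∈ Algebra.adjoin k ({MvPolynomial.X 0} : Set (MvPolynomial (Fin 4) k)))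
    (hz : D (MvPolynomial.X 2) ∈ Algebra.adjoin k
      ({MvPolynomial.X 0, MvPolynomial.X 1} : Set (MvPolynomial (Fin 4) k)))
    (hu : D (MvPolynomial.X 3) ∈ Algebra.adjoin k
      ({MvPolynomial.X 0, MvPolynomial.X 1, MvPolynomial.X 2} : Set (MvPolynomial (Fin 4) k))) :
    ∃ a p q, Triangular (consDerivation D hx) a p q := by
  have h1 : consEquiv k 3 (MvPolynomial.X 1) = MvPolynomial.X 0 := consEquiv_succ 3 0
  have h2 : consEquiv k 3 (MvPolynomial.X 2) = MvPolynomial.X 1 := consEquiv_succ 3 1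
  have h3 : consEquiv k 3 (MvPolynomial.X 3) = MvPolynomial.X 2 := consEquiv_succ 3 2
  have hC : ∀ r, ∃ P, yHom k[X] P = MvPolynomial.C r := fun r => ⟨C r, yHom_C r⟩
  have hC' : ∀ P, ∃ Q, pairHom (MvPolynomial.X 1) Q = yHom k[X] P := fun P => ⟨C P, pairHom_C _ P⟩
  obtain ⟨a, ha⟩ : consEquiv k 3 (D (MvPolynomial.X 1)) ∈ (MvPolynomial.C : k[X] →+* MvPolynomial (Fin 3) k[X]).range := by
    refine mem_of_mem_adjoin hy (fun r => ⟨r, rfl⟩) ?_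
    rintro x rfl
    exact ⟨X, (consEquiv_zero 3).symm⟩
  obtain ⟨p, hp⟩ : consEquiv k 3 (D (MvPolynomial.X 2)) ∈ (yHom k[X]).range := by
    refine mem_of_mem_adjoin hz hC ?_
    rintro x (rfl | rfl)
    · rw [consEquiv_zero]; exact hC X
    · rw [h1]; exact ⟨X, yHom_X⟩
  obtain ⟨q, hq⟩ : consEquiv k 3 (D (MvPolynomial.X 3)) ∈ (pairHom (K := k[X]) (MvPolynomial.X 1)).range := by
    refine mem_of_mem_adjoin hu (fun r => ?_) ?_
    · rw [← yHom_C]; exact hC' _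
    · rintro x (rfl | rfl | rfl)
      · rw [consEquiv_zero, ← yHom_C]; exact hC' _
      · rw [h1, ← yHom_X]; exact hC' _
      · rw [h2]; exact ⟨X, pairHom_X _⟩
  refine ⟨a, p, q, ?_, ?_, ?_⟩
  · rw [← h1, consDerivation_apply, ha]
  · rw [← h2, consDerivation_apply, hp]
  · rw [← h3, consDerivation_apply, hq]

theorem proper_consDerivation (hx : D (MvPolynomial.X 0) = 0) (hD : IsLocNilp (consDerivation D hx))
    (hP : IsProperGaAction D) : Proper (consDerivation D hx) hD := by
  obtain ⟨m, f, g, N, hN, h⟩ := hP X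
  have hit : ∀ j x, (⇑(consDerivation D hx))^[j] (consEquiv k 3 x) = consEquiv k 3 ((⇑D)^[j] x) := fun j x =>
    ((Function.Semiconj.iterate_right (f := consEquiv k 3) (ga := D) (gb := consDerivation D hx)
      (fun x => (consDerivation_apply D hx x).symm) j) x).symm
  refine ⟨m, fun i => consEquiv k 3 (f i), fun i => consEquiv k 3 (g i), ?_⟩
  have h1 := congrArg (mapRingHom (consEquiv k 3 : MvPolynomial (Fin 4) k →+* MvPolynomial (Fin 3) k[X])) h
  rw [coe_mapRingHom, map_X, Polynomial.map_sum] at h1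
  rw [h1]
  refine Finset.sum_congr rfl fun i _ => ?_
  rw [Polynomial.map_mul, map_C, expHom_eq_sum (n := N) _ _ (by rw [hit, hN, map_zero]), expPoly, Polynomial.map_sum]
  congr 1
  refine Finset.sum_congr rfl fun j _ => ?_
  rw [Polynomial.map_mul, map_C, Polynomial.map_pow, map_X, hit, RingHom.coe_coe, _root_.map_rat_smul (consEquiv k 3)]

theorem mem_kerDer {R B : Type*} [CommRing R] [CommRing B] [Algebra R B] {D : Derivation R B B} {g : B} :
    g ∈ kerDer D ↔ D g = 0 := Iff.rfl

end
end Polynomial.GaProper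

theorem statement0 {k : Type*} [Field k] [CharZero k]
    (D : Derivation k (MvPolynomial (Fin 4) k) (MvPolynomial (Fin 4) k))
    -- triangularity: ∂x = 0, ∂y ∈ k[x], ∂z ∈ k[x,y], ∂u ∈ k[x,y,z]
    (hx : D (X 0) = 0)
    (hy : D (X 1) ∈ Algebra.adjoin k ({X 0} : Set (MvPolynomial (Fin 4) k)))
    (hz : D (X 2) ∈ Algebra.adjoin k ({X 0, X 1} : Set (MvPolynomial (Fin 4) k)))
    (hu : D (X 3) ∈ Algebra.adjoin k ({X 0, X 1, X 2} : Set (MvPolynomial (Fin 4) k)))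
    -- properness of the generated G_a-action
    (hproper : IsProperGaAction D) :
    -- the action is a translation:
    ∃ s : MvPolynomial (Fin 4) k, D s = 1 ∧
      Nonempty (↥(kerDer D) ≃ₐ[k] MvPolynomial (Fin 3) k) ∧
      Function.Bijective (Polynomial.aeval (R := ↥(kerDer D)) s) := by
  obtain ⟨a, p, q, ht⟩ := Polynomial.GaProper.exists_triangular_consDerivation D hx hy hz hu
  have hD := ht.isLocNilp
  obtain ⟨s, v, w, hs, hinj, hker⟩ := ht.exists_slice_and_generators hD
    (Polynomial.GaProper.proper_consDerivation D hx hD hproper)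
  have happ := Polynomial.GaProper.consDerivation_apply D hx
  set e := Polynomial.GaProper.consEquiv k 3
  have hs' : D (e.symm s) = 1 := e.injective (by rw [← happ, AlgEquiv.apply_symm_apply, hs, map_one])
  have hD' : Polynomial.GaProper.IsLocNilp D := by
    intro g
    obtain ⟨n, hn⟩ := hD (e g)
    refine ⟨n, e.injective ?_⟩
    rw [map_zero, ← hn]
    exact Function.Semiconj.iterate_right (f := e) (fun x => (happ x).symm) n g
  let Φ : MvPolynomial (Fin 2) (Polynomial k) →ₐ[k] MvPolynomial (Fin 4) k :=
    (e.symm : MvPolynomial (Fin 3) (Polynomial k) →ₐ[k] MvPolynomial (Fin 4) k).comp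
      ((aeval (R := Polynomial k) ![v, w]).restrictScalars k)
  have hΦ : Function.Injective Φ := e.symm.injective.comp hinj
  have hrange : Φ.range = kerDer D := by
    ext g
    rw [Polynomial.GaProper.mem_kerDer, ← map_eq_zero_iff e e.injective, ← happ, ← hker, Polynomial.GaProper.mem_adjoin_pair]
    refine exists_congr fun P => ?_
    exact e.symm_apply_eq
  exact ⟨e.symm s, hs',
    ⟨(Subalgebra.equivOfEq _ _ hrange.symm).trans
      ((AlgEquiv.ofInjective Φ hΦ).symm.trans (Polynomial.GaProper.consEquiv k 2).symm)⟩,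
    Polynomial.GaProper.aeval_slice_injective D (fun _ h => h) hs',
    Polynomial.GaProper.aeval_slice_surjective D hD' (fun _ => Iff.rfl) hs'⟩
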